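/- There exists a universal constant C > 0 with the following property: for every dimension n ≥ 1 and every pair of independent random vectors X and Y in ℝⁿ whose distributions have log-concave densities with respect to Lebesgue measure, there exist affine volume-preserving (hence entropy-preserving) maps u₁, u₂ : ℝⁿ → ℝⁿ such that, setting X̃ = u₁(X) and Ỹ = u₂(Y) (taken independent), one has N(X̃ + Ỹ) ≤ C · (N(X) + N(Y)). -/

import Mathlib

open MeasureTheory ProbabilityTheory Real Pointwise

/-- A nonnegative function on ℝⁿ is log-concave if
`f(tx + (1-t)y) ≥ f(x)^t f(y)^(1-t)` for all `x, y` and `t ∈ [0,1]`. -/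
def IsLogConcave {n : ℕ} (f : EuclideanSpace ℝ (Fin n) → ℝ) : Prop :=
  (∀ x, 0 ≤ f x) ∧
  ∀ x y : EuclideanSpace ℝ (Fin n), ∀ t : ℝ, 0 ≤ t → t ≤ 1 →
    f x ^ t * f y ^ (1 - t) ≤ f (t • x + (1 - t) • y)

/-- Differential (Shannon) entropy of a measure on ℝⁿ,
computed from its density w.r.t. Lebesgue measure: `h(μ) = -∫ p log p`. -/
noncomputable def dEnt {n : ℕ} (μ : Measure (EuclideanSpace ℝ (Fin n))) : ℝ :=
  -∫ x, ((μ.rnDeriv volume x).toReal) * Real.log ((μ.rnDeriv volume x).toReal)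

/-- Entropy power `N(μ) = exp(2 h(μ) / n)`. -/
noncomputable def entPow {n : ℕ} (μ : Measure (EuclideanSpace ℝ (Fin n))) : ℝ :=
  Real.exp (2 * dEnt μ / n)

section PartA
variable {E : Type*} [NormedAddCommGroup E] [InnerProductSpace ℝ E] [FiniteDimensional ℝ E]
  [MeasurableSpace E] [BorelSpace E]

/-- A regular strongly convex potential `ψ` with gradient `g` and its Hessian. -/
structure GoodPot (ψ : E → ℝ) (g : E → E) (g' : E → E →L[ℝ] E) (c d : ℝ) : Prop where
  cpos : 0 < c
  dpos : 0 < d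
  hψ : ∀ y, HasFDerivAt ψ (innerSL ℝ (g y)) y
  hg : ∀ y, HasFDerivAt g (g' y) y
  mono : ∀ y z, y ≠ z → 0 < inner ℝ (g y - g z) (y - z)
  coer : ∀ y, c * (‖y‖ ^ 2 + ‖g y‖ ^ 2) ≤ inner ℝ y (g y)
  quad : ∀ y, d * ‖y‖ ^ 2 ≤ ψ y

def PhiMap (g : E → E) (a b : ℝ) (z : E × E) : E × E :=
  (a • z.1 + b • z.2, a • g z.1 - b • g z.2)

noncomputable def dPhiMap (g' : E → E →L[ℝ] E) (a b : ℝ) (z : E × E) : E × E →L[ℝ] E × E :=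
  (a • ContinuousLinearMap.fst ℝ E E + b • ContinuousLinearMap.snd ℝ E E).prod
    (a • (g' z.1).comp (ContinuousLinearMap.fst ℝ E E)
      - b • (g' z.2).comp (ContinuousLinearMap.snd ℝ E E))

lemma hasFDerivAt_PhiMap {g : E → E} {g' : E → E →L[ℝ] E} (hg : ∀ y, HasFDerivAt g (g' y) y)
    (a b : ℝ) (z : E × E) : HasFDerivAt (PhiMap g a b) (dPhiMap g' a b z) z := by
  have h1 : HasFDerivAt (fun z : E × E => z.1) (ContinuousLinearMap.fst ℝ E E) z := hasFDerivAt_fst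
  have h2 : HasFDerivAt (fun z : E × E => z.2) (ContinuousLinearMap.snd ℝ E E) z := hasFDerivAt_snd
  have h3 := ((hg z.1).comp z h1).const_smul a
  have h4 := ((hg z.2).comp z h2).const_smul b
  exact ((h1.const_smul a).add (h2.const_smul b)).prodMk (h3.sub h4)

lemma PhiMap_injective {ψ : E → ℝ} {g : E → E} {g' : E → E →L[ℝ] E} {c d : ℝ}
    (G : GoodPot ψ g g' c d) {a b : ℝ} (ha : 0 < a) (hb : 0 < b) :
    Function.Injective (PhiMap g a b) := by
  rintro ⟨y1, y2⟩ ⟨z1, z2⟩ h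
  simp only [PhiMap, Prod.mk.injEq] at h
  obtain ⟨h1, h2⟩ := h
  have e1 : a • (y1 - z1) = -(b • (y2 - z2)) := by
    rw [smul_sub, smul_sub]
    have : a • y1 + b • y2 - (a • z1 + b • z2) = 0 := by rw [h1]; simp
    rw [← sub_eq_zero]; rw [← this]; abel
  have e2 : a • (g y1 - g z1) = b • (g y2 - g z2) := by
    rw [smul_sub, smul_sub]
    have : a • g y1 - b • g y2 - (a • g z1 - b • g z2) = 0 := by rw [h2]; simp
    rw [← sub_eq_zero]; rw [← this]; abel
  have key : a ^ 2 * inner ℝ (g y1 - g z1) (y1 - z1) + b ^ 2 * inner ℝ (g y2 - g z2) (y2 - z2)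
      = 0 := by
    have : inner ℝ (a • (g y1 - g z1)) (a • (y1 - z1)) =
        inner ℝ (b • (g y2 - g z2)) (-(b • (y2 - z2))) := by rw [e1, e2]
    simp only [inner_smul_left, inner_smul_right, inner_neg_right] at this
    simp only [conj_trivial] at this
    linarith
  have n1 : 0 ≤ inner ℝ (g y1 - g z1) (y1 - z1) := by
    by_cases h : y1 = z1
    · simp [h]
    · exact (G.mono _ _ h).le
  have n2 : 0 ≤ inner ℝ (g y2 - g z2) (y2 - z2) := by
    by_cases h : y2 = z2
    · simp [h]
    · exact (G.mono _ _ h).le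
  have m1 : y1 = z1 := by
    by_contra h
    have := G.mono _ _ h
    have : 0 < a ^ 2 * inner ℝ (g y1 - g z1) (y1 - z1) := by positivity
    have : 0 ≤ b ^ 2 * inner ℝ (g y2 - g z2) (y2 - z2) := by positivity
    linarith
  have m2 : y2 = z2 := by
    by_contra h
    have := G.mono _ _ h
    have : 0 < b ^ 2 * inner ℝ (g y2 - g z2) (y2 - z2) := by positivity
    have : 0 ≤ a ^ 2 * inner ℝ (g y1 - g z1) (y1 - z1) := by positivity
    linarith
  rw [m1, m2]

lemma PhiMap_surjective {ψ : E → ℝ} {g : E → E} {g' : E → E →L[ℝ] E} {c d : ℝ}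
    (G : GoodPot ψ g g' c d) {a b : ℝ} (ha : 0 < a) (hb : 0 < b) :
    Function.Surjective (PhiMap g a b) := by
  rintro ⟨s, t⟩
  set k : ℝ := b ^ 2 / a with hk
  have kpos : 0 < k := by positivity
  let m : E → E := fun y => b⁻¹ • (s - a • y)
  let h : E → ℝ := fun y => a * ψ y + k * ψ (m y) - inner ℝ t y
  have hmd : ∀ y, HasFDerivAt m (b⁻¹ • (-(a • ContinuousLinearMap.id ℝ E))) y := by
    intro y
    exact (((hasFDerivAt_id y).const_smul a).const_sub s).const_smul b⁻¹
  have hd : ∀ y, HasFDerivAt h (a • innerSL ℝ (g y)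
      + k • ((innerSL ℝ (g (m y))).comp (b⁻¹ • (-(a • ContinuousLinearMap.id ℝ E))))
      - innerSL ℝ t) y := by
    intro y
    exact ((((G.hψ y).const_mul a).add (((G.hψ (m y)).comp y (hmd y)).const_mul k))).sub
      (innerSL ℝ t).hasFDerivAt
  have hc : Continuous h := continuous_iff_continuousAt.2 fun y => (hd y).continuousAt
  have hlow : ∀ y, a * d * ‖y‖ ^ 2 - ‖t‖ * ‖y‖ ≤ h y := by
    intro y
    have h1 := G.quad y
    have h2 : 0 ≤ ψ (m y) := le_trans (by have := G.dpos; positivity) (G.quad (m y))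
    have h3 := real_inner_le_norm t y
    have h4 : a * (d * ‖y‖ ^ 2) ≤ a * ψ y := by gcongr
    have h5 : 0 ≤ k * ψ (m y) := by positivity
    simp only [h]; linarith
  have htend : Filter.Tendsto h (Filter.cocompact E) Filter.atTop := by
    have q : Filter.Tendsto (fun x : ℝ => a * d * x ^ 2 - ‖t‖ * x) Filter.atTop Filter.atTop := by
      have q1 : Filter.Tendsto (fun x : ℝ => x * (a * d * x - ‖t‖)) Filter.atTop Filter.atTop := by
        apply Filter.Tendsto.atTop_mul_atTop₀ Filter.tendsto_id
        have := G.dpos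
        exact Filter.tendsto_atTop_add_const_right _ _
          (Filter.Tendsto.const_mul_atTop (by positivity) Filter.tendsto_id)
      refine q1.congr fun x => by ring
    exact Filter.tendsto_atTop_mono hlow (q.comp (tendsto_norm_cocompact_atTop))
  obtain ⟨y, hy⟩ := hc.exists_forall_le htend
  have hmin : IsLocalMin h y := Filter.Eventually.of_forall hy
  have h0 := hmin.hasFDerivAt_eq_zero (hd y)
  refine ⟨(y, m y), ?_⟩
  have hgrad : a • g y - b • g (m y) = t := by
    apply ext_inner_right ℝ
    intro v
    have := congrArg (fun L => L v) h0
    simp only [ContinuousLinearMap.add_apply, ContinuousLinearMap.sub_apply,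
      ContinuousLinearMap.smul_apply, ContinuousLinearMap.comp_apply, innerSL_apply_apply,
      ContinuousLinearMap.neg_apply, ContinuousLinearMap.id_apply, smul_eq_mul,
      ContinuousLinearMap.zero_apply, inner_smul_right, inner_neg_right] at this
    rw [inner_sub_left, inner_smul_left, inner_smul_left]
    simp only [conj_trivial]
    have hkk : k * (b⁻¹ * a) = b := by rw [hk]; field_simp
    have : a * inner ℝ (g y) v - (k * (b⁻¹ * a)) * inner ℝ (g (m y)) v - inner ℝ t v = 0 := by
      rw [← this]; ring
    rw [hkk] at this; linarith
  simp only [PhiMap, Prod.mk.injEq]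
  refine ⟨?_, hgrad⟩
  simp only [m]
  rw [smul_smul, mul_inv_cancel₀ hb.ne', one_smul]; abel

lemma det_dPhiMap (g' : E → E →L[ℝ] E) (a b : ℝ) (z : E × E) :
    (dPhiMap g' a b z).det = (a * b) ^ (Module.finrank ℝ E) * (dPhiMap g' 1 1 z).det := by
  have h : ((dPhiMap g' a b z : E × E →L[ℝ] E × E) : E × E →ₗ[ℝ] E × E) =
      ((dPhiMap g' 1 1 z : E × E →L[ℝ] E × E) : E × E →ₗ[ℝ] E × E) ∘ₗ
        ((a • LinearMap.id).prodMap (b • LinearMap.id)) := by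
    ext v <;> simp [dPhiMap]
  rw [ContinuousLinearMap.det, h, LinearMap.det_comp, LinearMap.det_prodMap, LinearMap.det_smul,
    LinearMap.det_smul, ContinuousLinearMap.det]
  simp [mul_pow]; ring

lemma volume_prod_isAddHaar : (volume : Measure (E × E)).IsAddHaarMeasure :=
  inferInstanceAs ((volume : Measure E).prod (volume : Measure E)).IsAddHaarMeasure

lemma integral_comp_PhiMap {ψ : E → ℝ} {g : E → E} {g' : E → E →L[ℝ] E} {c d : ℝ}
    (G : GoodPot ψ g g' c d) {a b : ℝ} (ha : 0 < a) (hb : 0 < b) (hab : a * b = 1)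
    (F : E × E → ℂ) :
    ∫ z : E × E, |(dPhiMap g' 1 1 z).det| • F (PhiMap g a b z) = ∫ w, F w := by
  haveI := volume_prod_isAddHaar (E := E)
  have := integral_image_eq_integral_abs_det_fderiv_smul (volume : Measure (E × E))
    MeasurableSet.univ (fun z _ => (hasFDerivAt_PhiMap G.hg a b z).hasFDerivWithinAt)
    (PhiMap_injective G ha hb).injOn F
  rw [Set.image_univ, (PhiMap_surjective G ha hb).range_eq] at this
  simp only [Measure.restrict_univ, det_dPhiMap g' a b, hab, one_pow, one_mul] at this
  exact this.symm

lemma integrable_comp_PhiMap {ψ : E → ℝ} {g : E → E} {g' : E → E →L[ℝ] E} {c d : ℝ}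
    (G : GoodPot ψ g g' c d) (F : E × E → ℝ) (hF : Integrable F) :
    Integrable (fun z : E × E => |(dPhiMap g' 1 1 z).det| • F (PhiMap g 1 1 z)) := by
  haveI := volume_prod_isAddHaar (E := E)
  have := integrableOn_image_iff_integrableOn_abs_det_fderiv_smul (volume : Measure (E × E))
    MeasurableSet.univ (fun z _ => (hasFDerivAt_PhiMap G.hg 1 1 z).hasFDerivWithinAt)
    (PhiMap_injective G one_pos one_pos).injOn F
  rw [integrableOn_univ] at this
  exact this.1 hF.integrableOn
end PartA

lemma strip_bracket {c θ : ℝ} (hc : 0 < c) (hc2 : c ≤ 1 / 2) (h1 : -(c ^ 3 / 2) < θ) (h2 : θ < π / 2)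
    {W R : ℝ} (hW : 0 ≤ W) (hR1 : c * W ≤ R) (hR2 : R ≤ W / 2) :
    c ^ 3 * W ≤ c * Real.cos θ * W - c * (1 - 2 * c ^ 2) * W + 2 * Real.sin θ * R := by
  rcases le_or_gt 0 θ with h0 | h0
  · have hs : 0 ≤ Real.sin θ := Real.sin_nonneg_of_nonneg_of_le_pi h0 (by linarith [Real.pi_pos])
    have hco : 0 ≤ Real.cos θ := Real.cos_nonneg_of_mem_Icc ⟨by linarith [Real.pi_pos], h2.le⟩
    have hsc : 1 ≤ Real.sin θ + Real.cos θ := by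
      nlinarith [Real.sin_sq_add_cos_sq θ, mul_nonneg hs hco]
    have e1 : 2 * Real.sin θ * (c * W) ≤ 2 * Real.sin θ * R := by gcongr
    have e2 : 0 ≤ c * W * (Real.sin θ + Real.cos θ - 1) := by
      apply mul_nonneg (by positivity); linarith
    have e3 : 0 ≤ Real.sin θ * (c * W) := by positivity
    have e4 : 0 ≤ c ^ 3 * W := by positivity
    nlinarith
  · have hc3 : c ^ 3 ≤ 1 := pow_le_one₀ hc.le (by linarith)
    have hs : θ ≤ Real.sin θ := Real.le_sin h0.le
    have hs0 : Real.sin θ ≤ 0 := Real.sin_nonpos_of_nonpos_of_neg_pi_le h0.le (by linarith [Real.pi_gt_three])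
    have hco : 1 - θ ^ 2 / 2 ≤ Real.cos θ := Real.one_sub_sq_div_two_le_cos
    have hco2 : 1 + θ ≤ Real.cos θ := by nlinarith
    have e1 : 2 * Real.sin θ * (W / 2) ≤ 2 * Real.sin θ * R := by nlinarith
    have e2 : θ * W ≤ Real.sin θ * W := by gcongr
    have e3 : c * W * (1 + θ) ≤ c * W * Real.cos θ := by gcongr
    have e4 : -(c ^ 3 / 2) * W ≤ θ * W := by gcongr
    have e5 : c * W * θ ≥ 1 * W * θ := by nlinarith [mul_nonneg hW (neg_nonneg.2 h0.le)]
    nlinarith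

section PartA
variable {E : Type*} [NormedAddCommGroup E] [InnerProductSpace ℝ E] [FiniteDimensional ℝ E]
  [MeasurableSpace E] [BorelSpace E]

/-- angle condition -/
lemma angle_cond {ψ : E → ℝ} {g : E → E} {g' : E → E →L[ℝ] E} {c d : ℝ}
    (G : GoodPot ψ g g' c d) (y1 y2 : E) {a b : ℝ} (hab : a * b = 1) :
    -(2 * (inner ℝ y1 y2 - inner ℝ (g y1) (g y2))) ≤
      (1 - 2 * c ^ 2) * (a ^ 2 * (‖y1‖ ^ 2 + ‖g y1‖ ^ 2) + b ^ 2 * (‖y2‖ ^ 2 + ‖g y2‖ ^ 2)) := by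
  have hc := G.cpos
  set W := a ^ 2 * (‖y1‖ ^ 2 + ‖g y1‖ ^ 2) + b ^ 2 * (‖y2‖ ^ 2 + ‖g y2‖ ^ 2) with hW
  set A := W + 2 * (inner ℝ y1 y2 - inner ℝ (g y1) (g y2)) with hA
  have hA' : A = ‖a • y1 + b • y2‖ ^ 2 + ‖a • g y1 - b • g y2‖ ^ 2 := by
    rw [norm_add_sq_real, norm_sub_sq_real]
    simp only [norm_smul, mul_pow, inner_smul_left, inner_smul_right, conj_trivial, Real.norm_eq_abs,
      sq_abs]
    rw [hA, hW]
    linear_combination -2 * (inner ℝ y1 y2 - inner ℝ (g y1) (g y2)) * hab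
  have hB' : 2 * W - A = ‖a • y1 - b • y2‖ ^ 2 + ‖a • g y1 + b • g y2‖ ^ 2 := by
    rw [norm_add_sq_real, norm_sub_sq_real]
    simp only [norm_smul, mul_pow, inner_smul_left, inner_smul_right, conj_trivial, Real.norm_eq_abs,
      sq_abs]
    rw [hA, hW]
    linear_combination 2 * (inner ℝ y1 y2 - inner ℝ (g y1) (g y2)) * hab
  have hsum : inner ℝ (a • y1 + b • y2) (a • g y1 + b • g y2)
      + inner ℝ (a • y1 - b • y2) (a • g y1 - b • g y2)
      = 2 * a ^ 2 * inner ℝ y1 (g y1) + 2 * b ^ 2 * inner ℝ y2 (g y2) := by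
    simp only [inner_add_left, inner_add_right, inner_sub_left, inner_sub_right, inner_smul_left,
      inner_smul_right, conj_trivial]
    ring
  have h1 := real_inner_le_norm (a • y1 + b • y2) (a • g y1 + b • g y2)
  have h2 := real_inner_le_norm (a • y1 - b • y2) (a • g y1 - b • g y2)
  have h3 : 2 * c * W ≤ 2 * a ^ 2 * inner ℝ y1 (g y1) + 2 * b ^ 2 * inner ℝ y2 (g y2) := by
    have := mul_le_mul_of_nonneg_left (G.coer y1) (sq_nonneg a)
    have := mul_le_mul_of_nonneg_left (G.coer y2) (sq_nonneg b)
    rw [hW]; linarith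
  set p := ‖a • y1 + b • y2‖
  set q := ‖a • g y1 - b • g y2‖
  set p' := ‖a • y1 - b • y2‖
  set q' := ‖a • g y1 + b • g y2‖
  have h4 : 2 * c * (p * q') ≤ p ^ 2 + c ^ 2 * q' ^ 2 := by nlinarith [sq_nonneg (p - c * q')]
  have h5 : 2 * c * (p' * q) ≤ q ^ 2 + c ^ 2 * p' ^ 2 := by nlinarith [sq_nonneg (q - c * p')]
  have h6 : 2 * c * (2 * c * W) ≤ A + c ^ 2 * (2 * W - A) := by
    have : 2 * c * (2 * c * W) ≤ 2 * c * (p * q' + p' * q) := by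
      gcongr; linarith
    have e1 : c ^ 2 * (2 * W - A) = c ^ 2 * (p' ^ 2 + q' ^ 2) := by rw [hB']
    rw [e1]; linarith [hA']
  have hA0 : 0 ≤ A := by rw [hA']; positivity
  have : 2 * c ^ 2 * W ≤ A := by nlinarith [mul_nonneg (sq_nonneg c) hA0]
  rw [hA] at this
  linarith

lemma coer_le_half {ψ : E → ℝ} {g : E → E} {g' : E → E →L[ℝ] E} {c d : ℝ}
    (G : GoodPot ψ g g' c d) (y : E) : inner ℝ y (g y) ≤ (‖y‖ ^ 2 + ‖g y‖ ^ 2) / 2 := by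
  have := real_inner_le_norm y (g y)
  nlinarith [sq_nonneg (‖y‖ - ‖g y‖)]

/-- the complex exponent -/
noncomputable def cExpo (g : E → E) (c : ℝ) (ζ : ℂ) (z : E × E) : ℂ :=
  -(1 / 2) * (Complex.exp (-ζ) * ((c * (‖z.1‖ ^ 2 + ‖g z.1‖ ^ 2) : ℝ) + (2 * inner ℝ z.1 (g z.1) : ℝ) * Complex.I)
    + Complex.exp ζ * ((c * (‖z.2‖ ^ 2 + ‖g z.2‖ ^ 2) : ℝ) - (2 * inner ℝ z.2 (g z.2) : ℝ) * Complex.I)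
    + 2 * ((c * (inner ℝ z.1 z.2 - inner ℝ (g z.1) (g z.2)) : ℝ)
      + (inner ℝ (g z.1) z.2 - inner ℝ z.1 (g z.2) : ℝ) * Complex.I))

noncomputable def cExpo' (g : E → E) (c : ℝ) (ζ : ℂ) (z : E × E) : ℂ :=
  -(1 / 2) * (-Complex.exp (-ζ) * ((c * (‖z.1‖ ^ 2 + ‖g z.1‖ ^ 2) : ℝ) + (2 * inner ℝ z.1 (g z.1) : ℝ) * Complex.I)
    + Complex.exp ζ * ((c * (‖z.2‖ ^ 2 + ‖g z.2‖ ^ 2) : ℝ) - (2 * inner ℝ z.2 (g z.2) : ℝ) * Complex.I))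

lemma hasDerivAt_cExpo (g : E → E) (c : ℝ) (ζ : ℂ) (z : E × E) :
    HasDerivAt (fun ζ => cExpo g c ζ z) (cExpo' g c ζ z) ζ := by
  have h1 : HasDerivAt (fun ζ : ℂ => Complex.exp (-ζ)) (-Complex.exp (-ζ)) ζ := by
    have := (hasDerivAt_neg ζ).cexp
    simpa using this
  have h2 := Complex.hasDerivAt_exp ζ
  unfold cExpo cExpo'
  exact (((h1.mul_const _).add (h2.mul_const _)).add_const _).const_mul _

lemma cExpo_re (g : E → E) (c x θ : ℝ) (z : E × E) :
    (cExpo g c (x + θ * Complex.I) z).re =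
     -(1 / 2) * (Real.exp (-x) * (c * (‖z.1‖ ^ 2 + ‖g z.1‖ ^ 2) * Real.cos θ + 2 * inner ℝ z.1 (g z.1) * Real.sin θ)
      + Real.exp x * (c * (‖z.2‖ ^ 2 + ‖g z.2‖ ^ 2) * Real.cos θ + 2 * inner ℝ z.2 (g z.2) * Real.sin θ)
      + 2 * (c * (inner ℝ z.1 z.2 - inner ℝ (g z.1) (g z.2)))) := by
  have e1 : Complex.exp (x + θ * Complex.I) = (Real.exp x * Real.cos θ : ℝ) + (Real.exp x * Real.sin θ : ℝ) * Complex.I := by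
    rw [Complex.exp_add, Complex.exp_mul_I]; push_cast; ring
  have e2 : Complex.exp (-(x + θ * Complex.I)) = (Real.exp (-x) * Real.cos θ : ℝ) - (Real.exp (-x) * Real.sin θ : ℝ) * Complex.I := by
    rw [neg_add, Complex.exp_add, ← neg_mul, Complex.exp_mul_I]; push_cast; simp; ring
  rw [cExpo, e1, e2]
  generalize inner ℝ z.1 (g z.1) = P
  generalize inner ℝ z.2 (g z.2) = Q
  generalize c * (‖z.1‖ ^ 2 + ‖g z.1‖ ^ 2) = U
  generalize c * (‖z.2‖ ^ 2 + ‖g z.2‖ ^ 2) = V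
  generalize c * (inner ℝ z.1 z.2 - inner ℝ (g z.1) (g z.2)) = S
  generalize inner ℝ (g z.1) z.2 - inner ℝ z.1 (g z.2) = X
  have e3 : (-(1/2) : ℂ) = ((-(1/2) : ℝ) : ℂ) := by push_cast; ring
  have e4 : (2 : ℂ) = ((2 : ℝ) : ℂ) := by norm_num
  rw [e3, e4]
  simp only [Complex.mul_re, Complex.add_re, Complex.add_im, Complex.sub_re, Complex.sub_im,
    Complex.mul_im, Complex.ofReal_re, Complex.ofReal_im, Complex.I_re, Complex.I_im]
  ring

/-- sum of squared norms -/
noncomputable def sqs (g : E → E) (z : E × E) : ℝ :=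
  (‖z.1‖ ^ 2 + ‖g z.1‖ ^ 2) + (‖z.2‖ ^ 2 + ‖g z.2‖ ^ 2)

lemma sqs_nonneg (g : E → E) (z : E × E) : 0 ≤ sqs g z := by unfold sqs; positivity

lemma exp_ge_third {x : ℝ} (h1 : -1 < x) : 1 / 3 ≤ Real.exp x := by
  have : Real.exp (-1) ≤ Real.exp x := Real.exp_le_exp.2 h1.le
  refine le_trans ?_ this
  rw [Real.exp_neg, one_div]
  exact inv_anti₀ (Real.exp_pos 1) (by linarith [Real.exp_one_lt_d9])

lemma cExpo_re_le {ψ : E → ℝ} {g : E → E} {g' : E → E →L[ℝ] E} {c d : ℝ}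
    (G : GoodPot ψ g g' c d) (hc2 : c ≤ 1 / 2) {x θ : ℝ} (hx1 : -1 < x) (hx2 : x < 1)
    (h1 : -(c ^ 3 / 2) < θ) (h2 : θ < π / 2) (z : E × E) :
    (cExpo g c (x + θ * Complex.I) z).re ≤ -(c ^ 3 / 6) * sqs g z := by
  rw [cExpo_re]
  have hc := G.cpos
  have a1 := angle_cond G z.1 z.2 (a := Real.exp (-x / 2)) (b := Real.exp (x / 2))
    (by rw [← Real.exp_add]; simp; ring)
  have ea : Real.exp (-x / 2) ^ 2 = Real.exp (-x) := by rw [← Real.exp_nat_mul]; congr 1; push_cast; ring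
  have eb : Real.exp (x / 2) ^ 2 = Real.exp (x) := by rw [← Real.exp_nat_mul]; congr 1; push_cast; ring
  rw [ea, eb] at a1
  have p1 := G.coer z.1
  have p2 := G.coer z.2
  have q1 := coer_le_half G z.1
  have q2 := coer_le_half G z.2
  unfold sqs
  set u := ‖z.1‖ ^ 2 + ‖g z.1‖ ^ 2 with hu
  set v := ‖z.2‖ ^ 2 + ‖g z.2‖ ^ 2 with hv
  have hu0 : 0 ≤ u := by positivity
  have hv0 : 0 ≤ v := by positivity
  have s1 := strip_bracket hc hc2 h1 h2 (W := Real.exp (-x) * u) (R := Real.exp (-x) * inner ℝ z.1 (g z.1))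
    (by positivity) (by have := mul_le_mul_of_nonneg_left p1 (Real.exp_pos (-x)).le; linarith)
    (by have := mul_le_mul_of_nonneg_left q1 (Real.exp_pos (-x)).le; linarith)
  have s2 := strip_bracket hc hc2 h1 h2 (W := Real.exp (x) * v) (R := Real.exp (x) * inner ℝ z.2 (g z.2))
    (by positivity) (by have := mul_le_mul_of_nonneg_left p2 (Real.exp_pos (x)).le; linarith)
    (by have := mul_le_mul_of_nonneg_left q2 (Real.exp_pos (x)).le; linarith)
  have t1 : c ^ 3 * (1 / 3 * u) ≤ c ^ 3 * (Real.exp (-x) * u) := by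
    gcongr; exact exp_ge_third (by linarith)
  have t2 : c ^ 3 * (1 / 3 * v) ≤ c ^ 3 * (Real.exp x * v) := by
    gcongr; exact exp_ge_third (by linarith)
  have a2 := mul_le_mul_of_nonneg_left a1 hc.le
  linarith

lemma cExpo'_norm_le {ψ : E → ℝ} {g : E → E} {g' : E → E →L[ℝ] E} {c d : ℝ}
    (G : GoodPot ψ g g' c d) (hc2 : c ≤ 1 / 2) {ζ : ℂ} (hx1 : -1 < ζ.re) (hx2 : ζ.re < 1)
    (z : E × E) : ‖cExpo' g c ζ z‖ ≤ 3 * sqs g z := by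
  have hc := G.cpos
  have p1 := G.coer z.1
  have p2 := G.coer z.2
  have q1 := coer_le_half G z.1
  have q2 := coer_le_half G z.2
  unfold sqs cExpo'
  set u := ‖z.1‖ ^ 2 + ‖g z.1‖ ^ 2 with hu
  set v := ‖z.2‖ ^ 2 + ‖g z.2‖ ^ 2 with hv
  have hu0 : 0 ≤ u := by positivity
  have hv0 : 0 ≤ v := by positivity
  have hP : 0 ≤ inner ℝ z.1 (g z.1) := le_trans (by positivity) p1
  have hQ : 0 ≤ inner ℝ z.2 (g z.2) := le_trans (by positivity) p2
  have b1 : ‖((c * u : ℝ) : ℂ) + (2 * inner ℝ z.1 (g z.1) : ℝ) * Complex.I‖ ≤ 2 * u := by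
    refine (norm_add_le _ _).trans ?_
    rw [norm_mul, Complex.norm_I, Complex.norm_real, Complex.norm_real, Real.norm_of_nonneg (by positivity),
      Real.norm_of_nonneg (by positivity)]
    nlinarith
  have b2 : ‖((c * v : ℝ) : ℂ) - (2 * inner ℝ z.2 (g z.2) : ℝ) * Complex.I‖ ≤ 2 * v := by
    refine (norm_sub_le _ _).trans ?_
    rw [norm_mul, Complex.norm_I, Complex.norm_real, Complex.norm_real, Real.norm_of_nonneg (by positivity),
      Real.norm_of_nonneg (by positivity)]
    nlinarith
  have e1 : ‖Complex.exp ζ‖ ≤ 3 := by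
    rw [Complex.norm_exp]
    have : Real.exp ζ.re ≤ Real.exp 1 := Real.exp_le_exp.2 hx2.le
    linarith [Real.exp_one_lt_d9]
  have e2 : ‖-Complex.exp (-ζ)‖ ≤ 3 := by
    rw [norm_neg, Complex.norm_exp]
    have : Real.exp (-ζ).re ≤ Real.exp 1 := Real.exp_le_exp.2 (by simp; linarith)
    linarith [Real.exp_one_lt_d9]
  rw [norm_mul]
  have e3 : ‖(-(1 / 2) : ℂ)‖ = 1 / 2 := by norm_num
  rw [e3]
  refine (mul_le_mul_of_nonneg_left (norm_add_le _ _) (by norm_num)).trans ?_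
  rw [norm_mul, norm_mul]
  have := mul_le_mul e1 b2 (norm_nonneg _) (by norm_num)
  have := mul_le_mul e2 b1 (norm_nonneg _) (by norm_num)
  linarith

end PartA

section PartA
variable {E : Type*} [NormedAddCommGroup E] [InnerProductSpace ℝ E] [FiniteDimensional ℝ E]
  [MeasurableSpace E] [BorelSpace E]

lemma integrable_gauss {b : ℝ} (hb : 0 < b) : Integrable (fun v : E => Real.exp (-b * ‖v‖ ^ 2)) := by
  have h := (GaussianFourier.integrable_cexp_neg_mul_sq_norm_add (V := E) (b := (b : ℂ))
    (by simpa using hb) 0 0).norm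
  refine h.congr (Filter.Eventually.of_forall fun v => ?_)
  simp only [Complex.norm_exp]
  congr 1
  simp [← Complex.ofReal_pow, ← Complex.ofReal_mul]

lemma integrable_gauss2 {b : ℝ} (hb : 0 < b) :
    Integrable (fun v : E × E => Real.exp (-b * (‖v.1‖ ^ 2 + ‖v.2‖ ^ 2))) := by
  have := (integrable_gauss (E := E) hb).mul_prod (integrable_gauss (E := E) hb)
  refine this.congr (Filter.Eventually.of_forall fun v => ?_)
  simp only [← Real.exp_add]
  congr 1; ring

/-- Gaussian-Fourier integrand -/
noncomputable def Jint (c : ℝ) (w : E × E) : ℂ :=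
  Complex.exp ((-(c / 2) * (‖w.1‖ ^ 2 + ‖w.2‖ ^ 2) : ℝ) - (inner ℝ w.1 w.2 : ℝ) * Complex.I)

lemma norm_Jint (c : ℝ) (w : E × E) : ‖Jint c w‖ = Real.exp (-(c / 2) * (‖w.1‖ ^ 2 + ‖w.2‖ ^ 2)) := by
  rw [Jint, Complex.norm_exp]
  congr 1
  rw [Complex.sub_re, Complex.ofReal_re, Complex.re_ofReal_mul, Complex.I_re]; ring

lemma Jint_integral_norm {c : ℝ} (hc : 0 < c) (hc2 : c ≤ 1 / 2) :
    4 ^ (Module.finrank ℝ E) ≤ ‖∫ w : E × E, Jint c w‖ := by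
  have hint : Integrable (Jint c : E × E → ℂ) := by
    refine (integrable_gauss2 (E := E) (b := c / 2) (by positivity)).mono' ?_ ?_
    · apply Continuous.aestronglyMeasurable
      unfold Jint; fun_prop
    · exact Filter.Eventually.of_forall fun w => (norm_Jint c w).le
  have hv : (volume : Measure (E × E)) = (volume : Measure E).prod volume := rfl
  rw [hv] at hint ⊢
  rw [integral_prod _ hint]
  have e1 : ∀ s : E, ∫ t : E, Jint c (s, t) =
      ((π / (c / 2 : ℝ) : ℂ)) ^ (Module.finrank ℝ E / 2 : ℂ) *
        Complex.exp (-((c / 2 + 1 / (2 * c) : ℝ) : ℂ) * ‖s‖ ^ 2) := by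
    intro s
    have := GaussianFourier.integral_cexp_neg_mul_sq_norm_add (V := E) (b := ((c / 2 : ℝ) : ℂ))
      (by rw [Complex.ofReal_re]; positivity) (-Complex.I) s
    have e : ∀ t : E, Jint c (s, t) = Complex.exp (-((c / 2 : ℝ) : ℂ) * ‖s‖ ^ 2) *
        Complex.exp (-((c / 2 : ℝ) : ℂ) * ‖t‖ ^ 2 + -Complex.I * (inner ℝ s t : ℝ)) := by
      intro t
      rw [Jint, ← Complex.exp_add]; congr 1; push_cast; ring
    simp_rw [e]
    rw [integral_const_mul]
    erw [this]
    rw [mul_left_comm, ← Complex.exp_add]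
    congr 2
    rw [neg_sq, Complex.I_sq]
    have : (c : ℂ) ≠ 0 := by exact_mod_cast hc.ne'
    push_cast; field_simp; ring
  simp_rw [e1]
  rw [integral_const_mul, GaussianFourier.integral_cexp_neg_mul_sq_norm
    (by rw [Complex.ofReal_re]; positivity), norm_mul, ← Complex.ofReal_div, ← Complex.ofReal_div,
    Complex.norm_cpow_eq_rpow_re_of_pos (by positivity), Complex.norm_cpow_eq_rpow_re_of_pos (by positivity)]
  have e2 : ((Module.finrank ℝ E / 2 : ℂ)).re = (Module.finrank ℝ E : ℝ) / 2 := by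
    rw [show (Module.finrank ℝ E / 2 : ℂ) = ((Module.finrank ℝ E / 2 : ℝ) : ℂ) by push_cast; rfl, Complex.ofReal_re]
  rw [e2, ← Real.mul_rpow (by positivity) (by positivity)]
  have e3 : (4 : ℝ) ^ (Module.finrank ℝ E) = (16 : ℝ) ^ ((Module.finrank ℝ E : ℝ) / 2) := by
    rw [show (16 : ℝ) = 4 ^ (2 : ℝ) by norm_num, ← Real.rpow_mul (by norm_num), ← Real.rpow_natCast]
    congr 1; ring
  rw [e3]
  apply Real.rpow_le_rpow (by norm_num) _ (by positivity)
  have e4 : π / (c / 2) * (π / (c / 2 + 1 / (2 * c))) = 4 * π ^ 2 / (c ^ 2 + 1) := by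
    field_simp; ring
  rw [e4, le_div_iff₀ (by positivity)]
  nlinarith [Real.pi_gt_three]

lemma measurable_det_dPhiMap {g : E → E} {g' : E → E →L[ℝ] E} (hg : ∀ y, HasFDerivAt g (g' y) y) :
    Measurable (fun z => (dPhiMap g' 1 1 z).det) := by
  have : dPhiMap g' 1 1 = fderiv ℝ (PhiMap g 1 1) := by
    ext1 z; exact (hasFDerivAt_PhiMap hg 1 1 z).fderiv.symm
  rw [this]
  exact ContinuousLinearMap.continuous_det.measurable.comp (measurable_fderiv ℝ _)

lemma cExpo_real (g : E → E) (c x : ℝ) (z : E × E) :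
    Complex.exp (cExpo g c x z) = Jint c (PhiMap g (Real.exp (-x / 2)) (Real.exp (x / 2)) z) := by
  rw [Jint]
  congr 1
  have ea : Real.exp (-x / 2) ^ 2 = Real.exp (-x) := by rw [← Real.exp_nat_mul]; congr 1; push_cast; ring
  have eb : Real.exp (x / 2) ^ 2 = Real.exp (x) := by rw [← Real.exp_nat_mul]; congr 1; push_cast; ring
  have hab : Real.exp (-x / 2) * Real.exp (x / 2) = 1 := by rw [← Real.exp_add]; simp; ring
  set a := Real.exp (-x / 2)
  set b := Real.exp (x / 2)
  have e1 : ‖(PhiMap g a b z).1‖ ^ 2 + ‖(PhiMap g a b z).2‖ ^ 2 =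
      Real.exp (-x) * (‖z.1‖ ^ 2 + ‖g z.1‖ ^ 2) + Real.exp x * (‖z.2‖ ^ 2 + ‖g z.2‖ ^ 2)
        + 2 * (inner ℝ z.1 z.2 - inner ℝ (g z.1) (g z.2)) := by
    simp only [PhiMap]
    rw [norm_add_sq_real, norm_sub_sq_real]
    simp only [norm_smul, mul_pow, inner_smul_left, inner_smul_right, conj_trivial, Real.norm_eq_abs,
      sq_abs]
    rw [← ea, ← eb]
    linear_combination 2 * (inner ℝ z.1 z.2 - inner ℝ (g z.1) (g z.2)) * hab
  have e2 : inner ℝ (PhiMap g a b z).1 (PhiMap g a b z).2 =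
      Real.exp (-x) * inner ℝ z.1 (g z.1) - Real.exp x * inner ℝ z.2 (g z.2)
        + (inner ℝ (g z.1) z.2 - inner ℝ z.1 (g z.2)) := by
    simp only [PhiMap, inner_add_left, inner_sub_right, inner_smul_left, inner_smul_right, conj_trivial]
    rw [← ea, ← eb, real_inner_comm (g z.1) z.2]
    linear_combination (inner ℝ (g z.1) z.2 - inner ℝ z.1 (g z.2)) * hab
  rw [e1, e2, cExpo]
  push_cast
  ring

lemma sqs_ge (g : E → E) (z : E × E) :
    (‖(PhiMap g 1 1 z).1‖ ^ 2 + ‖(PhiMap g 1 1 z).2‖ ^ 2) / 2 ≤ sqs g z := by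
  simp only [PhiMap, one_smul, sqs]
  have h1 := parallelogram_law_with_norm ℝ z.1 z.2
  have h2 := parallelogram_law_with_norm ℝ (g z.1) (g z.2)
  nlinarith [sq_nonneg ‖z.1 - z.2‖, sq_nonneg ‖g z.1 + g z.2‖]

lemma measurable_cExpo {g : E → E} (hg : Measurable g) (c : ℝ) (ζ : ℂ) :
    Measurable (fun z => cExpo g c ζ z) := by
  unfold cExpo; fun_prop

lemma measurable_cExpo' {g : E → E} (hg : Measurable g) (c : ℝ) (ζ : ℂ) :
    Measurable (fun z => cExpo' g c ζ z) := by
  unfold cExpo'; fun_prop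

theorem complex_lemma {ψ : E → ℝ} {g : E → E} {g' : E → E →L[ℝ] E} {c d : ℝ}
    (G : GoodPot ψ g g' c d) (hc2 : c ≤ 1 / 2) :
    (4 : ENNReal) ^ (Module.finrank ℝ E) ≤ ∫⁻ z : E × E,
      ENNReal.ofReal (Real.exp (-(1 / 2) * (inner ℝ z.1 (g z.1) + inner ℝ z.2 (g z.2))) *
        |(dPhiMap g' 1 1 z).det|) := by
  have hc := G.cpos
  have hgm : Measurable g := (continuous_iff_continuousAt.2 fun y => (G.hg y).continuousAt).measurable
  have hDm : Measurable (fun z => (((|(dPhiMap g' 1 1 z).det| : ℝ)) : ℂ)) :=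
    Complex.measurable_ofReal.comp (measurable_det_dPhiMap G.hg).abs
  set κ := c ^ 3 / 6 with hκ
  have κpos : 0 < κ := by positivity
  let U : Set ℂ := {ζ | (-1 < ζ.re ∧ ζ.re < 1) ∧ (-(c ^ 3 / 2) < ζ.im ∧ ζ.im < π / 2)}
  have hUopen : IsOpen U :=
    ((isOpen_lt continuous_const Complex.continuous_re).inter (isOpen_lt Complex.continuous_re continuous_const)).inter
    ((isOpen_lt continuous_const Complex.continuous_im).inter (isOpen_lt Complex.continuous_im continuous_const))
  have hUconv : Convex ℝ U := by
    have h1 : U = (Complex.reLm ⁻¹' Set.Ioo (-1) 1) ∩ (Complex.imLm ⁻¹' Set.Ioo (-(c^3/2)) (π/2)) := by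
      ext ζ; simp [U]
    rw [h1]
    exact ((convex_Ioo _ _).linear_preimage _).inter ((convex_Ioo _ _).linear_preimage _)
  let F : ℂ → E × E → ℂ := fun ζ z => ((|(dPhiMap g' 1 1 z).det| : ℝ) : ℂ) * Complex.exp (cExpo g c ζ z)
  let F' : ℂ → E × E → ℂ := fun ζ z => ((|(dPhiMap g' 1 1 z).det| : ℝ) : ℂ) *
    (Complex.exp (cExpo g c ζ z) * cExpo' g c ζ z)
  let bnd : E × E → ℝ := fun z => |(dPhiMap g' 1 1 z).det| •
    ((6 / κ + 1) * Real.exp (-(κ / 4) * (‖(PhiMap g 1 1 z).1‖ ^ 2 + ‖(PhiMap g 1 1 z).2‖ ^ 2)))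
  have hbnd : Integrable bnd := by
    exact integrable_comp_PhiMap G (fun w => (6 / κ + 1) * Real.exp (-(κ / 4) * (‖w.1‖ ^ 2 + ‖w.2‖ ^ 2)))
      ((integrable_gauss2 (by positivity)).const_mul _)
  have hre : ∀ ζ ∈ U, ∀ z, (cExpo g c ζ z).re ≤ -κ * sqs g z := by
    intro ζ hζ z
    have := cExpo_re_le G hc2 hζ.1.1 hζ.1.2 hζ.2.1 hζ.2.2 z
    rwa [Complex.re_add_im] at this
  have hg2 : ∀ z, Real.exp (-(κ / 2) * sqs g z) ≤
      Real.exp (-(κ / 4) * (‖(PhiMap g 1 1 z).1‖ ^ 2 + ‖(PhiMap g 1 1 z).2‖ ^ 2)) := by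
    intro z
    apply Real.exp_le_exp.2
    have := mul_le_mul_of_nonneg_left (sqs_ge g z) (show 0 ≤ κ / 2 by positivity)
    linarith
  have hFb : ∀ ζ ∈ U, ∀ z, ‖F ζ z‖ ≤ bnd z := by
    intro ζ hζ z
    simp only [F, bnd, norm_mul, Complex.norm_real, Real.norm_eq_abs, abs_abs, smul_eq_mul, Complex.norm_exp]
    gcongr
    have h0 := sqs_nonneg g z
    have h1 : Real.exp (cExpo g c ζ z).re ≤ Real.exp (-(κ / 2) * sqs g z) := by
      apply Real.exp_le_exp.2
      have := hre ζ hζ z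
      nlinarith [mul_nonneg κpos.le h0]
    have h2 := h1.trans (hg2 z)
    have h3 : 0 ≤ 6 / κ * Real.exp (-(κ / 4) * (‖(PhiMap g 1 1 z).1‖ ^ 2 + ‖(PhiMap g 1 1 z).2‖ ^ 2)) := by positivity
    linarith
  have hF'b : ∀ ζ ∈ U, ∀ z, ‖F' ζ z‖ ≤ bnd z := by
    intro ζ hζ z
    simp only [F', bnd, norm_mul, Complex.norm_real, Real.norm_eq_abs, abs_abs, smul_eq_mul, Complex.norm_exp]
    refine mul_le_mul_of_nonneg_left ?_ (abs_nonneg _)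
    have h0 := sqs_nonneg g z
    have h1 : Real.exp (cExpo g c ζ z).re ≤ Real.exp (-κ * sqs g z) := Real.exp_le_exp.2 (hre ζ hζ z)
    have h2 := cExpo'_norm_le G hc2 hζ.1.1 hζ.1.2 z
    have h3 : κ / 2 * sqs g z ≤ Real.exp (κ / 2 * sqs g z) := by
      have := Real.add_one_le_exp (κ / 2 * sqs g z); linarith
    have h4 : 3 * sqs g z ≤ 6 / κ * Real.exp (κ / 2 * sqs g z) := by
      rw [div_mul_eq_mul_div, le_div_iff₀ κpos]; linarith
    calc Real.exp (cExpo g c ζ z).re * ‖cExpo' g c ζ z‖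
        ≤ Real.exp (-κ * sqs g z) * (6 / κ * Real.exp (κ / 2 * sqs g z)) := by
          gcongr; exact h2.trans h4
      _ = 6 / κ * Real.exp (-(κ / 2) * sqs g z) := by
          rw [mul_left_comm, ← Real.exp_add]; congr 2; ring
      _ ≤ (6 / κ + 1) * Real.exp (-(κ / 4) * (‖(PhiMap g 1 1 z).1‖ ^ 2 + ‖(PhiMap g 1 1 z).2‖ ^ 2)) := by
          refine mul_le_mul ?_ (hg2 z) (Real.exp_pos _).le (by positivity)
          linarith
  have hFm : ∀ ζ, Measurable (F ζ) := fun ζ => hDm.mul (Complex.measurable_exp.comp (measurable_cExpo hgm c ζ))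
  have hF'm : ∀ ζ, Measurable (F' ζ) := fun ζ =>
    hDm.mul ((Complex.measurable_exp.comp (measurable_cExpo hgm c ζ)).mul (measurable_cExpo' hgm c ζ))
  let I : ℂ → ℂ := fun ζ => ∫ z, F ζ z
  have hI : DifferentiableOn ℂ I U := by
    intro ζ hζ
    have := hasDerivAt_integral_of_dominated_loc_of_deriv_le (μ := (volume : Measure (E × E))) (F := F) (F' := F')
      (x₀ := ζ) (s := U) (bound := bnd) (hUopen.mem_nhds hζ)
      (Filter.Eventually.of_forall fun ζ => (hFm ζ).aestronglyMeasurable)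
      (hbnd.mono' (hFm ζ).aestronglyMeasurable (Filter.Eventually.of_forall (hFb ζ hζ)))
      (hF'm ζ).aestronglyMeasurable
      (Filter.Eventually.of_forall fun z ξ hξ => hF'b ξ hξ z) hbnd
      (Filter.Eventually.of_forall fun z ξ _ => ((hasDerivAt_cExpo g c ξ z).cexp).const_mul _)
    exact this.2.differentiableAt.differentiableWithinAt
  have hIreal : ∀ x : ℝ, I x = ∫ w : E × E, Jint c w := by
    intro x
    rw [← integral_comp_PhiMap G (Real.exp_pos (-x / 2)) (Real.exp_pos (x / 2))
      (by rw [← Real.exp_add]; simp; ring) (Jint c)]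
    simp only [I, F, cExpo_real, Complex.real_smul]
  have h0U : (0 : ℂ) ∈ U := by
    refine ⟨⟨by simp, by simp⟩, ⟨?_, ?_⟩⟩
    · simp; positivity
    · simp; positivity
  have hfreq : ∃ᶠ z in nhdsWithin (0 : ℂ) {0}ᶜ, I z = (fun _ => ∫ w : E × E, Jint c w) z := by
    have ht : Filter.Tendsto (fun k : ℕ => (((1 / ((k : ℝ) + 1) : ℝ)) : ℂ)) Filter.atTop (nhdsWithin (0 : ℂ) {0}ᶜ) := by
      rw [tendsto_nhdsWithin_iff]
      constructor
      · have := (Complex.continuous_ofReal.tendsto 0).comp tendsto_one_div_add_atTop_nhds_zero_nat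
        simpa [Function.comp_def] using this
      · refine Filter.Eventually.of_forall fun k => ?_
        simp only [Set.mem_compl_iff, Set.mem_singleton_iff, Complex.ofReal_eq_zero]
        positivity
    exact ht.frequently (Filter.Frequently.of_forall fun k => hIreal _)
  have hEq := (hI.analyticOnNhd hUopen).eqOn_of_preconnected_of_frequently_eq
    (analyticOnNhd_const) hUconv.isPreconnected h0U hfreq
  have hπU : (((0 : ℝ) : ℂ) + (π / 4 : ℝ) * Complex.I) ∈ U := by
    have := Real.pi_pos
    refine ⟨⟨by simp, by simp⟩, ⟨?_, ?_⟩⟩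
    · simp; have : 0 < c ^ 3 := by positivity
      linarith
    · simp; linarith
  have h1 := hEq hπU
  simp only at h1
  have h2 := Jint_integral_norm (E := E) hc hc2
  rw [← h1] at h2
  calc (4 : ENNReal) ^ (Module.finrank ℝ E) = ENNReal.ofReal (4 ^ (Module.finrank ℝ E)) := by
        rw [ENNReal.ofReal_pow (by norm_num)]; norm_num
    _ ≤ ENNReal.ofReal ‖I (((0 : ℝ) : ℂ) + (π / 4 : ℝ) * Complex.I)‖ := ENNReal.ofReal_le_ofReal h2
    _ = ‖I (((0 : ℝ) : ℂ) + (π / 4 : ℝ) * Complex.I)‖ₑ := by rw [ofReal_norm_eq_enorm]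
    _ ≤ ∫⁻ z, ‖F (((0 : ℝ) : ℂ) + (π / 4 : ℝ) * Complex.I) z‖ₑ := enorm_integral_le_lintegral_enorm _
    _ ≤ _ := by
      apply lintegral_mono
      intro z
      simp only
      rw [← ofReal_norm_eq_enorm]
      apply ENNReal.ofReal_le_ofReal
      simp only [F, norm_mul, Complex.norm_real, Real.norm_eq_abs, abs_abs, Complex.norm_exp]
      rw [mul_comm]
      gcongr
      rw [cExpo_re, Real.cos_pi_div_four, Real.sin_pi_div_four]
      simp only [neg_zero, Real.exp_zero, one_mul]
      have p1 := G.coer z.1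
      have p2 := G.coer z.2
      have a1 := angle_cond G z.1 z.2 (a := 1) (b := 1) (by norm_num)
      have a2 := mul_le_mul_of_nonneg_left a1 hc.le
      have w1 : 1.4 ≤ √2 := Real.le_sqrt_of_sq_le (by norm_num)
      have w2 : √2 ≤ 1.5 := Real.sqrt_le_iff.2 (by norm_num)
      set u := ‖z.1‖ ^ 2 + ‖g z.1‖ ^ 2 with hu
      set v := ‖z.2‖ ^ 2 + ‖g z.2‖ ^ 2 with hv
      have hu0 : 0 ≤ u := by positivity
      have hv0 : 0 ≤ v := by positivity
      have hP : 0 ≤ inner ℝ z.1 (g z.1) := le_trans (by positivity) p1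
      have hQ : 0 ≤ inner ℝ z.2 (g z.2) := le_trans (by positivity) p2
      have : 0 ≤ c * (2 * c ^ 2) * (u + v) := by positivity
      have r1 : (1 - √2 / 2) * (c * u) ≤ (1 - √2 / 2) * inner ℝ z.1 (g z.1) := by
        apply mul_le_mul_of_nonneg_left p1; linarith
      have r2 : (1 - √2 / 2) * (c * v) ≤ (1 - √2 / 2) * inner ℝ z.2 (g z.2) := by
        apply mul_le_mul_of_nonneg_left p2; linarith
      have r3 : 1.4 * inner ℝ z.1 (g z.1) ≤ √2 * inner ℝ z.1 (g z.1) := by gcongr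
      have r4 : 1.4 * inner ℝ z.2 (g z.2) ≤ √2 * inner ℝ z.2 (g z.2) := by gcongr
      linarith
end PartA

section PartB
variable {E : Type*} [NormedAddCommGroup E] [InnerProductSpace ℝ E] [FiniteDimensional ℝ E]
  [MeasurableSpace E] [BorelSpace E]

/-- `exp(-ψ^*)` as an infimum. -/
noncomputable def Sfun (ψ : E → ℝ) (x : E) : ENNReal :=
  ⨅ y, ENNReal.ofReal (Real.exp (ψ y - inner ℝ x y))

lemma measurable_Sfun (ψ : E → ℝ) : Measurable (Sfun ψ) := by
  apply UpperSemicontinuous.measurable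
  apply upperSemicontinuous_iInf
  intro y
  apply Continuous.upperSemicontinuous
  exact ENNReal.continuous_ofReal.comp (by fun_prop)

lemma lintegral_comp_smul' (F : E → ENNReal) {r : ℝ} (hr : 0 < r) :
    ∫⁻ x, F (r • x) = ENNReal.ofReal ((r ^ Module.finrank ℝ E)⁻¹) * ∫⁻ x, F x := by
  have h := Measure.map_addHaar_smul (volume : Measure E) hr.ne'
  have hm : MeasurableEmbedding (fun x : E => r • x) :=
    (Homeomorph.smulOfNeZero r hr.ne').measurableEmbedding
  rw [← hm.lintegral_map F]
  rw [show (fun x : E => r • x) = (r • · : E → E) from rfl, h, lintegral_smul_measure, smul_eq_mul,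
    abs_of_pos (by positivity)]

lemma GoodPot.mono' {ψ : E → ℝ} {g : E → E} {g' : E → E →L[ℝ] E} {c d : ℝ}
    (G : GoodPot ψ g g' c d) (y z : E) : 0 ≤ inner ℝ (g y - g z) (y - z) := by
  by_cases h : y = z
  · simp [h]
  · exact (G.mono _ _ h).le

lemma GoodPot.tangent {ψ : E → ℝ} {g : E → E} {g' : E → E →L[ℝ] E} {c d : ℝ}
    (G : GoodPot ψ g g' c d) (y z : E) : ψ y + inner ℝ (g y) (z - y) ≤ ψ z := by
  have hd : ∀ t : ℝ, HasDerivAt (fun t : ℝ => ψ (y + t • (z - y))) (inner ℝ (g (y + t • (z - y))) (z - y)) t := by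
    intro t
    have h1 : HasDerivAt (fun t : ℝ => y + t • (z - y)) (z - y) t := by
      simpa using ((hasDerivAt_id t).smul_const (z - y)).const_add y
    have := (G.hψ (y + t • (z - y))).comp_hasDerivAt t h1
    rw [innerSL_apply_apply] at this
    exact this
  obtain ⟨t, ht, h⟩ := exists_hasDerivAt_eq_slope (fun t : ℝ => ψ (y + t • (z - y)))
    (fun t => inner ℝ (g (y + t • (z - y))) (z - y)) zero_lt_one
    (fun t _ => (hd t).continuousAt.continuousWithinAt) (fun t _ => hd t)
  simp only [zero_smul, add_zero, one_smul, add_sub_cancel, sub_zero, div_one] at h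
  have hm := G.mono' (y + t • (z - y)) y
  rw [add_sub_cancel_left, inner_smul_right, inner_sub_left] at hm
  have h3 : 0 ≤ inner ℝ (g (y + t • (z - y))) (z - y) - inner ℝ (g y) (z - y) :=
    by
    by_contra hh
    nlinarith [mul_neg_of_pos_of_neg ht.1 (not_le.1 hh)]
  linarith

lemma Sfun_grad {ψ : E → ℝ} {g : E → E} {g' : E → E →L[ℝ] E} {c d : ℝ}
    (G : GoodPot ψ g g' c d) (y : E) :
    Sfun ψ (g y) = ENNReal.ofReal (Real.exp (ψ y - inner ℝ (g y) y)) := by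
  apply le_antisymm
  · exact iInf_le _ y
  · refine le_iInf fun z => ENNReal.ofReal_le_ofReal (Real.exp_le_exp.2 ?_)
    have := G.tangent y z
    rw [inner_sub_right] at this; linarith

lemma PhiMap_pointwise {ψ : E → ℝ} {g : E → E} {g' : E → E →L[ℝ] E} {c d : ℝ}
    (G : GoodPot ψ g g' c d) (heven : ∀ y, ψ (-y) = ψ y) (z : E × E) :
    ENNReal.ofReal (Real.exp (-(1 / 2) * (inner ℝ z.1 (g z.1) + inner ℝ z.2 (g z.2)))) ≤
     ENNReal.ofReal (Real.exp (-ψ ((1 / 2 : ℝ) • (PhiMap g 1 1 z).1))) *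
      Sfun ψ ((1 / 2 : ℝ) • (PhiMap g 1 1 z).2) := by
  rw [Sfun, ENNReal.mul_iInf_of_ne (by simp [Real.exp_pos]) ENNReal.ofReal_ne_top]
  refine le_iInf fun y => ?_
  rw [← ENNReal.ofReal_mul (Real.exp_pos _).le, ← Real.exp_add]
  refine ENNReal.ofReal_le_ofReal (Real.exp_le_exp.2 ?_)
  simp only [PhiMap, one_smul]
  set p := (1 / 2 : ℝ) • (z.1 + z.2) with hp
  have h1 := G.tangent z.1 y
  have h2 := G.tangent z.2 (-y)
  rw [heven] at h2
  have h3 := G.tangent p z.1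
  have h4 := G.tangent p z.2
  have h5 : inner ℝ (g p) (z.1 - p) + inner ℝ (g p) (z.2 - p) = 0 := by
    rw [← inner_add_right]
    have : z.1 - p + (z.2 - p) = 0 := by
      rw [hp]; module
    rw [this, inner_zero_right]
  simp only [inner_sub_right, inner_neg_right] at h1 h2
  simp only [inner_smul_left, inner_sub_left, conj_trivial]
  rw [real_inner_comm (g z.1) z.1, real_inner_comm (g z.2) z.2]
  linarith

/-- The Blaschke–Santaló-reverse (Bourgain–Milman) inequality for even good potentials. -/
theorem BM_ineq {ψ : E → ℝ} {g : E → E} {g' : E → E →L[ℝ] E} {c d : ℝ}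
    (G : GoodPot ψ g g' c d) (hc2 : c ≤ 1 / 2) (heven : ∀ y, ψ (-y) = ψ y) :
    1 ≤ (∫⁻ y, ENNReal.ofReal (Real.exp (-ψ y))) * ∫⁻ x, Sfun ψ x := by
  haveI := volume_prod_isAddHaar (E := E)
  have hψc : Continuous ψ := continuous_iff_continuousAt.2 fun y => (G.hψ y).continuousAt
  set n := Module.finrank ℝ E
  have h := complex_lemma G hc2
  have h2 : ∫⁻ z : E × E,
      ENNReal.ofReal (Real.exp (-(1 / 2) * (inner ℝ z.1 (g z.1) + inner ℝ z.2 (g z.2))) *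
        |(dPhiMap g' 1 1 z).det|) ≤ ∫⁻ z : E × E, ENNReal.ofReal (|(dPhiMap g' 1 1 z).det|) *
        (fun w : E × E => ENNReal.ofReal (Real.exp (-ψ ((1 / 2 : ℝ) • w.1))) *
          Sfun ψ ((1 / 2 : ℝ) • w.2)) (PhiMap g 1 1 z) := by
    apply lintegral_mono
    intro z
    simp only
    rw [mul_comm, ENNReal.ofReal_mul (abs_nonneg _)]
    gcongr
    exact PhiMap_pointwise G heven z
  have h3 := lintegral_image_eq_lintegral_abs_det_fderiv_mul (volume : Measure (E × E))
    MeasurableSet.univ (fun z _ => (hasFDerivAt_PhiMap G.hg 1 1 z).hasFDerivWithinAt)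
    (PhiMap_injective G one_pos one_pos).injOn (fun w : E × E => ENNReal.ofReal (Real.exp (-ψ ((1 / 2 : ℝ) • w.1))) *
          Sfun ψ ((1 / 2 : ℝ) • w.2))
  rw [Set.image_univ, (PhiMap_surjective G one_pos one_pos).range_eq] at h3
  simp only [Measure.restrict_univ] at h3
  rw [← h3] at h2
  have hv : (volume : Measure (E × E)) = (volume : Measure E).prod volume := rfl
  rw [hv] at h2
  rw [lintegral_prod_mul (f := fun x => ENNReal.ofReal (Real.exp (-ψ ((1 / 2 : ℝ) • x))))
    (g := fun x => Sfun ψ ((1 / 2 : ℝ) • x)) (Measurable.aemeasurable (by fun_prop))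
    ((measurable_Sfun ψ).comp (measurable_const_smul _)).aemeasurable,
    lintegral_comp_smul' (fun x => ENNReal.ofReal (Real.exp (-ψ x))) (by norm_num : (0:ℝ) < 1 / 2),
    lintegral_comp_smul' (Sfun ψ) (by norm_num : (0:ℝ) < 1 / 2)] at h2
  have h4 := h.trans h2
  have e : ENNReal.ofReal ((((1 : ℝ) / 2) ^ n)⁻¹) = 2 ^ n := by
    rw [← inv_pow, one_div, inv_inv, ENNReal.ofReal_pow (by norm_num)]; norm_num
  rw [e, show (4 : ENNReal) = 2 * 2 by norm_num, mul_pow, mul_mul_mul_comm] at h4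
  by_contra hlt
  rw [not_le] at hlt
  have h22 : (2 : ENNReal) ^ n * 2 ^ n ≠ ⊤ := ENNReal.mul_ne_top (by simp) (by simp)
  have h20 : (2 : ENNReal) ^ n * 2 ^ n ≠ 0 := by simp
  have := ENNReal.mul_lt_mul_right h20 h22 hlt
  rw [mul_one] at this
  exact absurd h4 (not_le.2 this)

lemma GoodPot.inj {ψ : E → ℝ} {g : E → E} {g' : E → E →L[ℝ] E} {c d : ℝ}
    (G : GoodPot ψ g g' c d) : Function.Injective g := by
  intro y z h
  by_contra hne
  have := G.mono y z hne
  simp [h] at this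

lemma lintegral_grad_le {ψ : E → ℝ} {g : E → E} {g' : E → E →L[ℝ] E} {c d : ℝ}
    (G : GoodPot ψ g g' c d) :
    ∫⁻ y, ENNReal.ofReal |(g' y).det| * ENNReal.ofReal (Real.exp (ψ y - inner ℝ (g y) y)) ≤
      ∫⁻ x, Sfun ψ x := by
  have h3 := lintegral_image_eq_lintegral_abs_det_fderiv_mul (volume : Measure E)
    MeasurableSet.univ (fun z _ => (G.hg z).hasFDerivWithinAt) (G.inj).injOn (Sfun ψ)
  simp only [Measure.restrict_univ, Sfun_grad G] at h3
  rw [← h3]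
  exact setLIntegral_le_lintegral _ _
end PartB

section PartC
variable {E : Type*} [NormedAddCommGroup E] [InnerProductSpace ℝ E] [FiniteDimensional ℝ E]
  [MeasurableSpace E] [BorelSpace E]

noncomputable def Zf (μ : Measure E) (y : E) : ℝ := ∫ u, Real.exp (inner ℝ u y) ∂μ
noncomputable def Mf (μ : Measure E) (y : E) : E := ∫ u, Real.exp (inner ℝ u y) • u ∂μ
noncomputable def Qf (μ : Measure E) (y : E) : E →L[ℝ] E :=
  ∫ u, Real.exp (inner ℝ u y) • (innerSL ℝ u).smulRight u ∂μ
/-- tilted barycentre -/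
noncomputable def bf (μ : Measure E) (y : E) : E := (Zf μ y)⁻¹ • Mf μ y
noncomputable def covf (μ : Measure E) (y : E) : E →L[ℝ] E :=
  (Zf μ y)⁻¹ • Qf μ y - (innerSL ℝ (bf μ y)).smulRight (bf μ y)

variable {F : Type*} [NormedAddCommGroup F] [NormedSpace ℝ F] [CompleteSpace F] [SecondCountableTopology F]

lemma tilt_integrable {μ : Measure E} [IsProbabilityMeasure μ] {R : ℝ} (hR : ∀ᵐ u ∂μ, ‖u‖ ≤ R)
    {φ : E → F} (hφ : Continuous φ) {B : ℝ} (hB : ∀ u, ‖u‖ ≤ R → ‖φ u‖ ≤ B) (y : E) :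
    Integrable (fun u => Real.exp (inner ℝ u y) • φ u) μ := by
  have hm : AEStronglyMeasurable (fun u => Real.exp (inner ℝ u y) • φ u) μ :=
    (Continuous.aestronglyMeasurable (by fun_prop))
  refine Integrable.of_bound hm (Real.exp (R * ‖y‖) * B) ?_
  filter_upwards [hR] with u hu
  rw [norm_smul, Real.norm_eq_abs, abs_of_pos (Real.exp_pos _)]
  have := hB u hu
  gcongr
  exact (real_inner_le_norm u y).trans (by gcongr)

lemma tilt_hasFDerivAt {μ : Measure E} [IsProbabilityMeasure μ] {R : ℝ} (hR : ∀ᵐ u ∂μ, ‖u‖ ≤ R)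
    {φ : E → F} (hφ : Continuous φ) {B : ℝ} (hB : ∀ u, ‖u‖ ≤ R → ‖φ u‖ ≤ B) (y : E) :
    HasFDerivAt (fun y => ∫ u, Real.exp (inner ℝ u y) • φ u ∂μ)
      (∫ u, Real.exp (inner ℝ u y) • (innerSL ℝ u).smulRight (φ u) ∂μ) y := by
  apply hasFDerivAt_integral_of_dominated_of_fderiv_le (𝕜 := ℝ) (s := Metric.ball y 1)
    (F' := fun y u => Real.exp (inner ℝ u y) • (innerSL ℝ u).smulRight (φ u))
    (bound := fun _ => Real.exp (R * (‖y‖ + 1)) * (R * B)) (Metric.ball_mem_nhds y one_pos)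
  · exact Filter.Eventually.of_forall fun z => Continuous.aestronglyMeasurable (by fun_prop)
  · exact tilt_integrable hR hφ hB y
  · apply Continuous.aestronglyMeasurable
    have : Continuous (fun u : E => (innerSL ℝ u).smulRight (φ u)) := by
      have := (ContinuousLinearMap.smulRightL ℝ E F).continuous₂
      exact this.comp ((innerSL ℝ).continuous.prodMk hφ)
    have h2 : Continuous (fun u : E => Real.exp (inner ℝ u y)) := by fun_prop
    exact h2.smul this
  · filter_upwards [hR] with u hu z hz
    rw [norm_smul, Real.norm_eq_abs, abs_of_pos (Real.exp_pos _), ContinuousLinearMap.norm_smulRight_apply,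
      innerSL_apply_norm]
    have := hB u hu
    have hR0 : 0 ≤ R := (norm_nonneg u).trans hu
    gcongr
    refine (real_inner_le_norm u z).trans ?_
    gcongr
    have h1 : ‖z‖ ≤ ‖y‖ + ‖z - y‖ := by
      have := norm_add_le y (z - y); rwa [add_sub_cancel] at this
    have h2 : ‖z - y‖ < 1 := by rwa [Metric.mem_ball, dist_eq_norm] at hz
    linarith
  · exact integrable_const _
  · refine Filter.Eventually.of_forall fun u z _ => ?_
    have h1 : HasFDerivAt (fun z : E => inner ℝ u z) (innerSL ℝ u) z := (innerSL ℝ u).hasFDerivAt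
    have h2 := (h1.exp).smul_const (φ u)
    refine h2.congr_fderiv ?_
    ext v; simp [mul_smul]

lemma int_one {μ : Measure E} [IsProbabilityMeasure μ] {R : ℝ} (hR : ∀ᵐ u ∂μ, ‖u‖ ≤ R) (y : E) :
    Integrable (fun u => Real.exp (inner ℝ u y)) μ := by
  have := tilt_integrable hR (φ := fun _ => (1 : ℝ)) continuous_const (B := 1) (by simp) y
  simpa using this

lemma int_id {μ : Measure E} [IsProbabilityMeasure μ] {R : ℝ} (hR : ∀ᵐ u ∂μ, ‖u‖ ≤ R) (y : E) :
    Integrable (fun u => Real.exp (inner ℝ u y) • u) μ :=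
  tilt_integrable hR (φ := fun u => u) continuous_id (B := R) (fun u h => h) y

lemma cont_sr : Continuous (fun u : E => (innerSL ℝ u).smulRight u) := by
  have := (ContinuousLinearMap.smulRightL ℝ E E).continuous₂
  exact this.comp ((innerSL ℝ).continuous.prodMk continuous_id)

lemma int_sr {μ : Measure E} [IsProbabilityMeasure μ] {R : ℝ} (hR : ∀ᵐ u ∂μ, ‖u‖ ≤ R) (y : E) :
    Integrable (fun u => Real.exp (inner ℝ u y) • (innerSL ℝ u).smulRight u) μ := by
  refine tilt_integrable hR (φ := fun u => (innerSL ℝ u).smulRight u) cont_sr (B := R * R) (fun u h => ?_) y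
  rw [ContinuousLinearMap.norm_smulRight_apply, innerSL_apply_norm]
  have := (norm_nonneg u).trans h
  gcongr

lemma Zf_pos {μ : Measure E} [IsProbabilityMeasure μ] {R : ℝ} (hR : ∀ᵐ u ∂μ, ‖u‖ ≤ R) (y : E) :
    0 < Zf μ y := integral_exp_pos (int_one hR y)

lemma inner_Mf {μ : Measure E} [IsProbabilityMeasure μ] {R : ℝ} (hR : ∀ᵐ u ∂μ, ‖u‖ ≤ R) (y v : E) :
    inner ℝ (Mf μ y) v = ∫ u, Real.exp (inner ℝ u y) * inner ℝ u v ∂μ := by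
  rw [Mf, real_inner_comm, ← integral_inner (int_id hR y) v]
  congr 1; ext u; rw [inner_smul_right, real_inner_comm v u]

lemma Zf_hasFDerivAt {μ : Measure E} [IsProbabilityMeasure μ] {R : ℝ} (hR : ∀ᵐ u ∂μ, ‖u‖ ≤ R) (y : E) :
    HasFDerivAt (Zf μ) (innerSL ℝ (Mf μ y)) y := by
  have := tilt_hasFDerivAt hR (φ := fun _ => (1 : ℝ)) continuous_const (B := 1) (by simp) y
  have e1 : (fun y => ∫ u, Real.exp (inner ℝ u y) • (1 : ℝ) ∂μ) = Zf μ := by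
    ext y; simp [Zf]
  rw [e1] at this
  refine this.congr_fderiv ?_
  symm
  ext v
  rw [innerSL_apply_apply, inner_Mf hR]
  rw [ContinuousLinearMap.integral_apply]
  · congr 1; ext u; simp
  · refine (tilt_integrable hR (φ := fun u => (innerSL ℝ u).smulRight (1:ℝ)) ?_ (B := R) ?_ y)
    · have := (ContinuousLinearMap.smulRightL ℝ E ℝ).continuous₂
      exact this.comp ((innerSL ℝ).continuous.prodMk continuous_const)
    · intro u hu
      rw [ContinuousLinearMap.norm_smulRight_apply, innerSL_apply_norm]; simpa using hu

lemma Mf_hasFDerivAt {μ : Measure E} [IsProbabilityMeasure μ] {R : ℝ} (hR : ∀ᵐ u ∂μ, ‖u‖ ≤ R) (y : E) :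
    HasFDerivAt (Mf μ) (Qf μ y) y :=
  tilt_hasFDerivAt hR (φ := fun u => u) continuous_id (B := R) (fun u h => h) y

lemma bf_hasFDerivAt {μ : Measure E} [IsProbabilityMeasure μ] {R : ℝ} (hR : ∀ᵐ u ∂μ, ‖u‖ ≤ R) (y : E) :
    HasFDerivAt (bf μ) (covf μ y) y := by
  have hZ := Zf_pos hR y
  have h1 : HasFDerivAt (fun y => (Zf μ y)⁻¹) ((-(Zf μ y ^ 2)⁻¹) • innerSL ℝ (Mf μ y)) y :=
    (hasDerivAt_inv hZ.ne').comp_hasFDerivAt y (Zf_hasFDerivAt hR y)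
  have h2 := h1.smul (Mf_hasFDerivAt hR y)
  refine h2.congr_fderiv ?_
  symm
  ext v
  apply ext_inner_right ℝ
  intro w
  simp [covf, bf, inner_smul_left, inner_sub_left, inner_add_left]
  field_simp
  ring

lemma logZ_hasFDerivAt {μ : Measure E} [IsProbabilityMeasure μ] {R : ℝ} (hR : ∀ᵐ u ∂μ, ‖u‖ ≤ R) (y : E) :
    HasFDerivAt (fun y => Real.log (Zf μ y)) (innerSL ℝ (bf μ y)) y := by
  have := (Zf_hasFDerivAt hR y).log (Zf_pos hR y).ne'
  refine this.congr_fderiv ?_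
  simp [bf]

lemma norm_bf_le {μ : Measure E} [IsProbabilityMeasure μ] {R : ℝ} (hR : ∀ᵐ u ∂μ, ‖u‖ ≤ R) (y : E) :
    ‖bf μ y‖ ≤ R := by
  have hZ := Zf_pos hR y
  have h1 : ‖Mf μ y‖ ≤ R * Zf μ y := by
    rw [Mf, Zf, ← integral_const_mul]
    refine norm_integral_le_of_norm_le ((int_one hR y).const_mul R) ?_
    filter_upwards [hR] with u hu
    rw [norm_smul, Real.norm_eq_abs, abs_of_pos (Real.exp_pos _), mul_comm]
    gcongr
  rw [bf, norm_smul, norm_inv, Real.norm_eq_abs, abs_of_pos hZ, inv_mul_le_iff₀ hZ]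
  linarith

lemma norm_covf_le {μ : Measure E} [IsProbabilityMeasure μ] {R : ℝ} (hR : ∀ᵐ u ∂μ, ‖u‖ ≤ R) (y : E) :
    ‖covf μ y‖ ≤ 2 * R ^ 2 := by
  have hZ := Zf_pos hR y
  have h1 : ‖Qf μ y‖ ≤ R ^ 2 * Zf μ y := by
    rw [Qf, Zf, ← integral_const_mul]
    refine norm_integral_le_of_norm_le ((int_one hR y).const_mul _) ?_
    filter_upwards [hR] with u hu
    rw [norm_smul, Real.norm_eq_abs, abs_of_pos (Real.exp_pos _), mul_comm,
      ContinuousLinearMap.norm_smulRight_apply, innerSL_apply_norm, sq]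
    have := (norm_nonneg u).trans hu
    gcongr
  have hb := norm_bf_le hR y
  have hR0 : 0 ≤ R := (norm_nonneg _).trans hb
  rw [covf]
  refine (norm_sub_le _ _).trans ?_
  rw [norm_smul, norm_inv, Real.norm_eq_abs, abs_of_pos hZ, ContinuousLinearMap.norm_smulRight_apply, innerSL_apply_norm]
  have h2 : (Zf μ y)⁻¹ * ‖Qf μ y‖ ≤ R ^ 2 := by rw [inv_mul_le_iff₀ hZ]; linarith
  have h3 : ‖bf μ y‖ * ‖bf μ y‖ ≤ R * R := by gcongr
  nlinarith

lemma logZ_tangent {μ : Measure E} [IsProbabilityMeasure μ] {R : ℝ} (hR : ∀ᵐ u ∂μ, ‖u‖ ≤ R) (y z : E) :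
    Real.log (Zf μ y) + inner ℝ (bf μ y) (z - y) ≤ Real.log (Zf μ z) := by
  have hZ := Zf_pos hR y
  have hZz := Zf_pos hR z
  set a := inner ℝ (bf μ y) (z - y) with ha
  have hint2 : Integrable (fun u => Real.exp (inner ℝ u y) * inner ℝ u (z - y)) μ := by
    have := (int_id hR y).inner_const (𝕜 := ℝ) (z - y)
    refine this.congr (Filter.Eventually.of_forall fun u => ?_)
    simp [inner_smul_left]
  have h1 : Real.exp a * Zf μ y ≤ Zf μ z := by
    have e : Real.exp a * Zf μ y = ∫ u, Real.exp a * (Real.exp (inner ℝ u y) * (1 - a) +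
        Real.exp (inner ℝ u y) * inner ℝ u (z - y)) ∂μ := by
      rw [integral_const_mul, integral_add ((int_one hR y).mul_const _) hint2, integral_mul_const,
        ← inner_Mf hR, ← Zf]
      congr 1
      have : inner ℝ (Mf μ y) (z - y) = a * Zf μ y := by
        rw [ha, bf, inner_smul_left, conj_trivial]; field_simp
      rw [this]; ring
    rw [e]
    refine integral_mono ((((int_one hR y).mul_const _).add hint2).const_mul _) (int_one hR z) fun u => ?_
    simp only
    have h : inner ℝ u z = inner ℝ u y + inner ℝ u (z - y) := by rw [inner_sub_right]; ring
    rw [h, Real.exp_add]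
    have h2 : Real.exp a * (inner ℝ u (z - y) - a + 1) ≤ Real.exp (inner ℝ u (z - y)) := by
      have := Real.add_one_le_exp (inner ℝ u (z - y) - a)
      calc _ ≤ Real.exp a * Real.exp (inner ℝ u (z - y) - a) := by gcongr
        _ = _ := by rw [← Real.exp_add]; congr 1; ring
    have := mul_le_mul_of_nonneg_left h2 (Real.exp_pos (inner ℝ u y)).le
    linarith
  have h2 := Real.log_le_log (by positivity) h1
  rw [Real.log_mul (Real.exp_pos _).ne' hZ.ne', Real.log_exp] at h2
  linarith

lemma Zf_zero {μ : Measure E} [IsProbabilityMeasure μ] : Zf μ 0 = 1 := by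
  simp [Zf]

lemma bf_zero {μ : Measure E} [IsProbabilityMeasure μ] (hs : μ.map Neg.neg = μ) : bf μ 0 = 0 := by
  have h : Mf μ 0 = -Mf μ 0 := by
    simp only [Mf, inner_zero_right, Real.exp_zero, one_smul]
    conv_lhs => rw [← hs]
    have := (MeasurableEquiv.neg E).measurableEmbedding.integral_map (μ := μ) (fun u : E => u)
    erw [this]
    simp only [MeasurableEquiv.neg_apply]
    exact integral_neg (fun u => u)
  have h2 : Mf μ 0 = 0 := by
    have h3 : (2 : ℝ) • Mf μ 0 = 0 := by rw [two_smul]; nth_rewrite 2 [h]; simp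
    simpa using h3
  rw [bf, h2, smul_zero]

lemma Zf_even {μ : Measure E} (hs : μ.map Neg.neg = μ) (y : E) : Zf μ (-y) = Zf μ y := by
  have := (MeasurableEquiv.neg E).measurableEmbedding.integral_map (μ := μ) (fun u : E => Real.exp (inner ℝ u (-y)))
  rw [Zf]
  conv_lhs => rw [← hs]
  erw [this]
  simp [Zf]

lemma cov_quad {μ : Measure E} [IsProbabilityMeasure μ] {R : ℝ} (hR : ∀ᵐ u ∂μ, ‖u‖ ≤ R) (y v : E) :
    ∫ u, Real.exp (inner ℝ u y) * (inner ℝ (u - bf μ y) v) ^ 2 ∂μ = Zf μ y * inner ℝ (covf μ y v) v := by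
  have hZ := Zf_pos hR y
  have hint2 : Integrable (fun u => Real.exp (inner ℝ u y) * inner ℝ u v) μ := by
    have := (int_id hR y).inner_const (𝕜 := ℝ) v
    refine this.congr (Filter.Eventually.of_forall fun u => ?_)
    simp [inner_smul_left]
  have hQi := int_sr hR y
  have hQv : Integrable (fun u => (Real.exp (inner ℝ u y) • (innerSL ℝ u).smulRight u) v) μ :=
    hQi.apply_continuousLinearMap v
  have hint3 : Integrable (fun u => Real.exp (inner ℝ u y) * inner ℝ u v ^ 2) μ := by
    have := hQv.inner_const (𝕜 := ℝ) v
    refine this.congr (Filter.Eventually.of_forall fun u => ?_)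
    simp [inner_smul_left]; ring
  have hQ : inner ℝ (Qf μ y v) v = ∫ u, Real.exp (inner ℝ u y) * inner ℝ u v ^ 2 ∂μ := by
    rw [Qf, ContinuousLinearMap.integral_apply hQi, real_inner_comm, ← integral_inner hQv v]
    congr 1; ext u
    simp [inner_smul_right]; rw [real_inner_comm u v]; ring
  set β := inner ℝ (bf μ y) v with hβ
  have hM : inner ℝ (Mf μ y) v = Zf μ y * β := by
    rw [hβ, bf, inner_smul_left, conj_trivial]; field_simp
  have e : ∀ u, Real.exp (inner ℝ u y) * (inner ℝ (u - bf μ y) v) ^ 2 =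
      Real.exp (inner ℝ u y) * inner ℝ u v ^ 2 - (2 * β) * (Real.exp (inner ℝ u y) * inner ℝ u v)
        + β ^ 2 * Real.exp (inner ℝ u y) := by
    intro u; rw [inner_sub_left]; ring
  have hA : Integrable (fun u => Real.exp (inner ℝ u y) * inner ℝ u v ^ 2 -
      (2 * β) * (Real.exp (inner ℝ u y) * inner ℝ u v)) μ := hint3.sub (hint2.const_mul _)
  simp_rw [e]
  rw [integral_add hA ((int_one hR y).const_mul _),
    integral_sub hint3 (hint2.const_mul _), integral_const_mul, integral_const_mul, ← hQ, ← inner_Mf hR,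
    hM, ← Zf, covf]
  simp [inner_sub_left, inner_smul_left]
  rw [← hβ]
  field_simp
  ring

/-- The regularized log-Laplace transform is a good potential. -/
theorem logLaplace_goodPot {μ : Measure E} [IsProbabilityMeasure μ] {R : ℝ} (hR : ∀ᵐ u ∂μ, ‖u‖ ≤ R)
    (hs : μ.map Neg.neg = μ) {δ : ℝ} (hδ : 0 < δ) :
    ∃ c d, c ≤ 1 / 2 ∧ GoodPot (fun y => Real.log (Zf μ y) + δ / 2 * ‖y‖ ^ 2)
      (fun y => bf μ y + δ • y) (fun y => covf μ y + δ • ContinuousLinearMap.id ℝ E) c d := by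
  have hb0 := bf_zero hs
  have hlip : ∀ y, ‖bf μ y‖ ≤ 2 * R ^ 2 * ‖y‖ := by
    intro y
    have := convex_univ.norm_image_sub_le_of_norm_hasFDerivWithin_le (𝕜 := ℝ) (f := bf μ) (f' := covf μ)
      (C := 2 * R ^ 2) (fun x _ => (bf_hasFDerivAt hR x).hasFDerivWithinAt) (fun x _ => norm_covf_le hR x)
      (Set.mem_univ 0) (Set.mem_univ y)
    simpa [hb0] using this
  set L := 2 * R ^ 2 + δ with hL
  have hLpos : 0 < L := by positivity
  refine ⟨min (1 / 2) (δ / (1 + L ^ 2)), δ / 2, min_le_left _ _, ?_⟩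
  have hmono : ∀ y z, 0 ≤ inner ℝ (bf μ y - bf μ z) (y - z) := by
    intro y z
    have h1 := logZ_tangent hR y z
    have h2 := logZ_tangent hR z y
    rw [inner_sub_left]
    rw [← neg_sub y z, inner_neg_right] at h1
    linarith
  refine ⟨by positivity, by positivity, ?_, ?_, ?_, ?_, ?_⟩
  · intro y
    have h1 := (logZ_hasFDerivAt hR y).add (((hasStrictFDerivAt_norm_sq y).hasFDerivAt).const_mul (δ / 2))
    refine h1.congr_fderiv ?_
    symm
    ext v
    simp [inner_add_left, inner_smul_left]
    ring
  · intro y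
    exact (bf_hasFDerivAt hR y).add ((hasFDerivAt_id y).const_smul δ)
  · intro y z hyz
    have h1 := hmono y z
    have h2 : (bf μ y + δ • y - (bf μ z + δ • z)) = (bf μ y - bf μ z) + δ • (y - z) := by module
    rw [h2, inner_add_left, inner_smul_left, conj_trivial, real_inner_self_eq_norm_sq]
    have : 0 < ‖y - z‖ := norm_pos_iff.2 (sub_ne_zero.2 hyz)
    positivity
  · intro y
    have h1 := hmono y 0
    rw [hb0, sub_zero, sub_zero, real_inner_comm] at h1
    rw [inner_add_right, inner_smul_right, real_inner_self_eq_norm_sq]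
    have h2 : ‖bf μ y + δ • y‖ ≤ L * ‖y‖ := by
      refine (norm_add_le _ _).trans ?_
      rw [norm_smul, Real.norm_eq_abs, abs_of_pos hδ, hL]
      linarith [hlip y]
    have h3 : ‖bf μ y + δ • y‖ ^ 2 ≤ L ^ 2 * ‖y‖ ^ 2 := by rw [← mul_pow]; gcongr
    calc min (1 / 2) (δ / (1 + L ^ 2)) * (‖y‖ ^ 2 + ‖bf μ y + δ • y‖ ^ 2)
        ≤ (δ / (1 + L ^ 2)) * (‖y‖ ^ 2 + L ^ 2 * ‖y‖ ^ 2) := by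
          gcongr; exact min_le_right _ _
      _ = δ * ‖y‖ ^ 2 := by field_simp
      _ ≤ _ := by linarith
  · intro y
    have := logZ_tangent hR 0 y
    rw [Zf_zero, hb0, inner_zero_left, Real.log_one] at this
    linarith
end PartC

section PartG
variable {n : ℕ}

lemma lc_sqrt {f : EuclideanSpace ℝ (Fin n) → ℝ} (hf : IsLogConcave f) (x y : EuclideanSpace ℝ (Fin n)) :
    √(f x) * √(f y) ≤ f ((1 / 2 : ℝ) • x + (1 / 2 : ℝ) • y) := by
  have := hf.2 x y (1 / 2) (by norm_num) (by norm_num)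
  rw [Real.sqrt_eq_rpow, Real.sqrt_eq_rpow]
  convert this using 3 <;> norm_num

lemma lc_convex {f : EuclideanSpace ℝ (Fin n) → ℝ} (hf : IsLogConcave f) (a : ℝ) :
    Convex ℝ {x | a ≤ f x} := by
  intro x hx y hy s t hs ht hst
  simp only [Set.mem_setOf_eq] at *
  rcases le_or_gt a 0 with h | h
  · exact h.trans (hf.1 _)
  · have h1 := hf.2 x y s hs (by linarith)
    have e : 1 - s = t := by linarith
    rw [e] at h1
    refine le_trans ?_ h1
    calc a = a ^ s * a ^ t := by rw [← Real.rpow_add h, hst, Real.rpow_one]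
      _ ≤ _ := by
        have := Real.rpow_nonneg (hf.1 x) s
        gcongr

lemma lc_aemeasurable {f : EuclideanSpace ℝ (Fin n) → ℝ} (hf : IsLogConcave f) :
    AEMeasurable f volume := by
  apply NullMeasurable.aemeasurable
  have : @Measurable (NullMeasurableSpace (EuclideanSpace ℝ (Fin n)) volume) ℝ _ _ f := by
    apply measurable_of_Ici
    intro a
    exact (lc_convex hf a).nullMeasurableSet volume
  exact fun s hs => this hs

lemma lintegral_half (F : EuclideanSpace ℝ (Fin n) → ENNReal) :
    ∫⁻ x, F ((1 / 2 : ℝ) • x) = 2 ^ n * ∫⁻ x, F x := by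
  rw [lintegral_comp_smul' F (by norm_num : (0 : ℝ) < 1 / 2)]
  congr 1
  rw [finrank_euclideanSpace_fin, ← inv_pow, one_div, inv_inv, ENNReal.ofReal_pow (by norm_num)]; norm_num

lemma lintegral_half_shift (F : EuclideanSpace ℝ (Fin n) → ENNReal) (x0 : EuclideanSpace ℝ (Fin n)) :
    ∫⁻ x, F ((1 / 2 : ℝ) • x + (1 / 2 : ℝ) • x0) = 2 ^ n * ∫⁻ x, F x := by
  rw [lintegral_half (fun x => F (x + (1 / 2 : ℝ) • x0)), lintegral_add_right_eq_self F]

lemma lc_sqrt_lint {f : EuclideanSpace ℝ (Fin n) → ℝ} (hf : IsLogConcave f) (x0 : EuclideanSpace ℝ (Fin n)) :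
    ENNReal.ofReal √(f x0) * ∫⁻ x, ENNReal.ofReal √(f x) ≤ 2 ^ n * ∫⁻ x, ENNReal.ofReal (f x) := by
  rw [← lintegral_half_shift (fun x => ENNReal.ofReal (f x)) x0, ← lintegral_const_mul' _ _ ENNReal.ofReal_ne_top]
  apply lintegral_mono
  intro x
  simp only
  rw [← ENNReal.ofReal_mul (Real.sqrt_nonneg _), mul_comm]
  exact ENNReal.ofReal_le_ofReal (lc_sqrt hf x x0)

lemma lc_exists_pos {f : EuclideanSpace ℝ (Fin n) → ℝ}
    (h1 : ∫⁻ x, ENNReal.ofReal (f x) = 1) : ∃ x, 0 < f x := by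
  by_contra h
  push Not at h
  have : ∀ x, ENNReal.ofReal (f x) = 0 := fun x => ENNReal.ofReal_of_nonpos (h x)
  simp [this] at h1

lemma lc_sqrt_fin {f : EuclideanSpace ℝ (Fin n) → ℝ} (hf : IsLogConcave f)
    (h1 : ∫⁻ x, ENNReal.ofReal (f x) = 1) : ∫⁻ x, ENNReal.ofReal √(f x) ≠ ⊤ := by
  obtain ⟨x0, hx0⟩ := lc_exists_pos h1
  have := lc_sqrt_lint hf x0
  rw [h1, mul_one] at this
  intro h
  rw [h, ENNReal.mul_top (by simpa using Real.sqrt_pos.2 hx0)] at this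
  simp at this

lemma lc_bdd {f : EuclideanSpace ℝ (Fin n) → ℝ} (hf : IsLogConcave f)
    (h1 : ∫⁻ x, ENNReal.ofReal (f x) = 1) : BddAbove (Set.range f) := by
  have hfin := lc_sqrt_fin hf h1
  set A := ∫⁻ x, ENNReal.ofReal √(f x) with hA
  have hpos : A ≠ 0 := by
    intro h0
    rw [hA, lintegral_eq_zero_iff' (by have := lc_aemeasurable hf; fun_prop)] at h0
    have : ∫⁻ x, ENNReal.ofReal (f x) = 0 := by
      rw [lintegral_eq_zero_iff' (by have := lc_aemeasurable hf; fun_prop)]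
      filter_upwards [h0] with x hx
      simp only [Pi.zero_apply, ENNReal.ofReal_eq_zero] at hx ⊢
      have := Real.sqrt_eq_zero'.1 (le_antisymm hx (Real.sqrt_nonneg _))
      exact this
    rw [h1] at this; simp at this
  refine ⟨((2 ^ n / A).toReal) ^ 2, ?_⟩
  rintro _ ⟨x0, rfl⟩
  have := lc_sqrt_lint hf x0
  rw [h1, mul_one, ← hA, ← ENNReal.le_div_iff_mul_le (Or.inl hpos) (Or.inl hfin)] at this
  have h2 := (ENNReal.ofReal_le_iff_le_toReal (ENNReal.div_ne_top (by simp) hpos)).1 this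
  calc f x0 = √(f x0) ^ 2 := (Real.sq_sqrt (hf.1 x0)).symm
    _ ≤ _ := by gcongr

lemma lc_integrable {f : EuclideanSpace ℝ (Fin n) → ℝ} (hf : IsLogConcave f)
    (h1 : ∫⁻ x, ENNReal.ofReal (f x) = 1) : Integrable f := by
  refine ⟨(lc_aemeasurable hf).aestronglyMeasurable, ?_⟩
  rw [hasFiniteIntegral_iff_ofReal (Filter.Eventually.of_forall hf.1), h1]; simp

lemma lc_integral {f : EuclideanSpace ℝ (Fin n) → ℝ} (hf : IsLogConcave f)
    (h1 : ∫⁻ x, ENNReal.ofReal (f x) = 1) : ∫ x, f x = 1 := by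
  rw [integral_eq_lintegral_of_nonneg_ae (Filter.Eventually.of_forall hf.1)
    (lc_aemeasurable hf).aestronglyMeasurable, h1]; simp

end PartG

section PartD
variable {n : ℕ}

/-- measure with density p -/
noncomputable def densM (p : EuclideanSpace ℝ (Fin n) → ℝ) : Measure (EuclideanSpace ℝ (Fin n)) :=
  volume.withDensity fun x => ENNReal.ofReal (p x)

structure EvenLC (p : EuclideanSpace ℝ (Fin n) → ℝ) (R : ℝ) : Prop where
  lc : IsLogConcave p
  one : ∫⁻ x, ENNReal.ofReal (p x) = 1
  even : ∀ x, p (-x) = p x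
  supp : ∀ x, R < ‖x‖ → p x = 0

lemma EvenLC.prob {p : EuclideanSpace ℝ (Fin n) → ℝ} {R : ℝ} (h : EvenLC p R) :
    IsProbabilityMeasure (densM p) := by
  constructor
  rw [densM, withDensity_apply _ MeasurableSet.univ, Measure.restrict_univ, h.one]

lemma EvenLC.ae {p : EuclideanSpace ℝ (Fin n) → ℝ} {R : ℝ} (h : EvenLC p R) :
    ∀ᵐ u ∂(densM p), ‖u‖ ≤ R := by
  rw [densM, ae_withDensity_iff' (lc_aemeasurable h.lc).ennreal_ofReal]
  refine Filter.Eventually.of_forall fun u hu => ?_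
  by_contra hlt
  rw [h.supp u (not_le.1 hlt)] at hu
  simp at hu

lemma EvenLC.symm {p : EuclideanSpace ℝ (Fin n) → ℝ} {R : ℝ} (h : EvenLC p R) :
    (densM p).map Neg.neg = densM p := by
  ext s hs
  rw [Measure.map_apply measurable_neg hs, densM, withDensity_apply _ (measurable_neg hs), withDensity_apply _ hs]
  have := (Measure.measurePreserving_neg (volume : Measure (EuclideanSpace ℝ (Fin n)))).setLIntegral_comp_preimage_emb
    (MeasurableEquiv.neg _).measurableEmbedding (fun x => ENNReal.ofReal (p x)) s
  rw [← this]
  simp only [h.even]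

lemma EvenLC.max {p : EuclideanSpace ℝ (Fin n) → ℝ} {R : ℝ} (h : EvenLC p R) (x : EuclideanSpace ℝ (Fin n)) :
    p x ≤ p 0 := by
  have := lc_sqrt h.lc x (-x)
  rw [h.even, Real.mul_self_sqrt (h.lc.1 x)] at this
  simpa using this

lemma EvenLC.pos {p : EuclideanSpace ℝ (Fin n) → ℝ} {R : ℝ} (h : EvenLC p R) : 0 < p 0 := by
  obtain ⟨x, hx⟩ := lc_exists_pos h.one
  exact hx.trans_le (h.max x)

lemma integral_densM {p : EuclideanSpace ℝ (Fin n) → ℝ} (hp : IsLogConcave p)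
    (φ : EuclideanSpace ℝ (Fin n) → ℝ) :
    ∫ u, φ u ∂(densM p) = ∫ u, p u * φ u := by
  rw [densM, integral_withDensity_eq_integral_toReal_smul₀ (lc_aemeasurable hp).ennreal_ofReal
    (Filter.Eventually.of_forall fun x => ENNReal.ofReal_lt_top)]
  congr 1; ext u
  rw [ENNReal.toReal_ofReal (hp.1 u), smul_eq_mul]

lemma lc_sqrt_integrable {f : EuclideanSpace ℝ (Fin n) → ℝ} (hf : IsLogConcave f)
    (h1 : ∫⁻ x, ENNReal.ofReal (f x) = 1) : Integrable (fun x => √(f x)) := by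
  refine ⟨((lc_aemeasurable hf).sqrt).aestronglyMeasurable, ?_⟩
  rw [hasFiniteIntegral_iff_ofReal (Filter.Eventually.of_forall fun x => Real.sqrt_nonneg _)]
  exact (lc_sqrt_fin hf h1).lt_top

lemma lc_sqrt_integral_le {f : EuclideanSpace ℝ (Fin n) → ℝ} (hf : IsLogConcave f)
    (h1 : ∫⁻ x, ENNReal.ofReal (f x) = 1) (x0 : EuclideanSpace ℝ (Fin n)) :
    √(f x0) * ∫ x, √(f x) ≤ 2 ^ n := by
  have h := lc_sqrt_lint hf x0
  rw [h1, mul_one, ← ofReal_integral_eq_lintegral_ofReal (lc_sqrt_integrable hf h1)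
    (Filter.Eventually.of_forall fun x => Real.sqrt_nonneg _), ← ENNReal.ofReal_mul (Real.sqrt_nonneg _)] at h
  have h2 : (2 : ENNReal) ^ n = ENNReal.ofReal (2 ^ n) := by
    rw [ENNReal.ofReal_pow (by norm_num)]; norm_num
  rw [h2] at h
  exact (ENNReal.ofReal_le_ofReal_iff (by positivity)).1 h

lemma Sfun_level {p : EuclideanSpace ℝ (Fin n) → ℝ} {R : ℝ} (h : EvenLC p R) {a : ℝ} (ha : 0 < a) (ha1 : a < 1)
    {x : EuclideanSpace ℝ (Fin n)} (hx : (1 / 2 : ℝ) • x ∉ closure {u | a * p 0 ≤ p u}) :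
    Sfun (fun y => Real.log (Zf (densM p) y)) x ≤ ENNReal.ofReal (2 ^ n * √a) := by
  haveI := h.prob
  have hp0 := h.pos
  obtain ⟨L, s, hL1, hL2⟩ := geometric_hahn_banach_closed_point ((lc_convex h.lc (a * p 0)).closure) isClosed_closure hx
  have hs : 0 < s := by
    have := hL1 0 (subset_closure (by simp only [Set.mem_setOf_eq]; nlinarith))
    simpa using this
  set y0 := s⁻¹ • (InnerProductSpace.toDual ℝ (EuclideanSpace ℝ (Fin n))).symm L with hy0
  have hy : ∀ u, inner ℝ u y0 = s⁻¹ * L u := by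
    intro u
    rw [hy0, inner_smul_right, real_inner_comm, InnerProductSpace.toDual_symm_apply]
  set t := -Real.log a with ht
  have htpos : 0 < t := by rw [ht]; linarith [Real.log_neg ha ha1]
  have hat : a = Real.exp (-t) := by rw [ht, neg_neg, Real.exp_log ha]
  have key : ∀ u, √(p u) * Real.exp (t / 2 * inner ℝ u y0) ≤ √(p 0) * Real.exp (t / 2) := by
    intro u
    set r := inner ℝ u y0 with hr
    rcases le_or_gt r 1 with h1 | h1
    · gcongr
      · exact h.max u
      · nlinarith
    · have hr0 : 0 < r := by linarith
      have hnot : p (r⁻¹ • u) < a * p 0 := by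
        by_contra hh
        have := hL1 (r⁻¹ • u) (subset_closure (not_lt.1 hh))
        have h3 : inner ℝ (r⁻¹ • u) y0 = 1 := by
          rw [inner_smul_left, conj_trivial, ← hr]; field_simp
        rw [hy] at h3
        have : s⁻¹ * L (r⁻¹ • u) < s⁻¹ * s := by gcongr
        rw [inv_mul_cancel₀ hs.ne'] at this
        linarith
      have h2 := h.lc.2 u 0 r⁻¹ (by positivity) (inv_le_one_of_one_le₀ h1.le)
      rw [smul_zero, add_zero] at h2
      have h3 : p u ^ r⁻¹ * p 0 ^ (1 - r⁻¹) ≤ Real.exp (-t) * p 0 ^ r⁻¹ * p 0 ^ (1 - r⁻¹) := by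
        rw [mul_assoc, ← Real.rpow_add hp0]; simp only [add_sub_cancel, Real.rpow_one]
        rw [← hat]; linarith
      have h4 : p u ^ r⁻¹ ≤ Real.exp (-t) * p 0 ^ r⁻¹ := le_of_mul_le_mul_right h3 (by positivity)
      have h5 : p u ≤ Real.exp (-t * r) * p 0 := by
        have := Real.rpow_le_rpow (Real.rpow_nonneg (h.lc.1 u) _) h4 hr0.le
        rw [← Real.rpow_mul (h.lc.1 u), inv_mul_cancel₀ hr0.ne', Real.rpow_one,
          Real.mul_rpow (Real.exp_pos _).le (by positivity), ← Real.rpow_mul hp0.le, inv_mul_cancel₀ hr0.ne', Real.rpow_one,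
          ← Real.exp_mul] at this
        exact this
      have h6 : √(p u) ≤ Real.exp (-(t * r) / 2) * √(p 0) := by
        have := Real.sqrt_le_sqrt h5
        rw [Real.sqrt_mul (Real.exp_pos _).le] at this
        rw [← Real.sqrt_sq (Real.exp_pos (-(t * r) / 2)).le]
        rw [← Real.exp_nat_mul]
        convert this using 4; push_cast; ring
      calc √(p u) * Real.exp (t / 2 * r) ≤ Real.exp (-(t * r) / 2) * √(p 0) * Real.exp (t / 2 * r) := by gcongr
        _ = √(p 0) := by
          rw [mul_right_comm, ← Real.exp_add]
          rw [show -(t * r) / 2 + t / 2 * r = 0 by ring, Real.exp_zero, one_mul]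
        _ ≤ √(p 0) * Real.exp (t / 2) := by
          apply le_mul_of_one_le_right (Real.sqrt_nonneg _)
          exact Real.one_le_exp (by positivity)
  refine (iInf_le _ ((t / 2) • y0)).trans (ENNReal.ofReal_le_ofReal ?_)
  have hZ := Zf_pos h.ae ((t / 2) • y0)
  have hZ2 : Zf (densM p) ((t / 2) • y0) ≤ 2 ^ n * Real.exp (t / 2) := by
    have e1 : Zf (densM p) ((t / 2) • y0) = ∫ u, p u * Real.exp (t / 2 * inner ℝ u y0) := by
      rw [Zf, integral_densM h.lc]
      congr 1; ext u; rw [inner_smul_right]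
    rw [e1]
    calc ∫ u, p u * Real.exp (t / 2 * inner ℝ u y0) ≤ ∫ u, (√(p 0) * Real.exp (t / 2)) * √(p u) := by
          apply integral_mono_of_nonneg
          · exact Filter.Eventually.of_forall fun u => mul_nonneg (h.lc.1 u) (Real.exp_pos _).le
          · exact (lc_sqrt_integrable h.lc h.one).const_mul _
          · refine Filter.Eventually.of_forall fun u => ?_
            simp only
            calc p u * Real.exp (t / 2 * inner ℝ u y0) = (√(p u) * Real.exp (t / 2 * inner ℝ u y0)) * √(p u) := by
                  nth_rewrite 1 [← Real.mul_self_sqrt (h.lc.1 u)]; ring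
              _ ≤ _ := mul_le_mul_of_nonneg_right (key u) (Real.sqrt_nonneg _)
      _ = (√(p 0) * ∫ u, √(p u)) * Real.exp (t / 2) := by rw [integral_const_mul]; ring
      _ ≤ _ := by gcongr; exact lc_sqrt_integral_le h.lc h.one 0
  rw [Real.exp_sub, Real.exp_log hZ, div_eq_mul_inv, ← Real.exp_neg]
  have hx2 : t ≤ inner ℝ x ((t / 2) • y0) := by
    have h1 : 1 < inner ℝ ((1 / 2 : ℝ) • x) y0 := by
      rw [hy]
      have : s⁻¹ * s < s⁻¹ * L ((1 / 2 : ℝ) • x) := by gcongr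
      rwa [inv_mul_cancel₀ hs.ne'] at this
    rw [inner_smul_left, conj_trivial] at h1
    rw [inner_smul_right]
    nlinarith
  have hsa : √a = Real.exp (-t / 2) := by
    rw [hat, ← Real.sqrt_sq (Real.exp_pos (-t / 2)).le, ← Real.exp_nat_mul]; congr 2; push_cast; ring
  rw [hsa]
  calc Zf (densM p) ((t / 2) • y0) * Real.exp (-inner ℝ x ((t / 2) • y0))
      ≤ (2 ^ n * Real.exp (t / 2)) * Real.exp (-t) := by gcongr
    _ = _ := by rw [mul_assoc, ← Real.exp_add]; congr 2; ring

lemma Sfun_ae_le {p : EuclideanSpace ℝ (Fin n) → ℝ} {R : ℝ} (h : EvenLC p R) :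
    ∀ᵐ x, Sfun (fun y => Real.log (Zf (densM p) y)) x ≤
      ENNReal.ofReal (2 ^ n * (√(p ((1 / 2 : ℝ) • x)) / √(p 0))) := by
  haveI := h.prob
  have hp0 := h.pos
  have hfr : ∀ᵐ x : EuclideanSpace ℝ (Fin n), ∀ a : ℚ, (1 / 2 : ℝ) • x ∉ frontier {u | (a : ℝ) * p 0 ≤ p u} := by
    rw [ae_all_iff]
    intro a
    have h1 := (lc_convex h.lc ((a : ℝ) * p 0)).addHaar_frontier volume
    have h2 : (volume : Measure (EuclideanSpace ℝ (Fin n)))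
        ((fun x => (1 / 2 : ℝ) • x) ⁻¹' (frontier {u | (a : ℝ) * p 0 ≤ p u})) = 0 := by
      rw [Measure.addHaar_preimage_smul _ (by norm_num), h1, mul_zero]
    exact measure_eq_zero_iff_ae_notMem.1 h2
  filter_upwards [hfr] with x hx
  have hS1 : Sfun (fun y => Real.log (Zf (densM p) y)) x ≤ 1 := by
    refine (iInf_le _ 0).trans ?_
    simp [Zf_zero]
  by_contra hlt
  rw [not_le] at hlt
  set S := Sfun (fun y => Real.log (Zf (densM p) y)) x with hS
  have hfin : S ≠ ⊤ := (hS1.trans_lt ENNReal.one_lt_top).ne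
  rw [← ENNReal.ofReal_toReal hfin, ENNReal.ofReal_lt_ofReal_iff'] at hlt
  obtain ⟨hlt, hpos⟩ := hlt
  have hS1' : S.toReal ≤ 1 := by
    have := ENNReal.toReal_mono ENNReal.one_ne_top hS1; simpa using this
  set σ := S.toReal / 2 ^ n with hσ
  have hσpos : 0 < σ := by positivity
  have h2n : (1 : ℝ) ≤ 2 ^ n := one_le_pow₀ (by norm_num)
  have hσ1 : σ ≤ 1 := by rw [hσ, div_le_one (by positivity)]; linarith
  have hq : √(p ((1 / 2 : ℝ) • x)) / √(p 0) < σ := by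
    rw [hσ, lt_div_iff₀ (by positivity)]; linarith
  have hq2 : p ((1 / 2 : ℝ) • x) / p 0 < σ ^ 2 := by
    rw [← Real.sqrt_div' _ hp0.le, Real.sqrt_lt' hσpos] at hq; exact hq
  obtain ⟨a, ha1, ha2⟩ := exists_rat_btwn hq2
  have ha0 : (0 : ℝ) < a := lt_of_le_of_lt (div_nonneg (h.lc.1 _) hp0.le) ha1
  have ha1' : (a : ℝ) < 1 := ha2.trans_le (pow_le_one₀ hσpos.le hσ1)
  have hnK : (1 / 2 : ℝ) • x ∉ {u | (a : ℝ) * p 0 ≤ p u} := by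
    simp only [Set.mem_setOf_eq, not_le]
    rwa [div_lt_iff₀ hp0] at ha1
  have hncl : (1 / 2 : ℝ) • x ∉ closure {u | (a : ℝ) * p 0 ≤ p u} := by
    intro hc
    exact hx a ⟨hc, fun hi => hnK (interior_subset hi)⟩
  have h3 := Sfun_level h ha0 ha1' hncl
  rw [← hS] at h3
  have h4 := ENNReal.toReal_le_of_le_ofReal (by positivity) h3
  have h5 : √(a : ℝ) < σ := (Real.sqrt_lt' hσpos).2 ha2
  rw [hσ, lt_div_iff₀ (by positivity)] at h5
  linarith

lemma Sfun_lint_le {p : EuclideanSpace ℝ (Fin n) → ℝ} {R : ℝ} (h : EvenLC p R) :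
    ∫⁻ x, Sfun (fun y => Real.log (Zf (densM p) y)) x ≤ ENNReal.ofReal (8 ^ n / p 0) := by
  have hp0 := h.pos
  refine (lintegral_mono_ae (Sfun_ae_le h)).trans ?_
  have e1 : ∀ x, ENNReal.ofReal (2 ^ n * (√(p ((1 / 2 : ℝ) • x)) / √(p 0))) =
      ENNReal.ofReal (2 ^ n / √(p 0)) * (fun x => ENNReal.ofReal (√(p x))) ((1 / 2 : ℝ) • x) := by
    intro x
    simp only
    rw [← ENNReal.ofReal_mul (by positivity)]; congr 1; ring
  simp_rw [e1]
  rw [lintegral_const_mul' _ _ ENNReal.ofReal_ne_top, lintegral_half (fun x => ENNReal.ofReal (√(p x))),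
    ← ofReal_integral_eq_lintegral_ofReal (lc_sqrt_integrable h.lc h.one)
    (Filter.Eventually.of_forall fun x => Real.sqrt_nonneg _)]
  have h2 : (2 : ENNReal) ^ n = ENNReal.ofReal (2 ^ n) := by
    rw [ENNReal.ofReal_pow (by norm_num)]; norm_num
  rw [h2, ← ENNReal.ofReal_mul (by positivity), ← ENNReal.ofReal_mul (by positivity)]
  apply ENNReal.ofReal_le_ofReal
  have h3 := lc_sqrt_integral_le h.lc h.one 0
  have h4 : 0 < √(p 0) := Real.sqrt_pos.2 hp0
  have h5 : ∫ x, √(p x) ≤ 2 ^ n / √(p 0) := by rw [le_div_iff₀ h4]; linarith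
  calc 2 ^ n / √(p 0) * (2 ^ n * ∫ x, √(p x)) ≤ 2 ^ n / √(p 0) * (2 ^ n * (2 ^ n / √(p 0))) := by gcongr
    _ = (2 * 2 * 2) ^ n / (√(p 0) * √(p 0)) := by rw [mul_pow, mul_pow]; field_simp
    _ = _ := by rw [Real.mul_self_sqrt hp0.le]; norm_num

lemma logZ_le {p : EuclideanSpace ℝ (Fin n) → ℝ} {R : ℝ} (h : EvenLC p R) (x : EuclideanSpace ℝ (Fin n)) :
    Real.log (Zf (densM p) x) ≤ R * ‖x‖ := by
  haveI := h.prob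
  have h1 := logZ_tangent h.ae x 0
  rw [Zf_zero, Real.log_one, zero_sub, inner_neg_right] at h1
  have h2 := real_inner_le_norm (bf (densM p) x) x
  have h3 := norm_bf_le h.ae x
  nlinarith [norm_nonneg x]

theorem exists_delta (hn : 1 ≤ n) {p : EuclideanSpace ℝ (Fin n) → ℝ} {R : ℝ} (h : EvenLC p R) :
    ∃ δ : ℝ, 0 < δ ∧ ∫⁻ x, Sfun (fun y => Real.log (Zf (densM p) y) + δ / 2 * ‖y‖ ^ 2) x ≤
      ENNReal.ofReal (9 ^ n / p 0) := by
  haveI := h.prob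
  have hp0 := h.pos
  let S : ℕ → EuclideanSpace ℝ (Fin n) → ENNReal := fun k =>
    Sfun (fun y => Real.log (Zf (densM p) y) + (1 / ((k : ℝ) + 1)) / 2 * ‖y‖ ^ 2)
  have hanti : Antitone S := by
    intro k l hkl x
    refine iInf_mono fun y => ENNReal.ofReal_le_ofReal (Real.exp_le_exp.2 ?_)
    have h0 : (1 / ((l : ℝ) + 1)) ≤ 1 / ((k : ℝ) + 1) := by
      have : (k : ℝ) ≤ l := Nat.cast_le.2 hkl
      gcongr
    simp only
    gcongr
  have hfin : ∫⁻ x, S 0 x ≠ ⊤ := by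
    have hb : ∀ x, S 0 x ≤ ENNReal.ofReal (Real.exp (R ^ 2) * Real.exp (-(1 / 4) * ‖x‖ ^ 2)) := by
      intro x
      refine (iInf_le _ x).trans (ENNReal.ofReal_le_ofReal ?_)
      rw [← Real.exp_add]
      apply Real.exp_le_exp.2
      rw [real_inner_self_eq_norm_sq]
      have := logZ_le h x
      norm_num
      nlinarith [sq_nonneg (R - ‖x‖ / 2)]
    refine ((lintegral_mono hb).trans_lt ?_).ne
    exact ((integrable_gauss (by norm_num)).const_mul _).lintegral_lt_top
  have h1 := lintegral_iInf (fun k => measurable_Sfun _) hanti hfin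
  have h2 : ∫⁻ x, ⨅ k, S k x ≤ ∫⁻ x, Sfun (fun y => Real.log (Zf (densM p) y)) x := by
    apply lintegral_mono
    intro x
    refine le_iInf fun y => ?_
    have ht : Filter.Tendsto (fun k : ℕ => ENNReal.ofReal (Real.exp (Real.log (Zf (densM p) y) + (1 / ((k : ℝ) + 1)) / 2 * ‖y‖ ^ 2 - inner ℝ x y)))
        Filter.atTop (nhds (ENNReal.ofReal (Real.exp (Real.log (Zf (densM p) y) - inner ℝ x y)))) := by
      apply (ENNReal.continuous_ofReal.tendsto _).comp
      apply (Real.continuous_exp.tendsto _).comp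
      have := ((((tendsto_one_div_add_atTop_nhds_zero_nat (𝕜 := ℝ)).div_const 2).mul_const (‖y‖ ^ 2)).const_add
        (Real.log (Zf (densM p) y))).sub_const (inner ℝ x y)
      simpa using this
    refine ge_of_tendsto' ht fun k => ?_
    exact (iInf_le _ k).trans (iInf_le _ y)
  have h3 : (⨅ k, ∫⁻ x, S k x) < ENNReal.ofReal (9 ^ n / p 0) := by
    rw [← h1]
    refine (h2.trans (Sfun_lint_le h)).trans_lt ?_
    rw [ENNReal.ofReal_lt_ofReal_iff (by positivity)]
    have h8 : (8 : ℝ) ^ n < 9 ^ n := pow_lt_pow_left₀ (by norm_num) (by norm_num) (by omega)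
    exact div_lt_div_of_pos_right h8 hp0
  obtain ⟨k, hk⟩ := iInf_lt_iff.1 h3
  exact ⟨1 / ((k : ℝ) + 1), by positivity, hk.le⟩
end PartD

section PartE1
variable {E : Type*} [NormedAddCommGroup E] [InnerProductSpace ℝ E] [FiniteDimensional ℝ E]
  [MeasurableSpace E] [BorelSpace E]

lemma GoodPot.symm_g' {ψ : E → ℝ} {g : E → E} {g' : E → E →L[ℝ] E} {c d : ℝ}
    (G : GoodPot ψ g g' c d) (y v w : E) : inner ℝ (g' y v) w = inner ℝ (g' y w) v := by
  have h2 : HasFDerivAt (fun y => innerSL ℝ (g y)) ((innerSL ℝ).comp (g' y)) y :=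
    (innerSL ℝ : E →L[ℝ] E →L[ℝ] ℝ).hasFDerivAt.comp y (G.hg y)
  have := second_derivative_symmetric G.hψ h2 v w
  simpa using this

lemma GoodPot.le_one {ψ : E → ℝ} {g : E → E} {g' : E → E →L[ℝ] E} {c d : ℝ}
    (G : GoodPot ψ g g' c d) (h0 : ψ 0 = 0) (y : E) : ψ y - inner ℝ (g y) y ≤ 0 := by
  have := G.tangent y 0
  rw [h0, zero_sub, inner_neg_right] at this
  linarith

lemma GoodPot.pow4 {ψ : E → ℝ} {g : E → E} {g' : E → E →L[ℝ] E} {c d : ℝ}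
    (G : GoodPot ψ g g' c d) (h0 : ψ 0 = 0) (y : E) :
    Real.exp (-ψ ((8 : ℝ) • y)) ≤ Real.exp (ψ y - inner ℝ (g y) y) ^ 4 := by
  have h1 := G.tangent y ((2 : ℝ) • y)
  have e1 : (2 : ℝ) • y - y = y := by module
  rw [e1] at h1
  have h2 := G.tangent ((2 : ℝ) • y) ((8 : ℝ) • y)
  have e2 : (8 : ℝ) • y - (2 : ℝ) • y = (3 : ℝ) • ((2 : ℝ) • y) := by module
  rw [e2, inner_smul_right] at h2
  have h3 := G.le_one h0 ((2 : ℝ) • y)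
  have h4 : 0 ≤ ψ y := le_trans (mul_nonneg G.dpos.le (sq_nonneg _)) (G.quad y)
  rw [← Real.exp_nat_mul]
  apply Real.exp_le_exp.2
  push_cast
  linarith

lemma GoodPot.pigeon {ψ : E → ℝ} {g : E → E} {g' : E → E →L[ℝ] E} {c d : ℝ}
    (G : GoodPot ψ g g' c d) (h0 : ψ 0 = 0) {a b K : ℝ} (hK : 0 < K)
    (ha : ENNReal.ofReal a ≤ ∫⁻ y, ENNReal.ofReal (Real.exp (-ψ y)))
    (hb : ∫⁻ x, Sfun ψ x ≤ ENNReal.ofReal b) (ha0 : 0 < a)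
    (hab : b < K * ((8 : ℝ) ^ Module.finrank ℝ E)⁻¹ * a) :
    ∃ y, |(g' y).det| ≤ K * Real.exp (ψ y - inner ℝ (g y) y) ^ 3 := by
  by_contra hcon
  push Not at hcon
  have h1 := (lintegral_grad_le G).trans hb
  have h2 : ENNReal.ofReal (K * ((8 : ℝ) ^ Module.finrank ℝ E)⁻¹ * a) ≤
      ∫⁻ y, ENNReal.ofReal |(g' y).det| * ENNReal.ofReal (Real.exp (ψ y - inner ℝ (g y) y)) := by
    calc ENNReal.ofReal (K * ((8 : ℝ) ^ Module.finrank ℝ E)⁻¹ * a)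
        = ENNReal.ofReal K * (ENNReal.ofReal ((8 : ℝ) ^ Module.finrank ℝ E)⁻¹ * ENNReal.ofReal a) := by
          rw [← ENNReal.ofReal_mul (by positivity), ← ENNReal.ofReal_mul hK.le, mul_assoc]
      _ ≤ ENNReal.ofReal K * (ENNReal.ofReal ((8 : ℝ) ^ Module.finrank ℝ E)⁻¹ * ∫⁻ y, ENNReal.ofReal (Real.exp (-ψ y))) := by
          gcongr
      _ = ∫⁻ y, ENNReal.ofReal K * ENNReal.ofReal (Real.exp (-ψ ((8 : ℝ) • y))) := by
          rw [lintegral_const_mul' _ _ ENNReal.ofReal_ne_top,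
            lintegral_comp_smul' (fun y => ENNReal.ofReal (Real.exp (-ψ y))) (by norm_num : (0 : ℝ) < 8)]
      _ ≤ _ := by
          apply lintegral_mono
          intro y
          simp only
          rw [← ENNReal.ofReal_mul hK.le, ← ENNReal.ofReal_mul (abs_nonneg _)]
          apply ENNReal.ofReal_le_ofReal
          have h5 := G.pow4 h0 y
          have h6 := (hcon y).le
          calc K * Real.exp (-ψ ((8 : ℝ) • y)) ≤ K * Real.exp (ψ y - inner ℝ (g y) y) ^ 4 := by gcongr
            _ = (K * Real.exp (ψ y - inner ℝ (g y) y) ^ 3) * Real.exp (ψ y - inner ℝ (g y) y) := by ring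
            _ ≤ _ := by gcongr
  have h3 := h2.trans h1
  rw [ENNReal.ofReal_le_ofReal_iff'] at h3
  have : 0 < K * ((8 : ℝ) ^ Module.finrank ℝ E)⁻¹ * a := by positivity
  rcases h3 with h | h <;> linarith
end PartE1

section PartE2
variable {n : ℕ}

lemma exists_whiten (H : EuclideanSpace ℝ (Fin n) →L[ℝ] EuclideanSpace ℝ (Fin n))
    (hs : ∀ v w, inner ℝ (H v) w = inner ℝ (H w) v) (hp : ∀ v, v ≠ 0 → 0 < inner ℝ (H v) v) :
    ∃ (T : EuclideanSpace ℝ (Fin n) →ₗ[ℝ] EuclideanSpace ℝ (Fin n))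
      (e : OrthonormalBasis (Fin n) ℝ (EuclideanSpace ℝ (Fin n))) (l : Fin n → ℝ),
      (∀ i, 0 < l i) ∧ (∀ i, inner ℝ (H (e i)) (e i) = l i) ∧
      0 < LinearMap.det T ∧ (LinearMap.det T) ^ 2 * H.det = 1 ∧
      ∀ v, ‖T v‖ ^ 2 = ∑ i, (l i)⁻¹ * (inner ℝ v (e i)) ^ 2 := by
  have hsym : (H : EuclideanSpace ℝ (Fin n) →ₗ[ℝ] EuclideanSpace ℝ (Fin n)).IsSymmetric := by
    intro v w
    simp only [ContinuousLinearMap.coe_coe]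
    rw [hs, real_inner_comm]
  have hfr : Module.finrank ℝ (EuclideanSpace ℝ (Fin n)) = n := finrank_euclideanSpace_fin
  set e := hsym.eigenvectorBasis hfr with he
  set l := hsym.eigenvalues hfr with hl
  have hei : ∀ i, inner ℝ (H (e i)) (e i) = l i := by
    intro i
    have := hsym.apply_eigenvectorBasis hfr i
    simp only [ContinuousLinearMap.coe_coe] at this
    rw [he, this, inner_smul_left, real_inner_self_eq_norm_sq, OrthonormalBasis.norm_eq_one]
    simp [hl]
  have hlp : ∀ i, 0 < l i := by
    intro i
    rw [← hei]
    apply hp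
    intro h0
    have := e.norm_eq_one i
    rw [h0, norm_zero] at this
    norm_num at this
  refine ⟨Matrix.toLin e.toBasis e.toBasis (Matrix.diagonal fun i => (√(l i))⁻¹), e, l, hlp, hei, ?_, ?_, ?_⟩
  · rw [LinearMap.det_toLin, Matrix.det_diagonal]
    exact Finset.prod_pos fun i _ => inv_pos.2 (Real.sqrt_pos.2 (hlp i))
  · have h1 : H.det = ∏ i, l i := by
      have := hsym.det_eq_prod_eigenvalues hfr
      simpa using this
    rw [LinearMap.det_toLin, Matrix.det_diagonal, h1, ← Finset.prod_pow, ← Finset.prod_mul_distrib]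
    apply Finset.prod_eq_one
    intro i _
    rw [inv_pow, Real.sq_sqrt (hlp i).le, inv_mul_cancel₀ (hlp i).ne']
  · intro v
    have h1 : ∀ i, inner ℝ (e i) (Matrix.toLin e.toBasis e.toBasis (Matrix.diagonal fun i => (√(l i))⁻¹) v)
        = (√(l i))⁻¹ * inner ℝ v (e i) := by
      intro i
      have := congrFun (LinearMap.toMatrix_mulVec_repr e.toBasis e.toBasis
        (Matrix.toLin e.toBasis e.toBasis (Matrix.diagonal fun i => (√(l i))⁻¹)) v) i
      rw [LinearMap.toMatrix_toLin, Matrix.mulVec_diagonal] at this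
      simp only [OrthonormalBasis.coe_toBasis_repr_apply, OrthonormalBasis.repr_apply_apply] at this
      rw [← this, real_inner_comm]
    rw [← e.sum_sq_norm_inner_right]
    apply Finset.sum_congr rfl
    intro i _
    rw [h1, Real.norm_eq_abs, sq_abs, mul_pow, inv_pow, Real.sq_sqrt (hlp i).le]

lemma integral_gauss_T (T : EuclideanSpace ℝ (Fin n) →ₗ[ℝ] EuclideanSpace ℝ (Fin n)) (hT : 0 < LinearMap.det T)
    (b : EuclideanSpace ℝ (Fin n)) {s : ℝ} (hs : 0 < s) :
    Integrable (fun u => Real.exp (-s * ‖T (u - b)‖ ^ 2)) ∧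
    ∫ u, Real.exp (-s * ‖T (u - b)‖ ^ 2) = (LinearMap.det T)⁻¹ * (π / s) ^ ((n : ℝ) / 2) := by
  set e := T.equivOfDetNeZero hT.ne' with he
  have heT : ∀ v, e v = T v := fun v => rfl
  have hem : MeasurableEmbedding T := by
    have : MeasurableEmbedding e := e.toContinuousLinearEquiv.toHomeomorph.measurableEmbedding
    exact this
  have hmap := Measure.map_linearMap_addHaar_eq_smul_addHaar (volume : Measure (EuclideanSpace ℝ (Fin n))) hT.ne'
  have hg := integrable_gauss (E := EuclideanSpace ℝ (Fin n)) hs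
  constructor
  · have h1 : Integrable (fun u => Real.exp (-s * ‖T u‖ ^ 2)) := by
      have := (hem.integrable_map_iff (μ := volume) (g := fun v => Real.exp (-s * ‖v‖ ^ 2))).1
        (by rw [hmap]; exact hg.smul_measure ENNReal.ofReal_ne_top)
      exact this
    exact h1.comp_sub_right b
  · rw [integral_sub_right_eq_self (fun u => Real.exp (-s * ‖T u‖ ^ 2)) b]
    rw [← hem.integral_map (g := fun v => Real.exp (-s * ‖v‖ ^ 2)), hmap, integral_smul_measure,
      GaussianFourier.integral_rexp_neg_mul_sq_norm hs, finrank_euclideanSpace_fin, smul_eq_mul,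
      ENNReal.toReal_ofReal (abs_nonneg _), abs_of_pos (inv_pos.2 hT)]
end PartE2

section PartE3
variable {n : ℕ}

lemma tilt_integrable' {μ : Measure (EuclideanSpace ℝ (Fin n))} [IsProbabilityMeasure μ] {R : ℝ} (hR : ∀ᵐ u ∂μ, ‖u‖ ≤ R)
    {φ : EuclideanSpace ℝ (Fin n) → ℝ} (hφ : Continuous φ) (y : EuclideanSpace ℝ (Fin n)) :
    Integrable (fun u => Real.exp (inner ℝ u y) * φ u) μ := by
  obtain ⟨B, hB⟩ := (isCompact_closedBall (0 : EuclideanSpace ℝ (Fin n)) R).exists_bound_of_continuousOn hφ.continuousOn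
  exact tilt_integrable hR hφ (B := B) (fun u hu => hB u (by simpa using hu)) y

/-- Jensen step -/
lemma jensen_tilt {μ : Measure (EuclideanSpace ℝ (Fin n))} [IsProbabilityMeasure μ] {R : ℝ} (hR : ∀ᵐ u ∂μ, ‖u‖ ≤ R)
    (y : EuclideanSpace ℝ (Fin n)) {q : EuclideanSpace ℝ (Fin n) → ℝ} (hq : Continuous q) (hq0 : ∀ u, 0 ≤ q u) {m : ℝ}
    (hm : ∫ u, Real.exp (inner ℝ u y) * q u ∂μ ≤ Zf μ y * m) :
    Real.exp (Real.log (Zf μ y) - inner ℝ (bf μ y) y - m) ≤ ∫ u, Real.exp (- q u) ∂μ := by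
  have hZ := Zf_pos hR y
  set a : ℝ := - inner ℝ (bf μ y) y - m with ha
  have i1 := int_one hR y
  have i2 : Integrable (fun u => Real.exp (inner ℝ u y) * inner ℝ u y) μ := tilt_integrable' hR (by fun_prop) y
  have i3 := tilt_integrable' hR hq y
  have hM : ∫ u, Real.exp (inner ℝ u y) * inner ℝ u y ∂μ = Zf μ y * inner ℝ (bf μ y) y := by
    rw [← inner_Mf hR, bf, inner_smul_left]
    simp only [conj_trivial]
    rw [mul_inv_cancel_left₀ hZ.ne']
  have key : ∀ u, Real.exp a * (((1 - a) * Real.exp (inner ℝ u y) - Real.exp (inner ℝ u y) * inner ℝ u y)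
      - Real.exp (inner ℝ u y) * q u) ≤ Real.exp (- q u) := by
    intro u
    have h1 := Real.add_one_le_exp (- inner ℝ u y - q u - a)
    have h2 : Real.exp (- q u) = Real.exp a * Real.exp (inner ℝ u y) * Real.exp (- inner ℝ u y - q u - a) := by
      rw [← Real.exp_add, ← Real.exp_add]; congr 1; ring
    rw [h2]
    have : Real.exp a * (((1 - a) * Real.exp (inner ℝ u y) - Real.exp (inner ℝ u y) * inner ℝ u y)
      - Real.exp (inner ℝ u y) * q u) = Real.exp a * Real.exp (inner ℝ u y) * (- inner ℝ u y - q u - a + 1) := by ring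
    rw [this]
    gcongr
  have hint : Integrable (fun u => Real.exp (- q u)) μ := by
    apply Integrable.of_bound (C := 1) (Continuous.aestronglyMeasurable (by fun_prop))
    refine Filter.Eventually.of_forall fun u => ?_
    rw [Real.norm_eq_abs, Real.abs_exp]
    exact Real.exp_le_one_iff.2 (by linarith [hq0 u])
  have h3 := integral_mono ((((i1.const_mul (1 - a)).sub i2).sub i3).const_mul (Real.exp a)) hint key
  refine le_trans ?_ h3
  have e1 : ∫ u, Real.exp a * (((1 - a) * Real.exp (inner ℝ u y) - Real.exp (inner ℝ u y) * inner ℝ u y)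
      - Real.exp (inner ℝ u y) * q u) ∂μ = Real.exp a * (((1 - a) * Zf μ y - Zf μ y * inner ℝ (bf μ y) y) -
        ∫ u, Real.exp (inner ℝ u y) * q u ∂μ) := by
    have i12 : Integrable (fun u => (1 - a) * Real.exp (inner ℝ u y) - Real.exp (inner ℝ u y) * inner ℝ u y) μ :=
      (i1.const_mul (1 - a)).sub i2
    rw [integral_const_mul, integral_sub i12 i3, integral_sub (i1.const_mul (1 - a)) i2,
      integral_const_mul, hM]
    rfl
  have e2 : Real.exp (Real.log (Zf μ y) - inner ℝ (bf μ y) y - m) = Real.exp a * Zf μ y := by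
    have : Real.log (Zf μ y) - inner ℝ (bf μ y) y - m = a + Real.log (Zf μ y) := by rw [ha]; ring
    rw [this, Real.exp_add, Real.exp_log hZ]
  rw [e2]
  refine le_trans ?_ e1.ge
  gcongr
  have : (1 - a) * Zf μ y - Zf μ y * inner ℝ (bf μ y) y = Zf μ y + Zf μ y * m := by rw [ha]; ring
  linarith

theorem even_main (hn : 1 ≤ n) {p : EuclideanSpace ℝ (Fin n) → ℝ} {R : ℝ} (h : EvenLC p R) :
    ∃ (T : EuclideanSpace ℝ (Fin n) →ₗ[ℝ] EuclideanSpace ℝ (Fin n)) (b : EuclideanSpace ℝ (Fin n)),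
      0 < LinearMap.det T ∧ (40 ^ n : ℝ)⁻¹ * p 0 ≤ LinearMap.det T ∧
      (100000 ^ n : ℝ)⁻¹ ≤ ∫ u, p u * Real.exp (-(1 / 2) * ‖T (u - b)‖ ^ 2) := by
  have hprob := h.prob
  have hp0 := h.pos
  obtain ⟨δ, hδ, hS⟩ := exists_delta hn h
  obtain ⟨c, d, hc, G⟩ := logLaplace_goodPot h.ae h.symm hδ
  set ψ : EuclideanSpace ℝ (Fin n) → ℝ := fun y => Real.log (Zf (densM p) y) + δ / 2 * ‖y‖ ^ 2 with hψ
  have hψ0 : ψ 0 = 0 := by simp [hψ, Zf_zero]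
  have hev : ∀ y, ψ (-y) = ψ y := by intro y; simp [hψ, Zf_even h.symm]
  have hBM := BM_ineq G hc hev
  have ha : ENNReal.ofReal (p 0 / 9 ^ n) ≤ ∫⁻ y, ENNReal.ofReal (Real.exp (-ψ y)) := by
    have h1 : 1 ≤ (∫⁻ y, ENNReal.ofReal (Real.exp (-ψ y))) * ENNReal.ofReal (9 ^ n / p 0) :=
      hBM.trans (by gcongr)
    calc ENNReal.ofReal (p 0 / 9 ^ n) ≤ ((∫⁻ y, ENNReal.ofReal (Real.exp (-ψ y))) * ENNReal.ofReal (9 ^ n / p 0)) *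
          ENNReal.ofReal (p 0 / 9 ^ n) := le_mul_of_one_le_left (by positivity) h1
      _ = _ := by
        rw [mul_assoc, ← ENNReal.ofReal_mul (by positivity)]
        have : (9 : ℝ) ^ n / p 0 * (p 0 / 9 ^ n) = 1 := by field_simp
        rw [this, ENNReal.ofReal_one, mul_one]
  set K : ℝ := 2 * 648 ^ n / p 0 ^ 2 with hK
  have hKpos : 0 < K := by positivity
  obtain ⟨y, hy⟩ := G.pigeon hψ0 hKpos ha hS (by positivity) (by
    rw [finrank_euclideanSpace_fin, hK]
    have : (648 : ℝ) ^ n = 8 ^ n * 9 ^ n * 9 ^ n := by rw [← mul_pow, ← mul_pow]; norm_num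
    rw [this]
    have e : 2 * ((8 : ℝ) ^ n * 9 ^ n * 9 ^ n) / p 0 ^ 2 * (8 ^ n)⁻¹ * (p 0 / 9 ^ n) = 2 * (9 ^ n / p 0) := by
      field_simp
    rw [e]
    have : 0 < (9 : ℝ) ^ n / p 0 := by positivity
    linarith)
  set H := covf (densM p) y + δ • ContinuousLinearMap.id ℝ (EuclideanSpace ℝ (Fin n)) with hH
  have hcov0 : ∀ v, 0 ≤ inner ℝ (covf (densM p) y v) v := by
    intro v
    have h1 := cov_quad h.ae y v
    have h2 : 0 ≤ ∫ u, Real.exp (inner ℝ u y) * (inner ℝ (u - bf (densM p) y) v) ^ 2 ∂(densM p) :=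
      integral_nonneg fun u => by positivity
    rw [h1] at h2
    exact nonneg_of_mul_nonneg_right h2 (Zf_pos h.ae y)
  have hHv : ∀ v, inner ℝ (H v) v = inner ℝ (covf (densM p) y v) v + δ * ‖v‖ ^ 2 := by
    intro v
    simp [hH, inner_add_left, inner_smul_left]
  obtain ⟨T, e, l, hl, hel, hdet, hdet2, hT⟩ := exists_whiten H (fun v w => G.symm_g' y v w) (by
    intro v hv
    rw [hHv]
    have := norm_pos_iff.2 hv
    have := hcov0 v
    positivity)
  set b := bf (densM p) y with hb
  set Ev := Real.exp (ψ y - inner ℝ (b + δ • y) y) with hEv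
  have hEv1 : Ev ≤ 1 := Real.exp_le_one_iff.2 (G.le_one hψ0 y)
  have hEv0 : 0 < Ev := Real.exp_pos _
  set τ := LinearMap.det T with hτ
  have hDle : H.det ≤ K * Ev ^ 3 := (le_abs_self _).trans hy
  have hqm : ∫ u, Real.exp (inner ℝ u y) * ((1 / 2) * ‖T (u - b)‖ ^ 2) ∂(densM p) ≤ Zf (densM p) y * (n / 2) := by
    have e1 : ∀ u, Real.exp (inner ℝ u y) * ((1 / 2) * ‖T (u - b)‖ ^ 2) =
        ∑ i, (1 / 2 * (l i)⁻¹) * (Real.exp (inner ℝ u y) * (inner ℝ (u - b) (e i)) ^ 2) := by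
      intro u
      rw [hT, Finset.mul_sum, Finset.mul_sum]
      apply Finset.sum_congr rfl; intro i _; ring
    simp_rw [e1]
    rw [integral_finset_sum _ (fun i _ => (tilt_integrable' h.ae (by fun_prop) y).const_mul _)]
    have e2 : ∀ i, ∫ u, (1 / 2 * (l i)⁻¹) * (Real.exp (inner ℝ u y) * (inner ℝ (u - b) (e i)) ^ 2) ∂(densM p) ≤
        Zf (densM p) y * (1 / 2) := by
      intro i
      rw [integral_const_mul, cov_quad h.ae]
      have h1 : inner ℝ (covf (densM p) y (e i)) (e i) ≤ l i := by
        rw [← hel, hHv]; have := sq_nonneg ‖e i‖; nlinarith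
      have := Zf_pos h.ae y
      have h2 := hl i
      calc 1 / 2 * (l i)⁻¹ * (Zf (densM p) y * inner ℝ (covf (densM p) y (e i)) (e i))
          ≤ 1 / 2 * (l i)⁻¹ * (Zf (densM p) y * l i) := by gcongr
        _ = _ := by field_simp
    refine (Finset.sum_le_sum fun i _ => e2 i).trans ?_
    simp
    apply le_of_eq; ring
  have hTc : Continuous T := T.continuous_of_finiteDimensional
  have hJ := jensen_tilt h.ae y (q := fun u => (1 / 2) * ‖T (u - b)‖ ^ 2) (by fun_prop) (fun u => by positivity) hqm
  rw [integral_densM h.lc] at hJ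
  set I := ∫ u, p u * Real.exp (-(1 / 2 * ‖T (u - b)‖ ^ 2)) with hI
  have hIeq : ∫ u, p u * Real.exp (-(1 / 2) * ‖T (u - b)‖ ^ 2) = I := by
    simp_rw [neg_mul]; rfl
  have hIlow : Real.exp (-(n / 2 : ℝ)) * Ev ≤ I := by
    refine le_trans ?_ hJ
    rw [hEv, ← Real.exp_add]
    apply Real.exp_le_exp.2
    rw [inner_add_left, inner_smul_left, real_inner_self_eq_norm_sq]
    simp only [conj_trivial, hψ]
    have := mul_nonneg hδ.le (sq_nonneg ‖y‖)
    linarith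
  have hIup : I ≤ p 0 * (τ⁻¹ * (2 * π) ^ ((n : ℝ) / 2)) := by
    obtain ⟨g1, g2⟩ := integral_gauss_T T hdet b (by norm_num : (0 : ℝ) < 1 / 2)
    have : π / (1 / 2) = 2 * π := by ring
    rw [this] at g2
    rw [← g2, ← integral_const_mul, ← hIeq]
    apply integral_mono_of_nonneg
    · exact Filter.Eventually.of_forall fun u => mul_nonneg (h.lc.1 u) (Real.exp_pos _).le
    · exact g1.const_mul _
    · refine Filter.Eventually.of_forall fun u => ?_
      exact mul_le_mul_of_nonneg_right (h.max u) (Real.exp_pos _).le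
  have hpi : ((2 * π) ^ ((n : ℝ) / 2)) ^ 2 = (2 * π) ^ n := by
    rw [← Real.rpow_natCast, ← Real.rpow_mul (by positivity), ← Real.rpow_natCast]
    congr 1; push_cast; ring
  have hex : Real.exp (-(n / 2 : ℝ)) ^ 2 = (Real.exp 1 ^ n)⁻¹ := by
    rw [← Real.exp_nat_mul, ← Real.exp_nat_mul, ← Real.exp_neg]; congr 1; push_cast; ring
  have hDτ : (τ⁻¹) ^ 2 = H.det := by
    rw [inv_pow]; exact (eq_inv_of_mul_eq_one_right hdet2).symm
  have h2n : (2 : ℝ) ≤ 2 ^ n := by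
    calc (2 : ℝ) = 2 ^ 1 := by norm_num
      _ ≤ 2 ^ n := pow_le_pow_right₀ (by norm_num) hn
  have hElow : (27216 ^ n : ℝ)⁻¹ ≤ Ev := by
    have hI0 : 0 ≤ Real.exp (-(n / 2 : ℝ)) * Ev := by positivity
    have h1 : (Real.exp (-(n / 2 : ℝ)) * Ev) ^ 2 ≤ (p 0 * (τ⁻¹ * (2 * π) ^ ((n : ℝ) / 2))) ^ 2 :=
      pow_le_pow_left₀ hI0 (hIlow.trans hIup) 2
    rw [mul_pow, mul_pow, mul_pow, hpi, hex, hDτ] at h1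
    have h2 : (Real.exp 1 ^ n)⁻¹ * Ev ^ 2 ≤ p 0 ^ 2 * (K * Ev ^ 3 * (2 * π) ^ n) := h1.trans (by gcongr)
    have h3 : p 0 ^ 2 * (K * Ev ^ 3 * (2 * π) ^ n) = (2 * 648 ^ n * (2 * π) ^ n * Ev) * Ev ^ 2 := by
      rw [hK]; field_simp
    rw [h3] at h2
    have h4 := le_of_mul_le_mul_right h2 (by positivity)
    have h5 : (1 : ℝ) ≤ Real.exp 1 ^ n * (2 * 648 ^ n * (2 * π) ^ n * Ev) := by
      rwa [inv_le_iff_one_le_mul₀' (by positivity)] at h4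
    have h6 : Real.exp 1 ^ n * (2 * 648 ^ n * (2 * π) ^ n * Ev) ≤ 27216 ^ n * Ev := by
      calc Real.exp 1 ^ n * (2 * 648 ^ n * (2 * π) ^ n * Ev)
          ≤ 3 ^ n * (2 ^ n * 648 ^ n * 7 ^ n * Ev) := by
            gcongr
            · exact Real.exp_one_lt_d9.le.trans (by norm_num)
            · linarith [Real.pi_lt_d2]
        _ = (3 * 2 * 648 * 7) ^ n * Ev := by rw [mul_pow, mul_pow, mul_pow]; ring
        _ = _ := by norm_num
    rw [inv_le_iff_one_le_mul₀' (by positivity)]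
    linarith
  refine ⟨T, b, hdet, ?_, ?_⟩
  · have h1 : H.det ≤ K := hDle.trans (by
      have : Ev ^ 3 ≤ 1 := pow_le_one₀ hEv0.le hEv1
      nlinarith)
    have h2 : 1 ≤ τ ^ 2 * K := by rw [← hdet2]; gcongr
    have h3 : ((40 ^ n : ℝ)⁻¹ * p 0) ^ 2 ≤ τ ^ 2 := by
      have h4 : τ ^ 2 * K = τ ^ 2 * (2 * 648 ^ n) / p 0 ^ 2 := by rw [hK]; ring
      rw [h4, le_div_iff₀ (by positivity), one_mul] at h2
      have h5 : (2 : ℝ) * 648 ^ n ≤ (40 ^ n) ^ 2 := by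
        calc (2 : ℝ) * 648 ^ n ≤ 2 ^ n * 648 ^ n := by gcongr
          _ = 1296 ^ n := by rw [← mul_pow]; norm_num
          _ ≤ (40 ^ 2) ^ n := by gcongr; norm_num
          _ = _ := by rw [← pow_mul, ← pow_mul, mul_comm]
      rw [mul_pow, inv_pow, inv_mul_le_iff₀ (by positivity), mul_comm]
      exact h2.trans (by gcongr)
    exact le_of_sq_le_sq h3 hdet.le
  · rw [hIeq]
    refine le_trans ?_ hIlow
    have h1 : (3 ^ n : ℝ)⁻¹ ≤ Real.exp (-(n / 2 : ℝ)) := by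
      have : Real.exp (n / 2 : ℝ) ≤ 3 ^ n := by
        calc Real.exp (n / 2 : ℝ) ≤ Real.exp (n * 1) := by
              apply Real.exp_le_exp.2; have : (0 : ℝ) ≤ n := Nat.cast_nonneg n; linarith
          _ = Real.exp 1 ^ n := by rw [Real.exp_nat_mul]
          _ ≤ 3 ^ n := by gcongr; exact Real.exp_one_lt_d9.le.trans (by norm_num)
      rw [Real.exp_neg]
      gcongr
    calc (100000 ^ n : ℝ)⁻¹ ≤ ((3 * 27216) ^ n)⁻¹ := by gcongr; norm_num
      _ = (3 ^ n)⁻¹ * (27216 ^ n)⁻¹ := by rw [mul_pow, mul_inv]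
      _ ≤ _ := by gcongr
end PartE3

section PartF
variable {n : ℕ}

lemma lint_sqrt3 {f : (EuclideanSpace ℝ (Fin n)) → ℝ} (hf : IsLogConcave f) (h1 : ∫⁻ x, ENNReal.ofReal (f x) = 1) (hn : 1 ≤ n)
    {x1 : (EuclideanSpace ℝ (Fin n))} (hx1 : ∀ x, f x ≤ 2 * f x1) :
    ENNReal.ofReal ((4 ^ n)⁻¹ * √(f x1)) ≤ ∫⁻ x, ENNReal.ofReal (f x * √(f x)) := by
  have hsh := lintegral_half_shift (fun x => ENNReal.ofReal (f x * √(f x))) x1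
  have key : ∀ x, ENNReal.ofReal (√(f x1) / 2) * ENNReal.ofReal (f x) ≤
      ENNReal.ofReal (f ((1 / 2 : ℝ) • x + (1 / 2 : ℝ) • x1) * √(f ((1 / 2 : ℝ) • x + (1 / 2 : ℝ) • x1))) := by
    intro x
    rw [← ENNReal.ofReal_mul (by positivity)]
    apply ENNReal.ofReal_le_ofReal
    have a1 := lc_sqrt hf x x1
    have a2 : √(f x) / 2 ≤ √(√(f x) * √(f x1)) := by
      apply Real.le_sqrt_of_sq_le
      have a3 : √(f x) ≤ 2 * √(f x1) := by
        rw [Real.sqrt_le_left (by positivity), mul_pow, Real.sq_sqrt (hf.1 _)]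
        linarith [hx1 x, hf.1 x1]
      nlinarith [Real.sqrt_nonneg (f x)]
    calc √(f x1) / 2 * f x = (√(f x) * √(f x1)) * (√(f x) / 2) := by
          have := Real.mul_self_sqrt (hf.1 x)
          linear_combination (-√(f x1) / 2) * this
      _ ≤ (√(f x) * √(f x1)) * √(√(f x) * √(f x1)) := by gcongr
      _ ≤ _ := by gcongr; exact hf.1 _
  have h2 : ENNReal.ofReal (√(f x1) / 2) ≤ 2 ^ n * ∫⁻ x, ENNReal.ofReal (f x * √(f x)) := by
    rw [← hsh]
    calc ENNReal.ofReal (√(f x1) / 2) = ∫⁻ x, ENNReal.ofReal (√(f x1) / 2) * ENNReal.ofReal (f x) := by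
          rw [lintegral_const_mul' _ _ ENNReal.ofReal_ne_top, h1, mul_one]
      _ ≤ _ := lintegral_mono key
  have e2 : (2 : ENNReal) ^ n = ENNReal.ofReal (2 ^ n) := by
    rw [ENNReal.ofReal_pow (by norm_num)]; norm_num
  have h2n : (2 : ℝ) ≤ 2 ^ n := by
    calc (2 : ℝ) = 2 ^ 1 := by norm_num
      _ ≤ 2 ^ n := pow_le_pow_right₀ (by norm_num) hn
  calc ENNReal.ofReal ((4 ^ n)⁻¹ * √(f x1)) ≤ ENNReal.ofReal ((2 ^ n)⁻¹ * (√(f x1) / 2)) := by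
        apply ENNReal.ofReal_le_ofReal
        have : (4 : ℝ) ^ n = 2 ^ n * 2 ^ n := by rw [← mul_pow]; norm_num
        rw [this, mul_inv, mul_assoc]
        gcongr
        rw [div_eq_inv_mul]
        gcongr
    _ = ENNReal.ofReal (2 ^ n)⁻¹ * ENNReal.ofReal (√(f x1) / 2) := by rw [ENNReal.ofReal_mul (by positivity)]
    _ ≤ ENNReal.ofReal (2 ^ n)⁻¹ * (2 ^ n * ∫⁻ x, ENNReal.ofReal (f x * √(f x))) := by gcongr
    _ = _ := by
        rw [e2, ← mul_assoc, ← ENNReal.ofReal_mul (by positivity), inv_mul_cancel₀ (by positivity)]; simp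

lemma lint_conv_eq {F G : (EuclideanSpace ℝ (Fin n)) → ENNReal} (h : F =ᵐ[volume] G) (z : (EuclideanSpace ℝ (Fin n))) :
    ∫⁻ a, F a * F (z - a) = ∫⁻ a, G a * G (z - a) := by
  apply lintegral_congr_ae
  have h2 := (Measure.measurePreserving_sub_left (volume : Measure (EuclideanSpace ℝ (Fin n))) z).quasiMeasurePreserving.ae_eq_comp h
  filter_upwards [h, h2] with a ha hb
  simp only [Function.comp] at hb
  rw [ha, hb]

lemma lint_m_ge {f : (EuclideanSpace ℝ (Fin n)) → ℝ} (hf : IsLogConcave f) :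
    (2 ^ n)⁻¹ * (∫⁻ x, ENNReal.ofReal (f x * √(f x))) ^ 2 ≤
    ∫⁻ w, (∫⁻ a, ENNReal.ofReal (f a) * ENNReal.ofReal (f ((2 : ℝ) • w - a))) * ENNReal.ofReal (f w) := by
  have hm := (lc_aemeasurable hf).ennreal_ofReal
  set F := hm.mk _ with hF
  have hFm : Measurable F := hm.measurable_mk
  have hFe : (fun x => ENNReal.ofReal (f x)) =ᵐ[volume] F := hm.ae_eq_mk
  have e1 : ∫⁻ w, (∫⁻ a, ENNReal.ofReal (f a) * ENNReal.ofReal (f ((2 : ℝ) • w - a))) * ENNReal.ofReal (f w) =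
      ∫⁻ w, ∫⁻ a, F a * F ((2 : ℝ) • w - a) * F w := by
    apply lintegral_congr_ae
    filter_upwards [hFe] with w hw
    rw [hw, lint_conv_eq hFe, lintegral_mul_const _ (by fun_prop)]
  have e2 : ∀ a, ∫⁻ w, F a * F ((2 : ℝ) • w - a) * F w =
      (2 ^ n)⁻¹ * (F a * ∫⁻ c, F c * F ((1 / 2 : ℝ) • c + (1 / 2 : ℝ) • a)) := by
    intro a
    have := lintegral_half_shift (fun w => F ((2 : ℝ) • w - a) * F w) a
    have h3 : ∀ c : (EuclideanSpace ℝ (Fin n)), (2 : ℝ) • ((1 / 2 : ℝ) • c + (1 / 2 : ℝ) • a) - a = c := by intro c; module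
    simp_rw [h3] at this
    rw [this]
    simp_rw [mul_assoc (F a)]
    rw [lintegral_const_mul _ (by fun_prop), mul_left_comm, ← mul_assoc _ (2 ^ n) _,
      ENNReal.inv_mul_cancel (by positivity) (by simp), one_mul]
  rw [e1, lintegral_lintegral_swap (by fun_prop)]
  simp_rw [e2]
  rw [lintegral_const_mul' _ _ (by simp)]
  gcongr
  rw [sq]
  have hsm : AEMeasurable (fun x => ENNReal.ofReal (f x * √(f x))) :=
    ((lc_aemeasurable hf).mul (lc_aemeasurable hf).sqrt).ennreal_ofReal
  rw [← lintegral_mul_const'' _ hsm]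
  apply lintegral_mono_ae
  filter_upwards [hFe] with a ha
  rw [← ha, ENNReal.ofReal_mul (hf.1 a), mul_assoc]
  gcongr
  rw [← lintegral_const_mul' _ _ ENNReal.ofReal_ne_top]
  have hq : Measure.QuasiMeasurePreserving (fun c : (EuclideanSpace ℝ (Fin n)) => (1 / 2 : ℝ) • c + (1 / 2 : ℝ) • a) volume volume := by
    have q1 : Measure.QuasiMeasurePreserving (fun c : (EuclideanSpace ℝ (Fin n)) => (1 / 2 : ℝ) • c) volume volume :=
      ⟨measurable_const_smul _, by
        rw [Measure.map_addHaar_smul _ (by norm_num)]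
        exact Measure.smul_absolutelyContinuous⟩
    exact (measurePreserving_add_right (volume : Measure (EuclideanSpace ℝ (Fin n))) ((1 / 2 : ℝ) • a)).quasiMeasurePreserving.comp q1
  have h2 := hq.ae_eq_comp hFe
  apply lintegral_mono_ae
  filter_upwards [hFe, h2] with c hc hc2
  simp only [Function.comp] at hc2
  rw [← hc, ← hc2, ← ENNReal.ofReal_mul (by positivity), ← ENNReal.ofReal_mul (hf.1 _)]
  apply ENNReal.ofReal_le_ofReal
  have := mul_le_mul_of_nonneg_left (lc_sqrt hf c a) (hf.1 c)
  linarith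

lemma exists_center {f : (EuclideanSpace ℝ (Fin n)) → ℝ} (hf : IsLogConcave f) (h1 : ∫⁻ x, ENNReal.ofReal (f x) = 1) (hn : 1 ≤ n)
    {x1 : (EuclideanSpace ℝ (Fin n))} (hx1 : ∀ x, f x ≤ 2 * f x1) :
    ∃ w, ENNReal.ofReal ((33 ^ n)⁻¹ * f x1) < ∫⁻ x, ENNReal.ofReal (f (w + x) * f (w - x)) := by
  by_contra hcon
  push Not at hcon
  have hpos : 0 < f x1 := by
    obtain ⟨x, hx⟩ := lc_exists_pos h1
    linarith [hx1 x]
  have e0 : ∀ w, ∫⁻ x, ENNReal.ofReal (f (w + x) * f (w - x)) =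
      ∫⁻ a, ENNReal.ofReal (f a) * ENNReal.ofReal (f ((2 : ℝ) • w - a)) := by
    intro w
    rw [← lintegral_add_left_eq_self (fun a => ENNReal.ofReal (f a) * ENNReal.ofReal (f ((2 : ℝ) • w - a))) w]
    apply lintegral_congr
    intro x
    rw [ENNReal.ofReal_mul (hf.1 _)]
    congr 3
    module
  simp_rw [e0] at hcon
  have h2 := lint_m_ge hf
  have h3 : ∫⁻ w, (∫⁻ a, ENNReal.ofReal (f a) * ENNReal.ofReal (f ((2 : ℝ) • w - a))) * ENNReal.ofReal (f w) ≤
      ENNReal.ofReal ((33 ^ n)⁻¹ * f x1) := by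
    calc _ ≤ ∫⁻ w, ENNReal.ofReal ((33 ^ n)⁻¹ * f x1) * ENNReal.ofReal (f w) := by
          apply lintegral_mono; intro w; simp only; gcongr; exact hcon w
      _ = _ := by rw [lintegral_const_mul' _ _ ENNReal.ofReal_ne_top, h1, mul_one]
  have h4 : ENNReal.ofReal ((32 ^ n)⁻¹ * f x1) ≤ (2 ^ n)⁻¹ * (∫⁻ x, ENNReal.ofReal (f x * √(f x))) ^ 2 := by
    have e2 : ((2 : ENNReal) ^ n)⁻¹ = ENNReal.ofReal (2 ^ n)⁻¹ := by
      rw [ENNReal.ofReal_inv_of_pos (by positivity), ENNReal.ofReal_pow (by norm_num)]; norm_num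
    calc ENNReal.ofReal ((32 ^ n)⁻¹ * f x1) = (2 ^ n)⁻¹ * ENNReal.ofReal ((4 ^ n)⁻¹ * √(f x1)) ^ 2 := by
          rw [e2, ← ENNReal.ofReal_pow (by positivity), ← ENNReal.ofReal_mul (by positivity), mul_pow,
            Real.sq_sqrt hpos.le, ← mul_assoc]
          congr 2
          have : (32 : ℝ) ^ n = 2 ^ n * (4 ^ n) ^ 2 := by
            rw [← pow_mul, mul_comm n 2, pow_mul, ← mul_pow]; norm_num
          rw [this]
          field_simp
      _ ≤ _ := by gcongr; exact lint_sqrt3 hf h1 hn hx1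
  have h5 := (h4.trans h2).trans h3
  rw [ENNReal.ofReal_le_ofReal_iff (by positivity)] at h5
  have h6 := le_of_mul_le_mul_right h5 hpos
  have h7 : ((33 : ℝ) ^ n)⁻¹ < (32 ^ n)⁻¹ := by
    have : (32 : ℝ) ^ n < 33 ^ n := pow_lt_pow_left₀ (by norm_num) (by norm_num) (by omega)
    gcongr
  linarith
end PartF

section PartF2
variable {n : ℕ}

lemma lc_sym_prod {f : (EuclideanSpace ℝ (Fin n)) → ℝ} (hf : IsLogConcave f) (w : (EuclideanSpace ℝ (Fin n))) (R : ℝ) {c : ℝ} (hc : 0 ≤ c) :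
    IsLogConcave (fun x => (Metric.closedBall (0 : (EuclideanSpace ℝ (Fin n))) R).indicator (fun x => c * (f (w + x) * f (w - x))) x) := by
  have hnn : ∀ x, 0 ≤ c * (f (w + x) * f (w - x)) := fun x => mul_nonneg hc (mul_nonneg (hf.1 _) (hf.1 _))
  refine ⟨fun x => Set.indicator_nonneg (fun x _ => hnn x) x, ?_⟩
  intro x y t ht0 ht1
  rcases ht0.eq_or_lt with rfl | ht0'
  · simp
  rcases ht1.eq_or_lt with rfl | ht1'
  · simp
  have h0 : ∀ z, 0 ≤ (Metric.closedBall (0 : (EuclideanSpace ℝ (Fin n))) R).indicator (fun x => c * (f (w + x) * f (w - x))) z :=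
    fun x => Set.indicator_nonneg (fun x _ => hnn x) x
  by_cases hx : x ∈ Metric.closedBall (0 : (EuclideanSpace ℝ (Fin n))) R
  swap
  · simp only
    rw [Set.indicator_of_notMem hx, Real.zero_rpow ht0'.ne', zero_mul]
    exact h0 _
  by_cases hy : y ∈ Metric.closedBall (0 : (EuclideanSpace ℝ (Fin n))) R
  swap
  · simp only
    rw [Set.indicator_of_notMem hy, Real.zero_rpow (by linarith), mul_zero]
    exact h0 _
  have hz : t • x + (1 - t) • y ∈ Metric.closedBall (0 : (EuclideanSpace ℝ (Fin n))) R :=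
    convex_closedBall (0 : (EuclideanSpace ℝ (Fin n))) R hx hy ht0 (by linarith) (by ring)
  simp only
  rw [Set.indicator_of_mem hx, Set.indicator_of_mem hy, Set.indicator_of_mem hz]
  have a1 := hf.2 (w + x) (w + y) t ht0 ht1
  have a2 := hf.2 (w - x) (w - y) t ht0 ht1
  have b1 : t • (w + x) + (1 - t) • (w + y) = w + (t • x + (1 - t) • y) := by module
  have b2 : t • (w - x) + (1 - t) • (w - y) = w - (t • x + (1 - t) • y) := by module
  rw [b1] at a1
  rw [b2] at a2
  have c1 : c ^ t * c ^ (1 - t) = c := by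
    rw [← Real.rpow_add_of_nonneg hc ht0 (by linarith)]; simp
  rw [Real.mul_rpow hc (mul_nonneg (hf.1 _) (hf.1 _)), Real.mul_rpow hc (mul_nonneg (hf.1 _) (hf.1 _)),
    Real.mul_rpow (hf.1 _) (hf.1 _), Real.mul_rpow (hf.1 _) (hf.1 _)]
  calc _ = (c ^ t * c ^ (1 - t)) * ((f (w + x) ^ t * f (w + y) ^ (1 - t)) * (f (w - x) ^ t * f (w - y) ^ (1 - t))) := by ring
    _ ≤ c * (f (w + (t • x + (1 - t) • y)) * f (w - (t • x + (1 - t) • y))) := by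
      rw [c1]
      gcongr
      · exact mul_nonneg (Real.rpow_nonneg (hf.1 _) _) (Real.rpow_nonneg (hf.1 _) _)
      · exact hf.1 _

theorem lc_gauss (hn : 1 ≤ n) {f : (EuclideanSpace ℝ (Fin n)) → ℝ} (hf : IsLogConcave f) (h1 : ∫⁻ x, ENNReal.ofReal (f x) = 1)
    {x1 : (EuclideanSpace ℝ (Fin n))} (hx1 : ∀ x, f x ≤ 2 * f x1) :
    ∃ (T : (EuclideanSpace ℝ (Fin n)) →ₗ[ℝ] (EuclideanSpace ℝ (Fin n))) (b : (EuclideanSpace ℝ (Fin n))), 0 < LinearMap.det T ∧ (1320 ^ n : ℝ)⁻¹ * f x1 ≤ LinearMap.det T ∧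
      (6600000 ^ n : ℝ)⁻¹ ≤ ∫ u, f u * Real.exp (-(1 / 2) * ‖T (u - b)‖ ^ 2) := by
  have hpos : 0 < f x1 := by
    obtain ⟨x, hx⟩ := lc_exists_pos h1
    linarith [hx1 x]
  obtain ⟨w, hw⟩ := exists_center hf h1 hn hx1
  have hfi := lc_integrable hf h1
  have i1 : Integrable (fun x => f (w + x)) := hfi.comp_add_left w
  have i2 : Integrable (fun x => f (w - x)) := hfi.comp_sub_left w
  set G : (EuclideanSpace ℝ (Fin n)) → ℝ := fun x => f (w + x) * f (w - x) with hG
  have hG0 : ∀ x, 0 ≤ G x := fun x => mul_nonneg (hf.1 _) (hf.1 _)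
  have hGle : ∀ x, G x ≤ f w * ((1 / 2) * (f (w + x) + f (w - x))) := by
    intro x
    have a1 := lc_sqrt hf (w + x) (w - x)
    have e1 : (1 / 2 : ℝ) • (w + x) + (1 / 2 : ℝ) • (w - x) = w := by module
    rw [e1] at a1
    have s1 := Real.mul_self_sqrt (hf.1 (w + x))
    have s2 := Real.mul_self_sqrt (hf.1 (w - x))
    have a2 : √(f (w + x)) * √(f (w - x)) ≤ (1 / 2) * (f (w + x) + f (w - x)) := by
      nlinarith [sq_nonneg (√(f (w + x)) - √(f (w - x)))]
    calc G x = (√(f (w + x)) * √(f (w - x))) * (√(f (w + x)) * √(f (w - x))) := by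
          rw [hG]; simp only
          linear_combination (-f (w - x)) * s1 - (√(f (w + x)) * √(f (w + x))) * s2
      _ ≤ _ := by gcongr; exact hf.1 w
  have iB : Integrable (fun x => f w * ((1 / 2) * (f (w + x) + f (w - x)))) := ((i1.add i2).const_mul _).const_mul _
  have iG : Integrable G := iB.mono' (i1.aestronglyMeasurable.mul i2.aestronglyMeasurable)
    (Filter.Eventually.of_forall fun x => by rw [Real.norm_eq_abs, abs_of_nonneg (hG0 x)]; exact hGle x)
  have hGint : ∫ x, G x ≤ f w := by
    refine (integral_mono iG iB hGle).trans ?_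
    rw [integral_const_mul, integral_const_mul, integral_add i1 i2, integral_add_left_eq_self (fun x => f x) w,
      integral_sub_left_eq_self (fun x => f x) volume w, lc_integral hf h1]
    linarith
  have hGgt : (33 ^ n)⁻¹ * f x1 < ∫ x, G x := by
    rw [← ofReal_integral_eq_lintegral_ofReal iG (Filter.Eventually.of_forall hG0)] at hw
    exact (ENNReal.ofReal_lt_ofReal_iff_of_nonneg (by positivity)).1 hw
  have htend := (aecover_closedBall (μ := (volume : Measure (EuclideanSpace ℝ (Fin n)))) (x := (0 : (EuclideanSpace ℝ (Fin n))))
    (tendsto_natCast_atTop_atTop (R := ℝ))).integral_tendsto_of_countably_generated iG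
  obtain ⟨k, hk⟩ := ((tendsto_order.1 htend).1 _ hGgt).exists
  set R : ℝ := (k : ℝ) with hR
  set m := ∫ x in Metric.closedBall (0 : (EuclideanSpace ℝ (Fin n))) R, G x with hm
  have hm0 : 0 < m := lt_trans (by positivity) hk
  have hmle : m ≤ f w := (setIntegral_le_integral iG (Filter.Eventually.of_forall hG0)).trans hGint
  set p : (EuclideanSpace ℝ (Fin n)) → ℝ := fun x => (Metric.closedBall (0 : (EuclideanSpace ℝ (Fin n))) R).indicator (fun x => m⁻¹ * G x) x with hp
  have hplc : IsLogConcave p := lc_sym_prod hf w R (inv_nonneg.2 hm0.le)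
  have hpint : ∫ x, p x = 1 := by
    rw [hp, integral_indicator Metric.isClosed_closedBall.measurableSet, integral_const_mul, inv_mul_cancel₀ hm0.ne']
  have hpI : Integrable p := by
    by_contra hni
    rw [integral_undef hni] at hpint
    norm_num at hpint
  have hE : EvenLC p R := by
    refine ⟨hplc, ?_, ?_, ?_⟩
    · rw [← ofReal_integral_eq_lintegral_ofReal hpI (Filter.Eventually.of_forall hplc.1), hpint, ENNReal.ofReal_one]
    · intro x
      simp only [hp, hG]
      by_cases hx : x ∈ Metric.closedBall (0 : (EuclideanSpace ℝ (Fin n))) R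
      · have hx' : -x ∈ Metric.closedBall (0 : (EuclideanSpace ℝ (Fin n))) R := by simpa using hx
        rw [Set.indicator_of_mem hx, Set.indicator_of_mem hx', sub_neg_eq_add, ← sub_eq_add_neg, mul_comm (f (w - x))]
      · have hx' : -x ∉ Metric.closedBall (0 : (EuclideanSpace ℝ (Fin n))) R := by simpa using hx
        rw [Set.indicator_of_notMem hx, Set.indicator_of_notMem hx']
    · intro x hx
      simp only [hp]
      apply Set.indicator_of_notMem
      simpa using hx
  obtain ⟨T, b, hT, hTp, hI⟩ := even_main hn hE
  have hp0 : m ≤ p 0 := by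
    have : p 0 = m⁻¹ * (f w * f w) := by
      simp only [hp, hG]
      rw [Set.indicator_of_mem (by simp [hR])]
      simp
    rw [this, inv_mul_eq_div, le_div_iff₀ hm0]
    gcongr
    exact hf.1 w
  refine ⟨T, w + b, hT, ?_, ?_⟩
  · calc (1320 ^ n : ℝ)⁻¹ * f x1 = (40 ^ n)⁻¹ * ((33 ^ n)⁻¹ * f x1) := by
          rw [← mul_assoc, ← mul_inv, ← mul_pow]; norm_num
      _ ≤ (40 ^ n)⁻¹ * p 0 := by
          gcongr
          exact hk.le.trans hp0
      _ ≤ _ := hTp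
  · have hple : ∀ u, p u ≤ 66 ^ n * f (w + u) := by
      intro u
      have h0 : 0 ≤ 66 ^ n * f (w + u) := mul_nonneg (by positivity) (hf.1 _)
      simp only [hp]
      refine Set.indicator_le' (f := fun x => m⁻¹ * G x) (g := fun u => 66 ^ n * f (w + u)) (fun x _ => ?_)
        (fun x _ => mul_nonneg (by positivity) (hf.1 _)) u
      simp only [hG]
      rw [inv_mul_le_iff₀ hm0]
      have h2 := hx1 (w - x)
      have h3 : 2 * f x1 ≤ m * 66 ^ n := by
        have h2n : (2 : ℝ) ≤ 2 ^ n := by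
          calc (2 : ℝ) = 2 ^ 1 := by norm_num
            _ ≤ 2 ^ n := pow_le_pow_right₀ (by norm_num) hn
        have e66 : (66 : ℝ) ^ n = 2 ^ n * 33 ^ n := by rw [← mul_pow]; norm_num
        have h4 : f x1 ≤ m * 33 ^ n := by
          have := hk.le
          rw [inv_mul_le_iff₀ (by positivity)] at this
          linarith
        calc 2 * f x1 ≤ 2 ^ n * (m * 33 ^ n) := by gcongr
          _ = _ := by rw [e66]; ring
      nlinarith [hf.1 (w + x)]
    have hTc : Continuous T := T.continuous_of_finiteDimensional
    have iS : Integrable (fun u => f (w + u) * Real.exp (-(1 / 2) * ‖T (u - b)‖ ^ 2)) := by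
      refine i1.mul_bdd (c := 1) (Continuous.aestronglyMeasurable (by fun_prop)) ?_
      refine Filter.Eventually.of_forall fun u => ?_
      rw [Real.norm_eq_abs, Real.abs_exp]
      exact Real.exp_le_one_iff.2 (by have := sq_nonneg ‖T (u - b)‖; linarith)
    have h5 : ∫ u, p u * Real.exp (-(1 / 2) * ‖T (u - b)‖ ^ 2) ≤
        66 ^ n * ∫ u, f (w + u) * Real.exp (-(1 / 2) * ‖T (u - b)‖ ^ 2) := by
      rw [← integral_const_mul]
      apply integral_mono_of_nonneg
      · exact Filter.Eventually.of_forall fun u => mul_nonneg (hplc.1 u) (Real.exp_pos _).le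
      · exact iS.const_mul _
      · refine Filter.Eventually.of_forall fun u => ?_
        simp only
        rw [← mul_assoc]
        exact mul_le_mul_of_nonneg_right (hple u) (Real.exp_pos _).le
    have h6 : ∫ u, f (w + u) * Real.exp (-(1 / 2) * ‖T (u - b)‖ ^ 2) =
        ∫ u, f u * Real.exp (-(1 / 2) * ‖T (u - (w + b))‖ ^ 2) := by
      rw [← integral_add_left_eq_self (fun u => f u * Real.exp (-(1 / 2) * ‖T (u - (w + b))‖ ^ 2)) w]
      congr 1; ext u
      rw [add_sub_add_left_eq_sub]
    rw [← h6]
    have h7 := hI.trans h5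
    rw [← inv_mul_le_iff₀ (by positivity), ← mul_inv, ← mul_pow] at h7
    norm_num at h7 ⊢
    exact h7

theorem lc_gauss' (hn : 1 ≤ n) {f : (EuclideanSpace ℝ (Fin n)) → ℝ} (hf : IsLogConcave f) (h1 : ∫⁻ x, ENNReal.ofReal (f x) = 1)
    {x1 : (EuclideanSpace ℝ (Fin n))} (hx1 : ∀ x, f x ≤ 2 * f x1) :
    ∃ (T : (EuclideanSpace ℝ (Fin n)) →ₗ[ℝ] (EuclideanSpace ℝ (Fin n))) (b : (EuclideanSpace ℝ (Fin n))), LinearMap.det T = 1 ∧ ∀ s : ℝ, 0 ≤ s → s ^ n ≤ (1320 ^ n : ℝ)⁻¹ * f x1 → 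
      (6600000 ^ n : ℝ)⁻¹ ≤ ∫ u, f u * Real.exp (-(s ^ 2 / 2) * ‖T (u - b)‖ ^ 2) := by
  obtain ⟨T, b, hT, hTd, hI⟩ := lc_gauss hn hf h1 hx1
  set t := (LinearMap.det T) ^ ((n : ℝ)⁻¹) with ht
  have ht0 : 0 < t := Real.rpow_pos_of_pos hT _
  have htn : t ^ n = LinearMap.det T := Real.rpow_inv_natCast_pow hT.le (by omega)
  refine ⟨t⁻¹ • T, b, ?_, ?_⟩
  · rw [LinearMap.det_smul, finrank_euclideanSpace_fin, inv_pow, htn, inv_mul_cancel₀ hT.ne']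
  · intro s hs hsn
    refine hI.trans ?_
    have hst : s ≤ t := by
      refine le_of_pow_le_pow_left₀ (by omega) ht0.le ?_ (n := n)
      rw [htn]; exact hsn.trans hTd
    have hTc : Continuous T := T.continuous_of_finiteDimensional
    have bnd : ∀ (c : ℝ), 0 ≤ c → ∀ (S : (EuclideanSpace ℝ (Fin n)) →ₗ[ℝ] (EuclideanSpace ℝ (Fin n))), Integrable (fun u => f u * Real.exp (-c * ‖S (u - b)‖ ^ 2)) := by
      intro c hc S
      have hSc : Continuous S := S.continuous_of_finiteDimensional
      refine (lc_integrable hf h1).mul_bdd (c := 1) (Continuous.aestronglyMeasurable (by fun_prop)) ?_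
      refine Filter.Eventually.of_forall fun u => ?_
      rw [Real.norm_eq_abs, Real.abs_exp]
      exact Real.exp_le_one_iff.2 (by have := mul_nonneg hc (sq_nonneg ‖S (u - b)‖); linarith)
    apply integral_mono (bnd _ (by norm_num) T) (bnd _ (by positivity) _)
    intro u
    simp only
    refine mul_le_mul_of_nonneg_left (Real.exp_le_exp.2 ?_) (hf.1 u)
    rw [LinearMap.smul_apply, norm_smul, Real.norm_eq_abs, abs_of_pos (inv_pos.2 ht0), mul_pow]
    have h8 : s ^ 2 * (t⁻¹) ^ 2 ≤ 1 := by
      rw [← mul_pow, ← div_eq_mul_inv]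
      exact pow_le_one₀ (by positivity) ((div_le_one ht0).2 hst)
    nlinarith [sq_nonneg ‖T (u - b)‖]
end PartF2

section PartH1
variable {n : ℕ}

lemma gibbs_pt {r q ψ : ℝ} (hr : 0 ≤ r) (hq : 0 ≤ q) (h : 0 < r → Real.exp (-ψ) ≤ q) :
    -(r * Real.log r) ≤ r * ψ + q - r := by
  rcases hr.eq_or_lt with rfl | hr'
  · simpa using hq
  have h1 := h hr'
  have h2 := Real.add_one_le_exp (-ψ - Real.log r)
  rw [Real.exp_sub, Real.exp_log hr'] at h2
  have h3 : r * (-ψ - Real.log r + 1) ≤ r * (Real.exp (-ψ) / r) := by gcongr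
  rw [mul_div_cancel₀ _ hr'.ne'] at h3
  linarith

lemma dEnt_withDensity {f : (EuclideanSpace ℝ (Fin n)) → ℝ} (hf0 : ∀ x, 0 ≤ f x) (hf : AEMeasurable f) :
    dEnt (volume.withDensity fun x => ENNReal.ofReal (f x)) = -∫ x, f x * Real.log (f x) := by
  rw [dEnt]
  congr 1
  apply integral_congr_ae
  filter_upwards [Measure.rnDeriv_withDensity₀ (volume : Measure (EuclideanSpace ℝ (Fin n))) hf.ennreal_ofReal] with x hx
  rw [hx, ENNReal.toReal_ofReal (hf0 x)]

lemma lc_ent {f : (EuclideanSpace ℝ (Fin n)) → ℝ} (hf : IsLogConcave f) (h1 : ∫⁻ x, ENNReal.ofReal (f x) = 1)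
    {x1 : (EuclideanSpace ℝ (Fin n))} (hx1 : ∀ x, f x ≤ 2 * f x1) :
    Integrable (fun x => f x * Real.log (f x)) ∧ -Real.log (2 * f x1) ≤ -∫ x, f x * Real.log (f x) ∧
      -∫ x, f x * Real.log (f x) ≤ 2 * n * Real.log 2 - Real.log (f x1) := by
  have hpos : 0 < f x1 := by
    obtain ⟨x, hx⟩ := lc_exists_pos h1
    linarith [hx1 x]
  have hfi := lc_integrable hf h1
  have hf1 := lc_integral hf h1
  set q : (EuclideanSpace ℝ (Fin n)) → ℝ := fun x => (2 ^ n)⁻¹ * f ((1 / 2 : ℝ) • x + (1 / 2 : ℝ) • x1) with hq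
  have hq0 : ∀ x, 0 ≤ q x := fun x => mul_nonneg (by positivity) (hf.1 _)
  have hqi : Integrable q := by
    have h2 : Integrable (fun x : (EuclideanSpace ℝ (Fin n)) => f (x + (1 / 2 : ℝ) • x1)) := hfi.comp_add_right _
    have h3 := (integrable_comp_smul_iff (volume : Measure (EuclideanSpace ℝ (Fin n))) (fun x : (EuclideanSpace ℝ (Fin n)) => f (x + (1 / 2 : ℝ) • x1))
      (by norm_num : (1 / 2 : ℝ) ≠ 0)).2 h2
    exact h3.const_mul _
  have hq1 : ∫ x, q x = 1 := by
    have h2 := lintegral_half_shift (fun x => ENNReal.ofReal (f x)) x1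
    rw [h1, mul_one] at h2
    have h3 : ∫ x : (EuclideanSpace ℝ (Fin n)), f ((1 / 2 : ℝ) • x + (1 / 2 : ℝ) • x1) = 2 ^ n := by
      have hi : Integrable (fun x : (EuclideanSpace ℝ (Fin n)) => f ((1 / 2 : ℝ) • x + (1 / 2 : ℝ) • x1)) := by
        have := hqi.const_mul (2 ^ n)
        simpa [hq, ← mul_assoc] using this
      rw [integral_eq_lintegral_of_nonneg_ae (Filter.Eventually.of_forall fun x => hf.1 _) hi.aestronglyMeasurable, h2]
      simp
    rw [hq, integral_const_mul, h3, inv_mul_cancel₀ (by positivity)]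
  have hub : ∀ x, -(f x * Real.log (f x)) ≤ f x * (2 * n * Real.log 2 - Real.log (f x1)) + 2 * q x - 2 * f x := by
    intro x
    have := gibbs_pt (ψ := -(1 / 2) * Real.log (f x) - (1 / 2) * Real.log (f x1) + n * Real.log 2) (hf.1 x) (hq0 x) (by
      intro hx
      have h4 := lc_sqrt hf x x1
      have e1 : Real.exp (-(-(1 / 2) * Real.log (f x) - (1 / 2) * Real.log (f x1) + n * Real.log 2)) =
          (2 ^ n)⁻¹ * (√(f x) * √(f x1)) := by
        have s1 : √(f x) = Real.exp (Real.log (f x) / 2) := by rw [Real.exp_half, Real.exp_log hx]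
        have s2 : √(f x1) = Real.exp (Real.log (f x1) / 2) := by rw [Real.exp_half, Real.exp_log hpos]
        have s3 : ((2 : ℝ) ^ n)⁻¹ = Real.exp (-(n * Real.log 2)) := by
          rw [Real.exp_neg, Real.exp_nat_mul, Real.exp_log (by norm_num)]
        rw [s1, s2, s3, ← Real.exp_add, ← Real.exp_add]; congr 1; ring
      rw [e1, hq]
      simp only
      gcongr)
    linarith
  have hlb : ∀ x, f x * (-Real.log (2 * f x1)) ≤ -(f x * Real.log (f x)) := by
    intro x
    rcases (hf.1 x).eq_or_lt with h | h
    · rw [← h]; simp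
    · have := Real.log_le_log h (hx1 x)
      nlinarith
  have iub : Integrable (fun x => f x * (2 * n * Real.log 2 - Real.log (f x1)) + 2 * q x - 2 * f x) :=
    ((hfi.mul_const _).add (hqi.const_mul 2)).sub (hfi.const_mul 2)
  have ilb : Integrable (fun x => f x * (-Real.log (2 * f x1))) := hfi.mul_const _
  have hm : AEStronglyMeasurable (fun x => -(f x * Real.log (f x))) :=
    ((lc_aemeasurable hf).mul (lc_aemeasurable hf).log).neg.aestronglyMeasurable
  have hi : Integrable (fun x => -(f x * Real.log (f x))) :=
    integrable_of_le_of_le hm (Filter.Eventually.of_forall hlb) (Filter.Eventually.of_forall hub) ilb iub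
  refine ⟨by simpa using hi.neg, ?_, ?_⟩
  · rw [← integral_neg]
    have := integral_mono ilb hi hlb
    rw [integral_mul_const, hf1, one_mul] at this
    exact this
  · rw [← integral_neg]
    have := integral_mono hi iub hub
    have i2 : Integrable (fun x => f x * (2 * n * Real.log 2 - Real.log (f x1)) + 2 * q x) :=
      (hfi.mul_const _).add (hqi.const_mul 2)
    rw [integral_sub i2 (hfi.const_mul 2), integral_add (hfi.mul_const _) (hqi.const_mul 2),
      integral_mul_const, integral_const_mul (2 : ℝ) q, integral_const_mul (2 : ℝ) f, hf1, hq1] at this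
    linarith
end PartH1

section PartH2
variable {n : ℕ}

/-- extended-valued density of the sum -/
noncomputable def convE (f g : (EuclideanSpace ℝ (Fin n)) → ℝ) (z : (EuclideanSpace ℝ (Fin n))) : ENNReal :=
  ∫⁻ a, ENNReal.ofReal (f a) * ENNReal.ofReal (g (z - a))

lemma convE_measurable {f g : (EuclideanSpace ℝ (Fin n)) → ℝ} (hf : IsLogConcave f) (hg : IsLogConcave g) : Measurable (convE f g) := by
  have hm := (lc_aemeasurable hf).ennreal_ofReal
  have hk := (lc_aemeasurable hg).ennreal_ofReal
  have hFm : Measurable (hm.mk _) := hm.measurable_mk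
  have hGm : Measurable (hk.mk _) := hk.measurable_mk
  have : convE f g = fun z => ∫⁻ a, hm.mk _ a * hk.mk _ (z - a) := by
    ext z
    apply lintegral_congr_ae
    have h2 := (Measure.measurePreserving_sub_left (volume : Measure (EuclideanSpace ℝ (Fin n))) z).quasiMeasurePreserving.ae_eq_comp hk.ae_eq_mk
    filter_upwards [hm.ae_eq_mk, h2] with a ha hb
    simp only [Function.comp] at hb
    rw [ha, hb]
  rw [this]
  apply Measurable.lintegral_prod_right'
    (f := fun p : (EuclideanSpace ℝ (Fin n)) × (EuclideanSpace ℝ (Fin n)) => hm.mk _ p.2 * hk.mk _ (p.1 - p.2))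
  fun_prop

lemma conv_eq {f g : (EuclideanSpace ℝ (Fin n)) → ℝ} (hf : IsLogConcave f) (hg : IsLogConcave g) :
    (densM f).conv (densM g) = volume.withDensity (convE f g) := by
  rw [densM, densM, conv_withDensity_eq_mlconvolution₀ (lc_aemeasurable hf).ennreal_ofReal (lc_aemeasurable hg).ennreal_ofReal]
  congr 1
  ext z
  rw [lconvolution, convE]
  congr 1; ext a
  rw [neg_add_eq_sub]

lemma convE_le {f g : (EuclideanSpace ℝ (Fin n)) → ℝ} (h1 : ∫⁻ x, ENNReal.ofReal (g x) = 1) {A : ℝ}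
    (hA : ∀ x, f x ≤ A) (z : (EuclideanSpace ℝ (Fin n))) : convE f g z ≤ ENNReal.ofReal A := by
  calc convE f g z ≤ ∫⁻ a, ENNReal.ofReal A * ENNReal.ofReal (g (z - a)) := by
        apply lintegral_mono; intro a; simp only; gcongr; exact hA a
    _ = _ := by
        rw [lintegral_const_mul' _ _ ENNReal.ofReal_ne_top, lintegral_sub_left_eq_self (fun x => ENNReal.ofReal (g x)) z,
          h1, mul_one]

lemma sqrt_ge_of_le {a A : ℝ} (ha : 0 ≤ a) (hA : 0 < A) (h : a ≤ A) : a / √A ≤ √a := by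
  rw [div_le_iff₀ (Real.sqrt_pos.2 hA)]
  nth_rewrite 1 [← Real.mul_self_sqrt ha]
  gcongr

lemma convE_mid {f g : (EuclideanSpace ℝ (Fin n)) → ℝ} (hf : IsLogConcave f) (hg : IsLogConcave g) {A B : ℝ} (hA0 : 0 < A) (hB0 : 0 < B)
    (hA : ∀ x, f x ≤ A) (hB : ∀ x, g x ≤ B) (x y z0 : (EuclideanSpace ℝ (Fin n))) :
    ENNReal.ofReal (√(f x) * √(g y) / (√A * √B)) * convE f g z0 ≤
      2 ^ n * convE f g ((1 / 2 : ℝ) • (x + y) + (1 / 2 : ℝ) • z0) := by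
  rw [convE, convE, ← lintegral_half_shift (fun a => ENNReal.ofReal (f a) *
    ENNReal.ofReal (g ((1 / 2 : ℝ) • (x + y) + (1 / 2 : ℝ) • z0 - a))) x, ← lintegral_const_mul' _ _ ENNReal.ofReal_ne_top]
  apply lintegral_mono
  intro a
  simp only
  have e1 : (1 / 2 : ℝ) • (x + y) + (1 / 2 : ℝ) • z0 - ((1 / 2 : ℝ) • a + (1 / 2 : ℝ) • x) =
    (1 / 2 : ℝ) • (z0 - a) + (1 / 2 : ℝ) • y := by module
  rw [e1, ← ENNReal.ofReal_mul (hf.1 _), ← ENNReal.ofReal_mul (hf.1 _), ← ENNReal.ofReal_mul (by positivity)]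
  apply ENNReal.ofReal_le_ofReal
  have a1 := lc_sqrt hf a x
  have a2 := lc_sqrt hg (z0 - a) y
  have b1 := sqrt_ge_of_le (hf.1 a) hA0 (hA a)
  have b2 := sqrt_ge_of_le (hg.1 (z0 - a)) hB0 (hB (z0 - a))
  have p1 := hf.1 a
  have p2 := hg.1 (z0 - a)
  calc √(f x) * √(g y) / (√A * √B) * (f a * g (z0 - a))
      = ((f a / √A) * √(f x)) * ((g (z0 - a) / √B) * √(g y)) := by ring
    _ ≤ (√(f a) * √(f x)) * (√(g (z0 - a)) * √(g y)) := by gcongr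
    _ ≤ _ := by gcongr; exact hf.1 _

lemma densM_prob {f : (EuclideanSpace ℝ (Fin n)) → ℝ} (h1 : ∫⁻ x, ENNReal.ofReal (f x) = 1) : IsProbabilityMeasure (densM f) := by
  constructor
  rw [densM, withDensity_apply _ MeasurableSet.univ, Measure.restrict_univ, h1]

lemma integrable_densM {f : (EuclideanSpace ℝ (Fin n)) → ℝ} (hf0 : ∀ x, 0 ≤ f x) (hf : AEMeasurable f) {φ : (EuclideanSpace ℝ (Fin n)) → ℝ} :
    Integrable φ (densM f) ↔ Integrable (fun x => f x * φ x) := by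
  rw [densM, integrable_withDensity_iff_integrable_smul₀' hf.ennreal_ofReal
    (Filter.Eventually.of_forall fun x => ENNReal.ofReal_lt_top)]
  simp only [ENNReal.toReal_ofReal (hf0 _), smul_eq_mul]

lemma integral_densM' {f : (EuclideanSpace ℝ (Fin n)) → ℝ} (hf0 : ∀ x, 0 ≤ f x) (hf : AEMeasurable f) (φ : (EuclideanSpace ℝ (Fin n)) → ℝ) :
    ∫ u, φ u ∂(densM f) = ∫ u, f u * φ u := by
  rw [densM, integral_withDensity_eq_integral_toReal_smul₀ hf.ennreal_ofReal
    (Filter.Eventually.of_forall fun x => ENNReal.ofReal_lt_top)]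
  congr 1; ext u; rw [ENNReal.toReal_ofReal (hf0 u), smul_eq_mul]

lemma densM_pos_ae {f : (EuclideanSpace ℝ (Fin n)) → ℝ} (hf : AEMeasurable f) : ∀ᵐ x ∂(densM f), 0 < f x := by
  rw [densM, ae_withDensity_iff' hf.ennreal_ofReal]
  refine Filter.Eventually.of_forall fun u hu => ?_
  by_contra hlt
  exact hu (ENNReal.ofReal_of_nonpos (not_lt.1 hlt))

/-- existence of a point of high density for the sum -/
lemma exists_high {f g : (EuclideanSpace ℝ (Fin n)) → ℝ} {r : (EuclideanSpace ℝ (Fin n)) → ℝ} (hr0 : ∀ z, 0 ≤ r z) (hrm : Measurable r)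
    (h1 : ∫⁻ x, ENNReal.ofReal (f x) = 1) (h2 : ∫⁻ x, ENNReal.ofReal (g x) = 1)
    (hf : IsLogConcave f) (hg : IsLogConcave g)
    (hconv : (densM f).conv (densM g) = densM r) {s γ : ℝ} (hs : 0 < s) (hγ : 0 < γ) (b1 b2 : (EuclideanSpace ℝ (Fin n)))
    (hγ1 : γ ≤ ∫ u, f u * Real.exp (-(s ^ 2 / 2) * ‖u - b1‖ ^ 2))
    (hγ2 : γ ≤ ∫ u, g u * Real.exp (-(s ^ 2 / 2) * ‖u - b2‖ ^ 2)) :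
    ∃ z0, γ ^ 2 / (2 * (π / (s ^ 2 / 4)) ^ ((n : ℝ) / 2)) ≤ r z0 := by
  by_contra hcon
  push Not at hcon
  have hp1 := densM_prob h1
  have hp2 := densM_prob h2
  set G : ℝ := (π / (s ^ 2 / 4)) ^ ((n : ℝ) / 2) with hG
  have hGpos : 0 < G := by positivity
  rw [← integral_densM hf] at hγ1
  rw [← integral_densM hg] at hγ2
  set Φ : (EuclideanSpace ℝ (Fin n)) → ℝ := fun z => Real.exp (-(s ^ 2 / 4) * ‖z - (b1 + b2)‖ ^ 2) with hΦ
  have hΦm : Continuous Φ := by fun_prop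
  have hΦ1 : ∀ z, Φ z ≤ 1 := fun z => Real.exp_le_one_iff.2 (by
    have := mul_nonneg (by positivity : 0 ≤ s ^ 2 / 4) (sq_nonneg ‖z - (b1 + b2)‖); linarith)
  have a1 : γ ^ 2 ≤ ∫ p, Real.exp (-(s ^ 2 / 2) * ‖p.1 - b1‖ ^ 2) * Real.exp (-(s ^ 2 / 2) * ‖p.2 - b2‖ ^ 2)
      ∂((densM f).prod (densM g)) := by
    rw [integral_prod_mul (fun u => Real.exp (-(s ^ 2 / 2) * ‖u - b1‖ ^ 2)) (fun u => Real.exp (-(s ^ 2 / 2) * ‖u - b2‖ ^ 2)), sq]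
    gcongr
  have a2 : ∫ p, Real.exp (-(s ^ 2 / 2) * ‖p.1 - b1‖ ^ 2) * Real.exp (-(s ^ 2 / 2) * ‖p.2 - b2‖ ^ 2)
      ∂((densM f).prod (densM g)) ≤ ∫ p, Φ (p.1 + p.2) ∂((densM f).prod (densM g)) := by
    apply integral_mono_of_nonneg
    · exact Filter.Eventually.of_forall fun p => by positivity
    · apply Integrable.of_bound (C := 1) (Continuous.aestronglyMeasurable (by fun_prop))
      refine Filter.Eventually.of_forall fun p => ?_
      rw [Real.norm_eq_abs, Real.abs_exp]
      exact hΦ1 _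
    · refine Filter.Eventually.of_forall fun p => ?_
      simp only [hΦ]
      rw [← Real.exp_add]
      apply Real.exp_le_exp.2
      have e1 : p.1 + p.2 - (b1 + b2) = (p.1 - b1) + (p.2 - b2) := by abel
      rw [e1]
      have e2 := parallelogram_law_with_norm ℝ (p.1 - b1) (p.2 - b2)
      have e3 := mul_nonneg (by positivity : 0 ≤ s ^ 2 / 4) (sq_nonneg ‖p.1 - b1 - (p.2 - b2)‖)
      have e4 : s ^ 2 / 4 * (‖p.1 - b1 + (p.2 - b2)‖ ^ 2 + ‖p.1 - b1 - (p.2 - b2)‖ ^ 2)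
        = s ^ 2 / 4 * (2 * (‖p.1 - b1‖ ^ 2 + ‖p.2 - b2‖ ^ 2)) := by rw [e2]
      nlinarith
  have a3 : ∫ p, Φ (p.1 + p.2) ∂((densM f).prod (densM g)) = ∫ z, r z * Φ z := by
    rw [← integral_densM' hr0 hrm.aemeasurable, ← hconv, Measure.conv,
      integral_map (by fun_prop) hΦm.aestronglyMeasurable]
  have a4 : ∫ z, r z * Φ z ≤ γ ^ 2 / (2 * G) * G := by
    have g2 := GaussianFourier.integral_rexp_neg_mul_sq_norm (V := (EuclideanSpace ℝ (Fin n))) (by positivity : 0 < s ^ 2 / 4)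
    rw [finrank_euclideanSpace_fin] at g2
    have g3 : ∫ z, Φ z = G := by
      rw [hΦ, integral_sub_right_eq_self (fun z : (EuclideanSpace ℝ (Fin n)) => Real.exp (-(s ^ 2 / 4) * ‖z‖ ^ 2)) (b1 + b2), g2]
    have g4 : Integrable Φ := (integrable_gauss (E := (EuclideanSpace ℝ (Fin n))) (by positivity : 0 < s ^ 2 / 4)).comp_sub_right (b1 + b2)
    rw [← g3, ← integral_const_mul]
    rw [g3]
    apply integral_mono_of_nonneg
    · exact Filter.Eventually.of_forall fun z => mul_nonneg (hr0 z) (Real.exp_pos _).le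
    · exact g4.const_mul _
    · exact Filter.Eventually.of_forall fun z => mul_le_mul_of_nonneg_right (hcon z).le (Real.exp_pos _).le
  have a5 : γ ^ 2 / (2 * G) * G = γ ^ 2 / 2 := by field_simp
  rw [a5] at a4
  have := a1.trans (a2.trans (a3.le.trans a4))
  nlinarith
end PartH2

section PartH3
variable {n : ℕ}

lemma integrable_of_lint_one {r : (EuclideanSpace ℝ (Fin n)) → ℝ} (hr0 : ∀ z, 0 ≤ r z) (hrm : Measurable r)
    (h : ∫⁻ z, ENNReal.ofReal (r z) = 1) : Integrable r ∧ ∫ z, r z = 1 := by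
  refine ⟨⟨hrm.aestronglyMeasurable, ?_⟩, ?_⟩
  · rw [hasFiniteIntegral_iff_ofReal (Filter.Eventually.of_forall hr0), h]
    exact ENNReal.one_lt_top
  · rw [integral_eq_lintegral_of_nonneg_ae (Filter.Eventually.of_forall hr0) hrm.aestronglyMeasurable, h]
    simp

/-- entropy of the sum is controlled by the density of the sum at any point -/
lemma two_body {f g : (EuclideanSpace ℝ (Fin n)) → ℝ} (hf : IsLogConcave f) (hg : IsLogConcave g)
    (h1 : ∫⁻ x, ENNReal.ofReal (f x) = 1) (h2 : ∫⁻ x, ENNReal.ofReal (g x) = 1)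
    {x1 x2 : (EuclideanSpace ℝ (Fin n))} (hx1 : ∀ x, f x ≤ 2 * f x1) (hx2 : ∀ x, g x ≤ 2 * g x2)
    {r : (EuclideanSpace ℝ (Fin n)) → ℝ} (hr0 : ∀ z, 0 ≤ r z) (hrm : Measurable r) (hre : ∀ z, convE f g z = ENNReal.ofReal (r z))
    {z0 : (EuclideanSpace ℝ (Fin n))} (hz0 : 0 < r z0) :
    dEnt ((densM f).conv (densM g)) ≤ 4 * n * Real.log 2 + Real.log 2 - Real.log (r z0) := by
  have hp1 := densM_prob h1
  have hp2 := densM_prob h2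
  have hconv : (densM f).conv (densM g) = densM r := by
    rw [conv_eq hf hg, densM]; congr 1; ext z; exact hre z
  have hr1 : ∫⁻ z, ENNReal.ofReal (r z) = 1 := by
    have hh : IsProbabilityMeasure ((densM f).conv (densM g)) := inferInstance
    have := hh.measure_univ
    rwa [hconv, densM, withDensity_apply _ MeasurableSet.univ, Measure.restrict_univ] at this
  obtain ⟨hri, hrI⟩ := integrable_of_lint_one hr0 hrm hr1
  have hp1x : 0 < f x1 := by
    obtain ⟨x, hx⟩ := lc_exists_pos h1
    linarith [hx1 x]
  have hp2x : 0 < g x2 := by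
    obtain ⟨x, hx⟩ := lc_exists_pos h2
    linarith [hx2 x]
  obtain ⟨if1, _, hf3⟩ := lc_ent hf h1 hx1
  obtain ⟨ig1, _, hg3⟩ := lc_ent hg h2 hx2
  have hlA : Real.log (2 * f x1) = Real.log 2 + Real.log (f x1) := Real.log_mul (by norm_num) hp1x.ne'
  have hlB : Real.log (2 * g x2) = Real.log 2 + Real.log (g x2) := Real.log_mul (by norm_num) hp2x.ne'
  set A := 2 * f x1 with hA
  set B := 2 * g x2 with hB
  have hA0 : 0 < A := by positivity
  have hB0 : 0 < B := by positivity
  have hrA : ∀ z, r z ≤ A := by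
    intro z
    have := convE_le (f := f) h2 hx1 z
    rw [hre] at this
    exact (ENNReal.ofReal_le_ofReal_iff hA0.le).1 this
  have hmid : ∀ x y, √(f x) * √(g y) / (√A * √B) * r z0 ≤ 2 ^ n * r ((1 / 2 : ℝ) • (x + y) + (1 / 2 : ℝ) • z0) := by
    intro x y
    have := convE_mid hf hg hA0 hB0 hx1 hx2 x y z0
    rw [hre, hre, ← ENNReal.ofReal_mul (by positivity)] at this
    have e : (2 : ENNReal) ^ n = ENNReal.ofReal (2 ^ n) := by
      rw [ENNReal.ofReal_pow (by norm_num)]; norm_num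
    rw [e, ← ENNReal.ofReal_mul (by positivity)] at this
    exact (ENNReal.ofReal_le_ofReal_iff (mul_nonneg (by positivity) (hr0 _))).1 this
  set q : (EuclideanSpace ℝ (Fin n)) → ℝ := fun z => (2 ^ n)⁻¹ * r ((1 / 2 : ℝ) • z + (1 / 2 : ℝ) • z0) with hq
  have hq0 : ∀ z, 0 ≤ q z := fun z => mul_nonneg (by positivity) (hr0 _)
  have hqm : Measurable q := by
    apply Measurable.const_mul
    exact hrm.comp (by fun_prop)
  have hq1 : ∫⁻ z, ENNReal.ofReal (q z) = 1 := by
    have h3 := lintegral_half_shift (fun x => ENNReal.ofReal (r x)) z0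
    rw [hr1, mul_one] at h3
    simp only [hq]
    have e : ∀ z : (EuclideanSpace ℝ (Fin n)), ENNReal.ofReal ((2 ^ n)⁻¹ * r ((1 / 2 : ℝ) • z + (1 / 2 : ℝ) • z0)) =
      ENNReal.ofReal ((2 ^ n)⁻¹) * ENNReal.ofReal (r ((1 / 2 : ℝ) • z + (1 / 2 : ℝ) • z0)) :=
      fun z => ENNReal.ofReal_mul (by positivity)
    simp only [e]
    rw [lintegral_const_mul' _ _ ENNReal.ofReal_ne_top, h3]
    have e2 : (2 : ENNReal) ^ n = ENNReal.ofReal (2 ^ n) := by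
      rw [ENNReal.ofReal_pow (by norm_num)]; norm_num
    rw [e2, ← ENNReal.ofReal_mul (by positivity), inv_mul_cancel₀ (by positivity), ENNReal.ofReal_one]
  obtain ⟨hqi, hqI⟩ := integrable_of_lint_one hq0 hqm hq1
  have hqlow : ∀ x y, (2 ^ n)⁻¹ * ((2 ^ n)⁻¹ * (√(f x) * √(g y) / (√A * √B) * r z0)) ≤ q (x + y) := by
    intro x y
    have := hmid x y
    simp only [hq]
    gcongr
    rw [inv_mul_le_iff₀ (by positivity)]
    exact this
  have hqpos : ∀ x y, 0 < f x → 0 < g y → 0 < q (x + y) := by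
    intro x y hx hy
    exact lt_of_lt_of_le (by positivity) (hqlow x y)
  have hloglow : ∀ x y, 0 < f x → 0 < g y →
      (Real.log (r z0) - 2 * n * Real.log 2 - Real.log A / 2 - Real.log B / 2) +
        ((1 / 2) * Real.log (f x) + (1 / 2) * Real.log (g y)) ≤ Real.log (q (x + y)) := by
    intro x y hx hy
    have h3 := Real.log_le_log (by positivity) (hqlow x y)
    rw [Real.log_mul (by positivity) (by positivity), Real.log_mul (by positivity) (by positivity),
      Real.log_mul (by positivity) (by positivity), Real.log_div (by positivity) (by positivity),
      Real.log_mul (by positivity) (by positivity), Real.log_mul (by positivity) (by positivity),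
      Real.log_inv, Real.log_pow, Real.log_sqrt hx.le, Real.log_sqrt hy.le, Real.log_sqrt hA0.le,
      Real.log_sqrt hB0.le] at h3
    linarith
  have hrq : ∀ z, 0 < r z → 0 < q z := by
    intro z hz
    by_contra hcon
    have h0 : convE f g z = 0 := by
      rw [convE]
      have : ∀ a, ENNReal.ofReal (f a) * ENNReal.ofReal (g (z - a)) = 0 := by
        intro a
        by_contra hne
        have ha : 0 < f a := by
          by_contra h; apply hne; rw [ENNReal.ofReal_of_nonpos (not_lt.1 h), zero_mul]
        have hb : 0 < g (z - a) := by
          by_contra h; apply hne; rw [ENNReal.ofReal_of_nonpos (not_lt.1 h), mul_zero]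
        have := hqpos a (z - a) ha hb
        rw [add_sub_cancel] at this
        exact hcon this
      simp [this]
    rw [hre, ENNReal.ofReal_eq_zero] at h0
    linarith
  have haeP1 : ∀ᵐ p ∂((densM f).prod (densM g)), 0 < f p.1 :=
    Measure.quasiMeasurePreserving_fst.ae (densM_pos_ae (lc_aemeasurable hf))
  have haeP2 : ∀ᵐ p ∂((densM f).prod (densM g)), 0 < g p.2 :=
    Measure.quasiMeasurePreserving_snd.ae (densM_pos_ae (lc_aemeasurable hg))
  have ilf : Integrable (fun x => Real.log (f x)) (densM f) :=
    (integrable_densM hf.1 (lc_aemeasurable hf)).2 if1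
  have ilg : Integrable (fun x => Real.log (g x)) (densM g) :=
    (integrable_densM hg.1 (lc_aemeasurable hg)).2 ig1
  have i1 : Integrable (fun p : (EuclideanSpace ℝ (Fin n)) × (EuclideanSpace ℝ (Fin n)) => (1 / 2) * Real.log (f p.1)) ((densM f).prod (densM g)) :=
    (ilf.comp_fst (densM g)).const_mul _
  have i2 : Integrable (fun p : (EuclideanSpace ℝ (Fin n)) × (EuclideanSpace ℝ (Fin n)) => (1 / 2) * Real.log (g p.2)) ((densM f).prod (densM g)) :=
    (ilg.comp_snd (densM f)).const_mul _
  have i12 : Integrable (fun p : (EuclideanSpace ℝ (Fin n)) × (EuclideanSpace ℝ (Fin n)) => (1 / 2) * Real.log (f p.1) + (1 / 2) * Real.log (g p.2))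
    ((densM f).prod (densM g)) := i1.add i2
  set c := Real.log (r z0) - 2 * n * Real.log 2 - Real.log A / 2 - Real.log B / 2 with hc
  have i3 : Integrable (fun p : (EuclideanSpace ℝ (Fin n)) × (EuclideanSpace ℝ (Fin n)) => c + ((1 / 2) * Real.log (f p.1) + (1 / 2) * Real.log (g p.2)))
    ((densM f).prod (densM g)) := (integrable_const c).add i12
  have hlow : ∀ᵐ p ∂((densM f).prod (densM g)),
      c + ((1 / 2) * Real.log (f p.1) + (1 / 2) * Real.log (g p.2)) ≤ Real.log (q (p.1 + p.2)) := by
    filter_upwards [haeP1, haeP2] with p h3 h4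
    exact hloglow p.1 p.2 h3 h4
  have hup : ∀ᵐ p ∂((densM f).prod (densM g)), Real.log (q (p.1 + p.2)) ≤ Real.log ((2 ^ n)⁻¹ * A) := by
    filter_upwards [haeP1, haeP2] with p h3 h4
    apply Real.log_le_log (hqpos _ _ h3 h4)
    simp only [hq]
    gcongr
    exact hrA _
  have hadd : Measurable (fun p : (EuclideanSpace ℝ (Fin n)) × (EuclideanSpace ℝ (Fin n)) => p.1 + p.2) := by fun_prop
  have iP : Integrable (fun p : (EuclideanSpace ℝ (Fin n)) × (EuclideanSpace ℝ (Fin n)) => Real.log (q (p.1 + p.2))) ((densM f).prod (densM g)) :=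
    integrable_of_le_of_le (hqm.log.comp hadd).aestronglyMeasurable hlow hup i3 (integrable_const _)
  have iq : Integrable (fun z => Real.log (q z)) (densM r) := by
    rw [← hconv, Measure.conv, integrable_map_measure hqm.log.aestronglyMeasurable hadd.aemeasurable]
    exact iP
  have eq1 : ∫ z, r z * Real.log (q z) = ∫ p, Real.log (q (p.1 + p.2)) ∂((densM f).prod (densM g)) := by
    rw [← integral_densM' hr0 hrm.aemeasurable, ← hconv, Measure.conv,
      integral_map hadd.aemeasurable hqm.log.aestronglyMeasurable]
  have low : c + ((1 / 2) * (∫ x, f x * Real.log (f x)) + (1 / 2) * ∫ x, g x * Real.log (g x)) ≤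
      ∫ z, r z * Real.log (q z) := by
    rw [eq1]
    have h5 := integral_mono_ae i3 iP hlow
    rw [integral_add (integrable_const c) i12, integral_add i1 i2, integral_const_mul, integral_const_mul] at h5
    have e1 : ∫ p : (EuclideanSpace ℝ (Fin n)) × (EuclideanSpace ℝ (Fin n)), Real.log (f p.1) ∂((densM f).prod (densM g)) = ∫ x, f x * Real.log (f x) := by
      rw [← integral_densM' hf.1 (lc_aemeasurable hf) (fun x => Real.log (f x))]
      rw [integral_fun_fst (fun x => Real.log (f x))]
      simp
    have e2 : ∫ p : (EuclideanSpace ℝ (Fin n)) × (EuclideanSpace ℝ (Fin n)), Real.log (g p.2) ∂((densM f).prod (densM g)) = ∫ x, g x * Real.log (g x) := by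
      rw [← integral_densM' hg.1 (lc_aemeasurable hg) (fun x => Real.log (g x))]
      rw [integral_fun_snd (fun x => Real.log (g x))]
      simp
    rw [e1, e2] at h5
    simpa using h5
  have iq' : Integrable (fun z => r z * Real.log (q z)) := (integrable_densM hr0 hrm.aemeasurable).1 iq
  have hub : ∀ z, -(r z * Real.log (r z)) ≤ -(r z * Real.log (q z)) + q z - r z := by
    intro z
    have := gibbs_pt (ψ := -Real.log (q z)) (hr0 z) (hq0 z) (by
      intro hz
      rw [neg_neg, Real.exp_log (hrq z hz)])
    linarith
  have hlb : ∀ z, r z * (-Real.log A) ≤ -(r z * Real.log (r z)) := by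
    intro z
    rcases (hr0 z).eq_or_lt with h | h
    · rw [← h]; simp
    · have := Real.log_le_log h (hrA z)
      nlinarith
  have j0 : Integrable (fun z => -(r z * Real.log (q z))) := iq'.neg
  have j1 : Integrable (fun z => -(r z * Real.log (q z)) + q z) := iq'.neg.add hqi
  have j2 : Integrable (fun z => -(r z * Real.log (q z)) + q z - r z) := j1.sub hri
  have j3 : Integrable (fun z => -(r z * Real.log (r z))) :=
    integrable_of_le_of_le (hrm.mul hrm.log).neg.aestronglyMeasurable (Filter.Eventually.of_forall hlb)
      (Filter.Eventually.of_forall hub) (hri.mul_const _) j2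
  have fin := integral_mono j3 j2 hub
  rw [integral_sub j1 hri, integral_add j0 hqi, integral_neg, integral_neg, hqI, hrI] at fin
  rw [hconv, densM, dEnt_withDensity hr0 hrm.aemeasurable]
  rw [hc] at low
  linarith
end PartH3

section PartH4
variable {n : ℕ}

lemma exists_near_max {f : (EuclideanSpace ℝ (Fin n)) → ℝ} (hf : IsLogConcave f) (h1 : ∫⁻ x, ENNReal.ofReal (f x) = 1) :
    ∃ x1, 0 < f x1 ∧ ∀ x, f x ≤ 2 * f x1 := by
  obtain ⟨x, hx⟩ := lc_exists_pos h1
  have hb := lc_bdd hf h1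
  have hM : 0 < sSup (Set.range f) := lt_of_lt_of_le hx (le_csSup hb ⟨x, rfl⟩)
  obtain ⟨_, ⟨x1, rfl⟩, hx1⟩ := exists_lt_of_lt_csSup (Set.range_nonempty f) (half_lt_self hM)
  refine ⟨x1, by linarith, fun y => ?_⟩
  have := le_csSup hb ⟨y, rfl⟩
  linarith

/-- transfer of a log-concave density through a volume preserving linear map -/
lemma transfer (hn : 1 ≤ n) {f : (EuclideanSpace ℝ (Fin n)) → ℝ} (hf : IsLogConcave f) (h1 : ∫⁻ x, ENNReal.ofReal (f x) = 1)
    {x1 : (EuclideanSpace ℝ (Fin n))} (hx1 : ∀ x, f x ≤ 2 * f x1) :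
    ∃ (T : (EuclideanSpace ℝ (Fin n)) →ₗ[ℝ] (EuclideanSpace ℝ (Fin n))) (f' : (EuclideanSpace ℝ (Fin n)) → ℝ) (x1' b : (EuclideanSpace ℝ (Fin n))), MeasurePreserving T volume volume ∧
      IsLogConcave f' ∧ (∫⁻ x, ENNReal.ofReal (f' x) = 1) ∧ f' x1' = f x1 ∧ (∀ x, f' x ≤ 2 * f' x1') ∧
      Measure.map T (densM f) = densM f' ∧
      ∀ s : ℝ, 0 ≤ s → s ^ n ≤ (1320 ^ n : ℝ)⁻¹ * f x1 →
        (6600000 ^ n : ℝ)⁻¹ ≤ ∫ u, f' u * Real.exp (-(s ^ 2 / 2) * ‖u - b‖ ^ 2) := by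
  obtain ⟨T, b, hT, hmain⟩ := lc_gauss' hn hf h1 hx1
  have hT0 : LinearMap.det T ≠ 0 := by rw [hT]; exact one_ne_zero
  let e := T.equivOfDetNeZero hT0
  have heT : ∀ x, e x = T x := fun x => rfl
  have hTc : Continuous T := T.continuous_of_finiteDimensional
  have hec : Continuous e.symm := (e.symm : (EuclideanSpace ℝ (Fin n)) →ₗ[ℝ] (EuclideanSpace ℝ (Fin n))).continuous_of_finiteDimensional
  have hmp : MeasurePreserving T volume volume := by
    refine ⟨hTc.measurable, ?_⟩
    rw [Measure.map_linearMap_addHaar_eq_smul_addHaar volume hT0, hT]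
    simp
  let em : (EuclideanSpace ℝ (Fin n)) ≃ᵐ (EuclideanSpace ℝ (Fin n)) := (e.toContinuousLinearEquiv.toHomeomorph).toMeasurableEquiv
  have hem : ∀ x, em x = T x := fun x => rfl
  have hmpe : MeasurePreserving em volume volume := hmp
  have hes : ∀ x, e.symm (T x) = x := fun x => e.symm_apply_apply x
  have key : ∀ x, f (e.symm (em x)) = f x := fun x => by rw [hem, hes]
  refine ⟨T, fun x => f (e.symm x), T x1, T b, hmp, ⟨fun x => hf.1 _, ?_⟩, ?_, ?_, ?_, ?_, ?_⟩
  · intro x y t h0 h1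
    have := hf.2 (e.symm x) (e.symm y) t h0 h1
    simpa using this
  · rw [← hmpe.lintegral_comp_emb em.measurableEmbedding]
    simp only [key]; exact h1
  · simp only [hes]
  · intro x; simp only [hes]; exact hx1 _
  · have : Measure.map T (densM f) = Measure.map em (densM f) := rfl
    rw [this]
    ext S hS
    rw [em.map_apply, densM, densM, withDensity_apply _ hS, withDensity_apply _ (em.measurable hS)]
    rw [← hmpe.setLIntegral_comp_preimage_emb em.measurableEmbedding (fun x => ENNReal.ofReal (f (e.symm x))) S]
    simp only [key]
  · intro s hs hs'
    refine (hmain s hs hs').trans (le_of_eq ?_)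
    rw [← hmpe.integral_comp em.measurableEmbedding
      (fun u => f (e.symm u) * Real.exp (-(s ^ 2 / 2) * ‖u - T b‖ ^ 2))]
    simp only [hem, hes, map_sub]

/-- the entropy bound with the absolute constant -/
noncomputable def Kc : ℝ := 7 * Real.log 2 + 2 * Real.log 6600000 + Real.log (4 * π) / 2 + Real.log 1320

lemma core (hn : 1 ≤ n) {f g : (EuclideanSpace ℝ (Fin n)) → ℝ} (hf : IsLogConcave f) (hg : IsLogConcave g)
    (h1 : ∫⁻ x, ENNReal.ofReal (f x) = 1) (h2 : ∫⁻ x, ENNReal.ofReal (g x) = 1) :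
    ∃ (T₁ T₂ : (EuclideanSpace ℝ (Fin n)) →ₗ[ℝ] (EuclideanSpace ℝ (Fin n))), MeasurePreserving T₁ volume volume ∧ MeasurePreserving T₂ volume volume ∧
      dEnt ((Measure.map T₁ (densM f)).conv (Measure.map T₂ (densM g))) ≤
        n * Kc + max (dEnt (densM f)) (dEnt (densM g)) := by
  obtain ⟨x1, hp1, hx1⟩ := exists_near_max hf h1
  obtain ⟨x2, hp2, hx2⟩ := exists_near_max hg h2
  obtain ⟨T₁, f', y1, b1, hT1, hf', h1', hy1, hx1', hm1, hs1⟩ := transfer hn hf h1 hx1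
  obtain ⟨T₂, g', y2, b2, hT2, hg', h2', hy2, hx2', hm2, hs2⟩ := transfer hn hg h2 hx2
  refine ⟨T₁, T₂, hT1, hT2, ?_⟩
  rw [hm1, hm2]
  have hn0 : (0 : ℝ) < n := by exact_mod_cast hn
  have hn1 : (1 : ℝ) ≤ n := by exact_mod_cast hn
  obtain ⟨_, ef, _⟩ := lc_ent hf h1 hx1
  obtain ⟨_, eg, _⟩ := lc_ent hg h2 hx2
  rw [Real.log_mul (by norm_num) hp1.ne'] at ef
  rw [Real.log_mul (by norm_num) hp2.ne'] at eg
  have df : dEnt (densM f) = -∫ x, f x * Real.log (f x) := dEnt_withDensity hf.1 (lc_aemeasurable hf)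
  have dg : dEnt (densM g) = -∫ x, g x * Real.log (g x) := dEnt_withDensity hg.1 (lc_aemeasurable hg)
  rw [← df] at ef
  rw [← dg] at eg
  set m := min (f x1) (g x2) with hm
  have hmpos : 0 < m := lt_min hp1 hp2
  have hmlog : -Real.log m ≤ Real.log 2 + max (dEnt (densM f)) (dEnt (densM g)) := by
    rcases min_cases (f x1) (g x2) with h | h
    · rw [hm, h.1]; linarith [le_max_left (dEnt (densM f)) (dEnt (densM g))]
    · rw [hm, h.1]; linarith [le_max_right (dEnt (densM f)) (dEnt (densM g))]
  set M : ℝ := (1320 ^ n : ℝ)⁻¹ * m with hM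
  have hMpos : 0 < M := by positivity
  set s : ℝ := M ^ ((n : ℝ)⁻¹) with hs
  have hspos : 0 < s := by positivity
  have hsn : s ^ n = M := Real.rpow_inv_natCast_pow hMpos.le (by omega)
  have hslog : n * Real.log s = -(n * Real.log 1320) + Real.log m := by
    have : Real.log (s ^ n) = Real.log M := by rw [hsn]
    rw [Real.log_pow, hM, Real.log_mul (by positivity) hmpos.ne', Real.log_inv, Real.log_pow] at this
    exact_mod_cast this
  have c1 := hs1 s hspos.le (by
    rw [hsn, hM]; gcongr; exact min_le_left _ _)
  have c2 := hs2 s hspos.le (by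
    rw [hsn, hM]; gcongr; exact min_le_right _ _)
  set r : (EuclideanSpace ℝ (Fin n)) → ℝ := fun z => (convE f' g' z).toReal with hr
  have hr0 : ∀ z, 0 ≤ r z := fun z => ENNReal.toReal_nonneg
  have hrm : Measurable r := (convE_measurable hf' hg').ennreal_toReal
  have hre : ∀ z, convE f' g' z = ENNReal.ofReal (r z) := fun z =>
    (ENNReal.ofReal_toReal (ne_top_of_le_ne_top ENNReal.ofReal_ne_top (convE_le h2' hx1' z))).symm
  have hconv : (densM f').conv (densM g') = densM r := by
    rw [conv_eq hf' hg', densM]; congr 1; ext z; exact hre z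
  obtain ⟨z0, hz0⟩ := exists_high hr0 hrm h1' h2' hf' hg' hconv hspos
    (by positivity : (0 : ℝ) < (6600000 ^ n : ℝ)⁻¹) b1 b2 c1 c2
  have hρ : 0 < ((6600000 ^ n : ℝ)⁻¹) ^ 2 / (2 * (π / (s ^ 2 / 4)) ^ ((n : ℝ) / 2)) := by positivity
  have hfin := two_body hf' hg' h1' h2' hx1' hx2' hr0 hrm hre (lt_of_lt_of_le hρ hz0)
  have hl := Real.log_le_log hρ hz0
  have e1 : π / (s ^ 2 / 4) = (4 * π) / s ^ 2 := by field_simp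
  rw [Real.log_div (by positivity) (by positivity), Real.log_mul (by norm_num) (by positivity),
    Real.log_rpow (by positivity), e1, Real.log_div (by positivity) (by positivity), Real.log_pow, Real.log_pow,
    Real.log_inv, Real.log_pow] at hl
  push_cast at hl
  have hl2 : (n : ℝ) / 2 * (Real.log (4 * π) - 2 * Real.log s) = n * (Real.log (4 * π) / 2) - n * Real.log s := by ring
  rw [hl2, hslog] at hl
  have hlog2 : 0 < Real.log 2 := Real.log_pos (by norm_num)
  have h3 : 3 * Real.log 2 ≤ n * (3 * Real.log 2) := by nlinarith
  rw [Kc]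
  linarith
end PartH4

/-- Reverse entropy power inequality for log-concave random vectors:
there is a universal constant `C` such that for any two independent log-concave
random vectors `X, Y` in ℝⁿ, one can find affine volume-preserving maps `u₁, u₂`
with `N(u₁(X) + u₂(Y)) ≤ C (N(X) + N(Y))`. -/
theorem reverse_entropy_power_inequality :
    ∃ C : ℝ, 0 < C ∧
    ∀ (n : ℕ), 1 ≤ n →
    ∀ (Ω : Type) [MeasureSpace Ω], IsProbabilityMeasure (ℙ : Measure Ω) →
    ∀ (X Y : Ω → EuclideanSpace ℝ (Fin n))
      (f g : EuclideanSpace ℝ (Fin n) → ℝ),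
      Measurable X → Measurable Y →
      IsLogConcave f → IsLogConcave g →
      Measure.map X (ℙ : Measure Ω) = volume.withDensity (fun x => ENNReal.ofReal (f x)) →
      Measure.map Y (ℙ : Measure Ω) = volume.withDensity (fun x => ENNReal.ofReal (g x)) →
      ProbabilityTheory.IndepFun X Y (ℙ : Measure Ω) →
      ∃ (u₁ u₂ : EuclideanSpace ℝ (Fin n) →ᵃ[ℝ] EuclideanSpace ℝ (Fin n)),
        MeasurePreserving u₁ volume volume ∧
        MeasurePreserving u₂ volume volume ∧
        entPow (Measure.map (fun ω => u₁ (X ω) + u₂ (Y ω)) (ℙ : Measure Ω)) ≤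
          C * (entPow (Measure.map X (ℙ : Measure Ω)) + entPow (Measure.map Y (ℙ : Measure Ω))) := by
  refine ⟨Real.exp (2 * Kc), Real.exp_pos _, ?_⟩
  intro n hn Ω _ hP X Y f g hX hY hf hg hXf hYg hind
  have h1 : ∫⁻ x, ENNReal.ofReal (f x) = 1 := by
    have := (Measure.isProbabilityMeasure_map (μ := (ℙ : Measure Ω)) hX.aemeasurable).measure_univ
    rwa [hXf, withDensity_apply _ MeasurableSet.univ, Measure.restrict_univ] at this
  have h2 : ∫⁻ x, ENNReal.ofReal (g x) = 1 := by
    have := (Measure.isProbabilityMeasure_map (μ := (ℙ : Measure Ω)) hY.aemeasurable).measure_univ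
    rwa [hYg, withDensity_apply _ MeasurableSet.univ, Measure.restrict_univ] at this
  obtain ⟨T₁, T₂, hT1, hT2, hmain⟩ := core hn hf hg h1 h2
  refine ⟨T₁.toAffineMap, T₂.toAffineMap, hT1, hT2, ?_⟩
  have hn0 : (0 : ℝ) < n := by exact_mod_cast hn
  have hsum : Measure.map (fun ω => T₁ (X ω) + T₂ (Y ω)) (ℙ : Measure Ω) =
      (Measure.map T₁ (densM f)).conv (Measure.map T₂ (densM g)) := by
    have := (hind.comp hT1.measurable hT2.measurable).map_add_eq_map_conv_map
      (hT1.measurable.comp hX) (hT2.measurable.comp hY)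
    rw [← Measure.map_map hT1.measurable hX, ← Measure.map_map hT2.measurable hY, hXf, hYg] at this
    exact this
  change entPow (Measure.map (fun ω => T₁ (X ω) + T₂ (Y ω)) (ℙ : Measure Ω)) ≤ _
  rw [hsum, hXf, hYg]
  change entPow _ ≤ _ * (entPow (densM f) + entPow (densM g))
  simp only [entPow]
  have h3 : 2 * dEnt ((Measure.map T₁ (densM f)).conv (Measure.map T₂ (densM g))) / n ≤
      2 * Kc + 2 * max (dEnt (densM f)) (dEnt (densM g)) / n := by
    have e : 2 * Kc + 2 * max (dEnt (densM f)) (dEnt (densM g)) / n =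
      2 * (n * Kc + max (dEnt (densM f)) (dEnt (densM g))) / n := by field_simp
    rw [e]; gcongr
  refine (Real.exp_le_exp.2 h3).trans ?_
  rw [Real.exp_add]
  gcongr
  rcases max_cases (dEnt (densM f)) (dEnt (densM g)) with h | h
  · rw [h.1]; linarith [Real.exp_pos (2 * dEnt (densM g) / n)]
  · rw [h.1]; linarith [Real.exp_pos (2 * dEnt (densM f) / n)]
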